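/- Let n ∈ ℕ, E a complex Banach space, s ∈ ℝ, 0 < p < ∞, 0 < q ≤ ∞, and let S ∈ ℤ with S ≥ −1 and S ≥ ⌊s⌋. Let ε > 0 and Ψ, ψ ∈ S(ℝ^n) satisfy |Ψ(x)| > 0 for |x| < 2ε, |ψ(x)| > 0 for ε/2 < |x| < 2ε, and D^α ψ(0) = 0 for all multi-indices |α| ≤ S. Then there exist constants c₁, c₂ > 0 such that for all f ∈ F^s_{p,q}(E): c₁ ‖f|F^s_{p,q}(E)‖ ≤ ‖(Ψ f̂)ˇ|L_p(E)‖ + ‖ (Σ_{j≥1} 2^{jsq} ‖(ψ(2^{−j}·) f̂)ˇ(·)‖_E^q)^{1/q} |L_p‖ ≤ c₂ ‖f|F^s_{p,q}(E)‖ (supremum over j if q = ∞). Moreover, an f ∈ S'(ℝ^n,E) belongs to F^s_{p,q}(E) if and only if ‖(Ψ f̂)ˇ|L_p(E)‖ + ‖ (Σ_{j≥1} 2^{jsq} ‖(ψ(2^{−j}·) f̂)ˇ(·)‖_E^q)^{1/q} |L_p‖ < ∞. -/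

import Mathlib

noncomputable section

open MeasureTheory Filter Metric Real Set SchwartzMap
open scoped ENNReal NNReal Topology FourierTransform

/-- Euclidean space ℝⁿ. -/
abbrev Rn (n : ℕ) : Type := EuclideanSpace ℝ (Fin n)

/-- The Schwartz space 𝓢(ℝⁿ, ℂ). -/
abbrev Sch (n : ℕ) : Type := SchwartzMap (Rn n) ℂ

/-- Partial derivative in the `i`-th coordinate direction. -/
def pd {F : Type*} [NormedAddCommGroup F] [NormedSpace ℝ F] {n : ℕ} (i : Fin n)
    (g : Rn n → F) : Rn n → F :=
  fun x => lineDeriv ℝ g x (EuclideanSpace.single i (1 : ℝ))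

/-- Multi-index derivative `D^α = ∂₁^{α₁} ⋯ ∂ₙ^{αₙ}`. -/
def mderiv {F : Type*} [NormedAddCommGroup F] [NormedSpace ℝ F] {n : ℕ} (α : Fin n → ℕ)
    (g : Rn n → F) : Rn n → F :=
  (List.finRange n).foldr (fun i h => (pd i)^[α i] h) g

/-- The order `|α|` of a multi-index. -/
def mdeg {n : ℕ} (α : Fin n → ℕ) : ℕ := ∑ i, α i

/-- The Schwartz seminorm `‖φ‖_{K,L} = sup_x (1+|x|²)^{K/2} ∑_{|α| ≤ L} |D^α φ(x)|`. -/
def schSemi {n : ℕ} (K L : ℕ) (φ : Sch n) : ℝ :=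
  ⨆ x : Rn n, (1 + ‖x‖ ^ 2) ^ ((K : ℝ) / 2) *
    ∑ α : Fin n → Fin (L + 1), if mdeg (fun i => (α i : ℕ)) ≤ L
      then ‖mderiv (fun i => (α i : ℕ)) (fun y => φ y) x‖ else 0

/-- `E`-valued tempered distributions: linear maps `𝓢(ℝⁿ) → E` bounded by some
Schwartz seminorm. -/
structure TDist (n : ℕ) (E : Type*) [NormedAddCommGroup E] [NormedSpace ℂ E] where
  toFun : Sch n →ₗ[ℂ] E
  bound : ∃ (c : ℝ) (K L : ℕ), ∀ φ : Sch n, ‖toFun φ‖ ≤ c * schSemi K L φ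

namespace Aux

lemma hasTemperateGrowth_sub_left {n : ℕ} (x : Rn n) :
    Function.HasTemperateGrowth (fun y : Rn n => x - y) := by
  apply Function.HasTemperateGrowth.of_fderiv (k := 1) (C := ‖x‖ + 1)
  · have h : (fderiv ℝ (fun y : Rn n => x - y)) =
        fun _ : Rn n => -(ContinuousLinearMap.id ℝ (Rn n)) := by
      ext1 y
      rw [fderiv_const_sub]
      simp
    rw [h]
    exact .const _
  · exact (differentiable_const x).sub differentiable_id
  · intro y
    have h1 : ‖x - y‖ ≤ ‖x‖ + ‖y‖ := norm_sub_le x y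
    have h2 : (0:ℝ) ≤ ‖y‖ := norm_nonneg y
    have h3 : (0:ℝ) ≤ ‖x‖ := norm_nonneg x
    calc ‖x - y‖ ≤ ‖x‖ + ‖y‖ := h1
      _ ≤ (‖x‖ + 1) * (1 + ‖y‖) ^ 1 := by nlinarith

lemma antilipschitz_sub_left {n : ℕ} (x : Rn n) :
    AntilipschitzWith 1 (fun y : Rn n => x - y) := by
  refine (Isometry.antilipschitz ?_)
  intro y z
  simp only [edist_dist, dist_eq_norm, sub_sub_sub_cancel_left, norm_sub_rev]

end Aux

/-- The Schwartz function `y ↦ ψ(x - y)`. -/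
def shiftReflect {n : ℕ} (ψ : Sch n) (x : Rn n) : Sch n :=
  SchwartzMap.compCLMOfAntilipschitz (𝕜 := ℝ)
    (Aux.hasTemperateGrowth_sub_left x) (Aux.antilipschitz_sub_left x) ψ

/-- The dilated Schwartz function `ψ(t ·)` (junk value `0` when `t = 0`). -/
def dilate {n : ℕ} (ψ : Sch n) (t : ℝ) : Sch n :=
  if h : t = 0 then 0 else
    SchwartzMap.compCLM (𝕜 := ℝ) (g := fun y : Rn n => t • y)
      (by
        have := (t • ContinuousLinearMap.id ℝ (Rn n)).hasTemperateGrowth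
        exact this)
      (⟨1, |t|⁻¹, fun y => by
        have ht : 0 < |t| := abs_pos.mpr h
        have : ‖t • y‖ = |t| * ‖y‖ := by rw [norm_smul]; simp [Real.norm_eq_abs]
        rw [pow_one, this]
        rw [mul_add, mul_one]
        have : |t|⁻¹ * (|t| * ‖y‖) = ‖y‖ := by field_simp
        nlinarith [norm_nonneg y, inv_pos.mpr ht]⟩) ψ

/-- Fourier transform on Schwartz space. -/
def fourierS {n : ℕ} (φ : Sch n) : Sch n := FourierTransform.fourierCLE ℂ (Sch n) φ

/-- Inverse Fourier transform on Schwartz space. -/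
def invFourierS {n : ℕ} (φ : Sch n) : Sch n := (FourierTransform.fourierCLE ℂ (Sch n)).symm φ

variable {n : ℕ} {E : Type*} [NormedAddCommGroup E] [NormedSpace ℂ E]

/-- Convolution `(ψ * f)(x) := (2π)^{-n/2} f(ψ(x - ·))` of a Schwartz function with an
`E`-valued tempered distribution. -/
def tdConv (ψ : Sch n) (f : TDist n E) : Rn n → E :=
  fun x => ((2 * π) ^ (-(n : ℝ) / 2) : ℝ) • f.toFun (shiftReflect ψ x)

/-- The operator `f ↦ (φ f̂)ˇ = φ̌ * f`. -/
def mOp (φ : Sch n) (f : TDist n E) : Rn n → E := tdConv (invFourierS φ) f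

/-- `L_p`-norm (in `[0,∞]`) of an `ℝ≥0∞`-valued function. -/
def lpNormENN {n : ℕ} (p : ℝ≥0∞) (g : Rn n → ℝ≥0∞) : ℝ≥0∞ :=
  if p = ∞ then essSup g volume else (∫⁻ x, (g x) ^ p.toReal) ^ (1 / p.toReal)

/-- `ℓ_q`-norm (in `[0,∞]`) of a sequence, with the usual modification for `q = ∞`. -/
def lqSum (q : ℝ≥0∞) (a : ℕ → ℝ≥0∞) : ℝ≥0∞ :=
  if q = ∞ then ⨆ j, a j else (∑' j, (a j) ^ q.toReal) ^ (1 / q.toReal)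

/-- A smooth dyadic resolution of unity. -/
structure SmoothResolution (n : ℕ) (φ : ℕ → Sch n) : Prop where
  supp0 : Function.support (φ 0) ⊆ {ξ : Rn n | ‖ξ‖ ≤ 2}
  suppj : ∀ j : ℕ, 0 < j →
    Function.support (φ j) ⊆ {ξ : Rn n | 2 ^ ((j : ℝ) - 1) ≤ ‖ξ‖ ∧ ‖ξ‖ ≤ 2 ^ ((j : ℝ) + 1)}
  sum_eq : ∀ ξ : Rn n, ∑' j : ℕ, φ j ξ = 1
  deriv_bound : ∀ α : Fin n → ℕ, ∃ c : ℝ, ∀ (j : ℕ) (ξ : Rn n),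
    ‖mderiv α (fun y => φ j y) ξ‖ ≤ c * 2 ^ (-(j : ℝ) * (mdeg α : ℝ))

/-- The Besov quasi-norm `‖f | B^s_{p,q}(E)‖` w.r.t. the resolution of unity `φ`. -/
def besovNorm (s : ℝ) (p q : ℝ≥0∞) (φ : ℕ → Sch n) (f : TDist n E) : ℝ≥0∞ :=
  lqSum q fun j => (2 : ℝ≥0∞) ^ ((j : ℝ) * s) * eLpNorm (mOp (φ j) f) p volume

/-- The Triebel–Lizorkin quasi-norm `‖f | F^s_{p,q}(E)‖` w.r.t. the resolution of unity `φ`. -/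
def triebelNorm (s : ℝ) (p q : ℝ≥0∞) (φ : ℕ → Sch n) (f : TDist n E) : ℝ≥0∞ :=
  lpNormENN p fun x =>
    lqSum q fun j => (2 : ℝ≥0∞) ^ ((j : ℝ) * s) * (‖mOp (φ j) f x‖₊ : ℝ≥0∞)

variable {n : ℕ} {E : Type*} [NormedAddCommGroup E] [NormedSpace ℂ E]

/-- `‖(Ψ f̂)ˇ|L_p(E)‖ + (∑_{j≥1} 2^{jsq} ‖(ψ(2^{-j}·) f̂)ˇ|L_p(E)‖^q)^{1/q}`. -/
def besovPsiNorm (s : ℝ) (p q : ℝ≥0∞) (Ψ ψ : Sch n) (f : TDist n E) : ℝ≥0∞ :=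
  eLpNorm (mOp Ψ f) p volume +
    lqSum q fun j => (2 : ℝ≥0∞) ^ (((j : ℝ) + 1) * s) *
      eLpNorm (mOp (dilate ψ ((2 : ℝ) ^ (-((j : ℝ) + 1)))) f) p volume

/-- `‖(Ψ f̂)ˇ|L_p(E)‖ + ‖(∑_{j≥1} 2^{jsq} ‖(ψ(2^{-j}·) f̂)ˇ(·)‖_E^q)^{1/q}|L_p‖`. -/
def triebelPsiNorm (s : ℝ) (p q : ℝ≥0∞) (Ψ ψ : Sch n) (f : TDist n E) : ℝ≥0∞ :=
  eLpNorm (mOp Ψ f) p volume +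
    lpNormENN p fun x => lqSum q fun j => (2 : ℝ≥0∞) ^ (((j : ℝ) + 1) * s) *
      (‖mOp (dilate ψ ((2 : ℝ) ^ (-((j : ℝ) + 1)))) f x‖₊ : ℝ≥0∞)

section
namespace TL

lemma holder_jensen {α : Type*} [MeasurableSpace α] (μ : Measure α) {q : ℝ} (hq : 1 < q)
    (κ a : α → ℝ≥0∞) (hκ : Measurable κ) (ha : Measurable a) :
    (∫⁻ x, κ x * a x ∂μ) ^ q ≤ (∫⁻ x, κ x ∂μ) ^ (q - 1) * ∫⁻ x, κ x * a x ^ q ∂μ := by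
  have hc := Real.HolderConjugate.conjExponent hq
  set q' := Real.conjExponent q
  have hq0 : 0 < q := by linarith
  have hq'0 : 0 < q' := hc.symm.pos
  have h := ENNReal.lintegral_mul_le_Lp_mul_Lq μ hc.symm (f := fun x => κ x ^ (1 / q'))
    (g := fun x => κ x ^ (1 / q) * a x) (by fun_prop) (by fun_prop)
  have e1 : ∀ x, (κ x ^ (1 / q')) * (κ x ^ (1 / q) * a x) = κ x * a x := by
    intro x
    rw [← mul_assoc, ← ENNReal.rpow_add_of_nonneg _ _ (by positivity) (by positivity)]
    have : 1 / q' + 1 / q = 1 := by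
      have := hc.inv_add_inv_eq_one; simp only [one_div]; linarith
    rw [this, ENNReal.rpow_one]
  have e2 : ∀ x, (κ x ^ (1 / q')) ^ q' = κ x := by
    intro x; rw [← ENNReal.rpow_mul, one_div_mul_cancel hq'0.ne', ENNReal.rpow_one]
  have e3 : ∀ x, (κ x ^ (1 / q) * a x) ^ q = κ x * a x ^ q := by
    intro x
    rw [ENNReal.mul_rpow_of_nonneg _ _ hq0.le, ← ENNReal.rpow_mul, one_div_mul_cancel hq0.ne',
      ENNReal.rpow_one]
  simp only [Pi.mul_apply, e1, e2, e3] at h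
  calc _ ≤ _ := ENNReal.rpow_le_rpow h hq0.le
    _ = _ := by
      rw [ENNReal.mul_rpow_of_nonneg _ _ hq0.le, ← ENNReal.rpow_mul, ← ENNReal.rpow_mul,
        one_div_mul_cancel hq0.ne', ENNReal.rpow_one]
      congr 2
      have := hc.inv_add_inv_eq_one
      field_simp at this ⊢
      linarith

lemma tsum_jensen {ι : Type*} {q : ℝ} (hq : 1 < q) (κ a : ι → ℝ≥0∞) :
    (∑' x, κ x * a x) ^ q ≤ (∑' x, κ x) ^ (q - 1) * ∑' x, κ x * a x ^ q := by
  let _ : MeasurableSpace ι := ⊤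
  have := holder_jensen (Measure.count : Measure ι) hq κ a measurable_from_top measurable_from_top
  simpa [lintegral_count] using this

lemma tsum_rpow_le {ι : Type*} {q : ℝ} (hq : 0 < q) (hq1 : q ≤ 1) (a : ι → ℝ≥0∞) :
    (∑' x, a x) ^ q ≤ ∑' x, a x ^ q := by
  have hfin : ∀ s : Finset ι, (∑ x ∈ s, a x) ^ q ≤ ∑ x ∈ s, a x ^ q := by
    intro s
    classical
    induction s using Finset.induction_on with
    | empty => simp [hq]
    | insert b s hb ih =>
      rw [Finset.sum_insert hb, Finset.sum_insert hb]
      exact (ENNReal.rpow_add_le_add_rpow _ _ hq.le hq1).trans (by gcongr)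
  have : (∑' x, a x) ≤ (∑' x, a x ^ q) ^ (1 / q) := by
    rw [ENNReal.tsum_eq_iSup_sum]
    refine iSup_le fun s => ?_
    rw [one_div, ENNReal.le_rpow_inv_iff hq]
    exact (hfin s).trans (ENNReal.sum_le_tsum s)
  exact (ENNReal.le_rpow_inv_iff hq).1 (by rwa [one_div] at this)

lemma two_rpow_ne_zero (x : ℝ) : (2 : ℝ≥0∞) ^ x ≠ 0 := by simp
lemma two_rpow_ne_top (x : ℝ) : (2 : ℝ≥0∞) ^ x ≠ ∞ := by
  simp
lemma two_rpow_add (x y : ℝ) : (2 : ℝ≥0∞) ^ (x + y) = 2 ^ x * 2 ^ y :=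
  ENNReal.rpow_add _ _ (by simp) (by simp)
lemma two_rpow_le {x y : ℝ} (h : x ≤ y) : (2 : ℝ≥0∞) ^ x ≤ 2 ^ y :=
  ENNReal.rpow_le_rpow_of_exponent_le (by simp) h
lemma two_rpow_ofReal (x : ℝ) : (2 : ℝ≥0∞) ^ x = ENNReal.ofReal ((2:ℝ) ^ x) := by
  rw [← ENNReal.ofReal_rpow_of_pos (by norm_num)]; simp

lemma tsum_nat_geom {δ : ℝ} (hδ : 0 < δ) :
    (∑' i : ℕ, (2 : ℝ≥0∞) ^ (-(δ * i))) < ∞ := by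
  have : ∀ i : ℕ, (2 : ℝ≥0∞) ^ (-(δ * i)) = ((2:ℝ≥0∞) ^ (-δ)) ^ i := by
    intro i
    rw [← ENNReal.rpow_natCast, ← ENNReal.rpow_mul]; congr 1; ring
  simp_rw [this]
  rw [ENNReal.tsum_geometric]
  have h1 : (2:ℝ≥0∞) ^ (-δ) < 1 := ENNReal.rpow_lt_one_of_one_lt_of_neg (by simp) (by linarith)
  simp [h1]

lemma tsum_int_geom {δ : ℝ} (hδ : 0 < δ) :
    (∑' m : ℤ, (2 : ℝ≥0∞) ^ (-(δ * |(m : ℝ)|))) < ∞ := by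
  have h := tsum_nat_geom hδ
  have : ∀ m : ℤ, (2 : ℝ≥0∞) ^ (-(δ * |(m : ℝ)|)) ≤
      ∑' p : ℕ × Bool, if (if p.2 then (p.1:ℤ) else -(p.1:ℤ)) = m then
        (2 : ℝ≥0∞) ^ (-(δ * p.1)) else 0 := by
    intro m
    refine le_trans ?_ (ENNReal.le_tsum (m.natAbs, decide (0 ≤ m)))
    have h1 : (if decide (0 ≤ m) = true then (m.natAbs:ℤ) else -(m.natAbs:ℤ)) = m := by
      simp only [decide_eq_true_eq]
      split_ifs <;> omega
    simp only [h1, if_true]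
    have : ((m.natAbs : ℕ) : ℝ) = |(m:ℝ)| := by
      rw [Nat.cast_natAbs]; simp
    rw [this]
  refine (ENNReal.tsum_le_tsum this).trans_lt ?_
  rw [ENNReal.tsum_comm]
  simp only [tsum_ite_eq']
  rw [ENNReal.tsum_prod (f := fun (i : ℕ) (_ : Bool) => (2 : ℝ≥0∞) ^ (-(δ * i)))]
  simp only [tsum_bool]
  rw [ENNReal.tsum_add]
  exact ENNReal.add_lt_top.2 ⟨h, h⟩

def gk (δ : ℝ) (j k : ℕ) : ℝ≥0∞ := (2 : ℝ≥0∞) ^ (-(δ * |(j : ℝ) - k|))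

def geomC (δ : ℝ) : ℝ≥0∞ := ∑' m : ℤ, (2 : ℝ≥0∞) ^ (-(δ * |(m : ℝ)|))

lemma tsum_gk_le (δ : ℝ) (j : ℕ) : ∑' k, gk δ j k ≤ geomC δ := by
  have := ENNReal.tsum_comp_le_tsum_of_injective (f := fun k : ℕ => (j : ℤ) - k)
    (fun a b h => by simpa using h) (fun m : ℤ => (2 : ℝ≥0∞) ^ (-(δ * |(m : ℝ)|)))
  simpa [gk, geomC] using this

lemma gk_comm (δ : ℝ) (j k : ℕ) : gk δ j k = gk δ k j := by
  rw [gk, gk, abs_sub_comm]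

lemma lqSum_mono (q : ℝ≥0∞) {a b : ℕ → ℝ≥0∞} (h : ∀ j, a j ≤ b j) : lqSum q a ≤ lqSum q b := by
  unfold lqSum
  split_ifs
  · exact iSup_mono h
  · have : 0 ≤ q.toReal := ENNReal.toReal_nonneg
    gcongr with j; exact h j

lemma lqSum_const_mul (q : ℝ≥0∞) (hq : 0 < q) (c : ℝ≥0∞) (a : ℕ → ℝ≥0∞) :
    lqSum q (fun j => c * a j) = c * lqSum q a := by
  unfold lqSum
  split_ifs with h
  · rw [ENNReal.mul_iSup]
  · have h0 : 0 < q.toReal := ENNReal.toReal_pos hq.ne' h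
    simp_rw [ENNReal.mul_rpow_of_nonneg _ _ h0.le, ENNReal.tsum_mul_left]
    rw [ENNReal.mul_rpow_of_nonneg _ _ (by positivity), ← ENNReal.rpow_mul,
      mul_one_div_cancel h0.ne', ENNReal.rpow_one]

lemma lqSum_rpow (q : ℝ≥0∞) (hq : 0 < q) {r : ℝ} (hr : 0 < r) (a : ℕ → ℝ≥0∞) :
    lqSum q (fun j => a j ^ (1 / r)) = (lqSum (q / ENNReal.ofReal r) a) ^ (1 / r) := by
  have hr' : ENNReal.ofReal r ≠ 0 := by simpa using hr
  unfold lqSum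
  by_cases h : q = ∞
  · have : q / ENNReal.ofReal r = ∞ := by rw [h]; exact ENNReal.top_div_of_ne_top (by simp)
    rw [if_pos h, if_pos this]
    exact ((ENNReal.orderIsoRpow (1 / r) (by positivity)).map_iSup a).symm
  · have : q / ENNReal.ofReal r ≠ ∞ := ENNReal.div_ne_top h hr'
    rw [if_neg h, if_neg this]
    have e : (q / ENNReal.ofReal r).toReal = q.toReal / r := by
      rw [ENNReal.toReal_div, ENNReal.toReal_ofReal hr.le]
    have h0 : 0 < q.toReal := ENNReal.toReal_pos hq.ne' h
    rw [e, ← ENNReal.rpow_mul]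
    congr 1
    · congr 1; ext j; rw [← ENNReal.rpow_mul]; congr 1; field_simp
    · field_simp

lemma lqSum_conv (q : ℝ≥0∞) (hq : 0 < q) {δ : ℝ} (hδ : 0 < δ) :
    ∃ C : ℝ≥0∞, C < ∞ ∧ ∀ a : ℕ → ℝ≥0∞,
      lqSum q (fun j => ∑' k, gk δ j k * a k) ≤ C * lqSum q a := by
  have hfin : ∀ {d : ℝ}, 0 < d → geomC d < ∞ := fun hd => tsum_int_geom hd
  by_cases h : q = ∞
  · refine ⟨geomC δ, hfin hδ, fun a => ?_⟩
    simp only [lqSum, if_pos h]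
    refine iSup_le fun j => ?_
    calc _ ≤ ∑' k, gk δ j k * ⨆ i, a i := by
          gcongr with k; exact le_iSup a k
      _ ≤ _ := by rw [ENNReal.tsum_mul_right]; gcongr; exact tsum_gk_le δ j
  have h0 : 0 < q.toReal := ENNReal.toReal_pos hq.ne' h
  suffices H : ∃ C : ℝ≥0∞, C < ∞ ∧ ∀ a : ℕ → ℝ≥0∞,
      (∑' j, (∑' k, gk δ j k * a k) ^ q.toReal) ≤ C * ∑' k, a k ^ q.toReal by
    obtain ⟨C, hC, H⟩ := H
    refine ⟨C ^ (1 / q.toReal), ENNReal.rpow_lt_top_of_nonneg (by positivity) hC.ne, fun a => ?_⟩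
    simp only [lqSum, if_neg h]
    rw [← ENNReal.mul_rpow_of_nonneg _ _ (by positivity)]
    gcongr; exact H a
  set t := q.toReal
  rcases le_or_gt t 1 with h1 | h1
  · refine ⟨geomC (δ * t), hfin (by positivity), fun a => ?_⟩
    have e : ∀ j k, (gk δ j k * a k) ^ t = gk (δ * t) j k * a k ^ t := by
      intro j k
      rw [ENNReal.mul_rpow_of_nonneg _ _ h0.le, gk, ← ENNReal.rpow_mul, gk]; congr 2; ring
    calc _ ≤ ∑' j, ∑' k, (gk δ j k * a k) ^ t := by
          gcongr with j; exact tsum_rpow_le h0 h1 _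
      _ = ∑' k, (∑' j, gk (δ * t) k j) * a k ^ t := by
          rw [ENNReal.tsum_comm]
          congr 1; ext k
          rw [← ENNReal.tsum_mul_right]; congr 1; ext j; rw [e, gk_comm]
      _ ≤ ∑' k, geomC (δ * t) * a k ^ t := by gcongr with k; exact tsum_gk_le _ k
      _ = _ := ENNReal.tsum_mul_left
  · refine ⟨geomC δ ^ (t - 1) * geomC δ, ENNReal.mul_lt_top
      (ENNReal.rpow_lt_top_of_nonneg (by linarith) (hfin hδ).ne) (hfin hδ), fun a => ?_⟩
    calc _ ≤ ∑' j, geomC δ ^ (t - 1) * ∑' k, gk δ j k * a k ^ t := by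
          gcongr with j
          refine (tsum_jensen h1 _ _).trans ?_
          have : 0 ≤ t - 1 := by linarith
          gcongr; exact tsum_gk_le _ j
      _ = geomC δ ^ (t - 1) * ∑' k, (∑' j, gk δ k j) * a k ^ t := by
          rw [ENNReal.tsum_mul_left, ENNReal.tsum_comm]
          congr 2; ext k
          rw [← ENNReal.tsum_mul_right]; congr 1; ext j; rw [gk_comm]
      _ ≤ geomC δ ^ (t - 1) * ∑' k, geomC δ * a k ^ t := by gcongr with k; exact tsum_gk_le _ k
      _ = _ := by rw [ENNReal.tsum_mul_left, mul_assoc]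

end TL
end

section
namespace TL

def av {n : ℕ} (r : ℝ) (u : Rn n → ℝ≥0∞) (x : Rn n) : ℝ≥0∞ :=
  (volume (closedBall x r))⁻¹ * ∫⁻ z in closedBall x r, u z

/-- Hardy-Littlewood maximal function over dyadic radii, truncated. -/
def MK {n : ℕ} (K : ℕ) (u : Rn n → ℝ≥0∞) (x : Rn n) : ℝ≥0∞ :=
  ⨆ m : ℤ, ⨆ (_ : m ≤ K), av ((2:ℝ) ^ m) u x

def HM {n : ℕ} (u : Rn n → ℝ≥0∞) (x : Rn n) : ℝ≥0∞ :=
  ⨆ m : ℤ, av ((2:ℝ) ^ m) u x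

lemma vol_cb_pos {n : ℕ} (x : Rn n) {r : ℝ} (hr : 0 < r) : volume (closedBall x r) ≠ 0 :=
  (measure_closedBall_pos volume x hr).ne'

lemma vol_cb_top {n : ℕ} (x : Rn n) (r : ℝ) : volume (closedBall x r) ≠ ∞ :=
  measure_closedBall_lt_top.ne

lemma weak_MK {n : ℕ} (K : ℕ) (u : Rn n → ℝ≥0∞) (l : ℝ≥0∞) :
    l * volume {x | l < MK K u x} ≤ ENNReal.ofReal (5 ^ n) * ∫⁻ z, u z := by
  set t := {x | l < MK K u x} with ht
  have h1 : ∀ x : Rn n, ∃ m : ℤ, x ∈ t → m ≤ K ∧ l < av ((2:ℝ) ^ m) u x := by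
    intro x
    by_cases hx : x ∈ t
    · simp only [ht, mem_setOf_eq, MK, lt_iSup_iff] at hx
      obtain ⟨m, hm, hl⟩ := hx
      exact ⟨m, fun _ => ⟨hm, hl⟩⟩
    · exact ⟨0, fun h => absurd h hx⟩
  choose m hm using h1
  obtain ⟨s, hst, hdis, hcov⟩ := Vitali.exists_disjoint_subfamily_covering_enlargement_closedBall
    t (fun x : Rn n => x) (fun x => (2:ℝ) ^ (m x)) (2 ^ (K:ℤ))
    (fun a ha => zpow_le_zpow_right₀ (by norm_num) (hm a ha).1) 5 (by norm_num)
  have hcount : s.Countable := by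
    refine hdis.countable_of_nonempty_interior ?_
    intro a _
    refine ⟨a, ball_subset_interior_closedBall (mem_ball_self (by positivity))⟩
  have hsub : t ⊆ ⋃ b ∈ s, closedBall b (5 * (2:ℝ) ^ (m b)) := by
    intro a ha
    obtain ⟨b, hb, hab⟩ := hcov a ha
    exact mem_biUnion hb (hab (mem_closedBall_self (by positivity)))
  have hb : ∀ b ∈ s, l * volume (closedBall b (5 * (2:ℝ) ^ (m b))) ≤
      ENNReal.ofReal (5 ^ n) * ∫⁻ z in closedBall b ((2:ℝ) ^ (m b)), u z := by
    intro b hb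
    have h2 := (hm b (hst hb)).2.le
    have h3 : volume (closedBall (0 : Rn n) ((2:ℝ) ^ (m b))) = volume (closedBall b ((2:ℝ) ^ (m b))) :=
      (Measure.addHaar_closedBall_center volume b _).symm
    rw [Measure.addHaar_closedBall_mul_of_pos volume b (by norm_num), finrank_euclideanSpace_fin,
      h3, mul_left_comm]
    refine mul_le_mul' le_rfl ?_
    calc _ ≤ av ((2:ℝ) ^ m b) u b * volume (closedBall b ((2:ℝ) ^ (m b))) := mul_le_mul' h2 le_rfl
      _ = _ := by
        rw [av, mul_comm, ← mul_assoc, ENNReal.mul_inv_cancel (vol_cb_pos _ (by positivity))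
          (vol_cb_top _ _), one_mul]
  calc l * volume t ≤ l * ∑' b : s, volume (closedBall (b : Rn n) (5 * (2:ℝ) ^ (m b))) := by
        gcongr
        exact (measure_mono hsub).trans (measure_biUnion_le _ hcount _)
    _ = ∑' b : s, l * volume (closedBall (b : Rn n) (5 * (2:ℝ) ^ (m b))) := by
        rw [ENNReal.tsum_mul_left]
    _ ≤ ∑' b : s, ENNReal.ofReal (5 ^ n) * ∫⁻ z in closedBall (b : Rn n) ((2:ℝ) ^ (m b)), u z :=
        ENNReal.tsum_le_tsum fun b => hb b b.2
    _ = ENNReal.ofReal (5 ^ n) * ∫⁻ z in ⋃ b ∈ s, closedBall b ((2:ℝ) ^ (m b)), u z := by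
        rw [ENNReal.tsum_mul_left, lintegral_biUnion hcount (fun _ _ => measurableSet_closedBall) hdis]
    _ ≤ _ := mul_le_mul' le_rfl (setLIntegral_le_lintegral _ _)

lemma HM_eq {n : ℕ} (u : Rn n → ℝ≥0∞) (x : Rn n) : HM u x = ⨆ K : ℕ, MK K u x := by
  apply le_antisymm
  · refine iSup_le fun m => ?_
    refine le_trans ?_ (le_iSup _ m.toNat)
    exact le_iSup_of_le m (le_iSup_of_le (Int.self_le_toNat m) le_rfl)
  · exact iSup_le fun K => iSup_mono fun m => iSup_le fun _ => le_rfl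

lemma weak_HM {n : ℕ} (u : Rn n → ℝ≥0∞) (l : ℝ≥0∞) :
    l * volume {x | l < HM u x} ≤ ENNReal.ofReal (5 ^ n) * ∫⁻ z, u z := by
  have : {x | l < HM u x} = ⋃ K : ℕ, {x | l < MK K u x} := by
    ext x; simp [HM_eq, lt_iSup_iff]
  have hmono : Monotone fun K : ℕ => {x | l < MK K u x} := by
    intro K K' h x hx
    have h2 : MK K u x ≤ MK K' u x :=
      iSup_mono fun m => iSup_le fun hm => le_iSup_of_le (hm.trans (by exact_mod_cast h)) le_rfl
    exact lt_of_lt_of_le hx h2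
  rw [this, hmono.measure_iUnion, ENNReal.mul_iSup]
  exact iSup_le fun K => weak_MK K u l

lemma HM_mono {n : ℕ} {u v : Rn n → ℝ≥0∞} (h : ∀ x, u x ≤ v x) (x : Rn n) : HM u x ≤ HM v x := by
  refine iSup_mono fun m => ?_
  unfold av; gcongr; exact h _

lemma measurable_av {n : ℕ} (r : ℝ) {u : Rn n → ℝ≥0∞} (hu : Measurable u) : Measurable (av r u) := by
  have h0 : ∀ x : Rn n, volume (closedBall x r) = volume (closedBall (0 : Rn n) r) := fun x => by
    rw [Measure.addHaar_closedBall_center]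
  unfold av
  simp_rw [h0]
  refine Measurable.const_mul ?_ _
  have : ∀ x : Rn n, ∫⁻ z in closedBall x r, u z =
      ∫⁻ z, ({p : Rn n × Rn n | dist p.2 p.1 ≤ r}.indicator (fun p => u p.2)) (x, z) := by
    intro x
    rw [← lintegral_indicator measurableSet_closedBall]; rfl
  simp_rw [this]
  refine Measurable.lintegral_prod_right' (f := ({p : Rn n × Rn n | dist p.2 p.1 ≤ r}.indicator (fun p => u p.2))) ?_
  refine Measurable.indicator (hu.comp measurable_snd) ?_
  exact measurableSet_le (by fun_prop) (by fun_prop)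

lemma measurable_HM {n : ℕ} {u : Rn n → ℝ≥0∞} (hu : Measurable u) : Measurable (HM u) :=
  Measurable.iSup fun _ => measurable_av _ hu

lemma HM_le_add {n : ℕ} (u : Rn n → ℝ≥0∞) (hu : Measurable u) (l : ℝ≥0∞) (x : Rn n) :
    HM u x ≤ HM (fun y => {y | l < u y}.indicator u y) x + l := by
  refine iSup_le fun m => ?_
  refine le_trans ?_ (add_le_add_left (le_iSup _ m) _)
  have : ∀ y, u y ≤ {y | l < u y}.indicator u y + l := by
    intro y
    by_cases h : l < u y
    · simp [indicator, h]
    · simp only [indicator, mem_setOf_eq, h, if_false, zero_add]; exact not_lt.1 h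
  unfold av
  calc _ ≤ (volume (closedBall x ((2:ℝ) ^ m)))⁻¹ *
        ∫⁻ z in closedBall x ((2:ℝ) ^ m), ({y | l < u y}.indicator u z + l) := by
        gcongr; exact this _
    _ = _ := by
      rw [lintegral_add_right _ measurable_const, mul_add, setLIntegral_const, mul_comm l,
        ← mul_assoc (volume _)⁻¹ (volume _), ENNReal.inv_mul_cancel (vol_cb_pos _ (by positivity)) (vol_cb_top _ _), one_mul]

lemma weak_HM' {n : ℕ} (u : Rn n → ℝ≥0∞) (hu : Measurable u) (l : ℝ≥0∞) :
    l * volume {x | 2 * l < HM u x} ≤ ENNReal.ofReal (5 ^ n) * ∫⁻ z, {y | l < u y}.indicator u z := by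
  refine le_trans ?_ (weak_HM _ l)
  refine mul_le_mul' le_rfl (measure_mono ?_)
  intro x hx
  simp only [mem_setOf_eq] at hx ⊢
  by_contra h
  have h2 := HM_le_add u hu l x
  refine absurd (hx.trans_le h2) (not_lt.2 ?_)
  rw [two_mul]
  gcongr
  exact not_lt.1 h

lemma exists_dyadic {y : ℝ≥0∞} (h0 : y ≠ 0) (ht : y ≠ ∞) :
    ∃ m : ℤ, (2:ℝ≥0∞) ^ (m:ℝ) < y ∧ y ≤ 2 ^ ((m:ℝ) + 1) := by
  obtain ⟨m, hm⟩ := ENNReal.exists_mem_Ioc_zpow h0 ht (y := 2) (by norm_num) (by simp)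
  refine ⟨m, ?_, ?_⟩
  · rw [ENNReal.rpow_intCast]; exact hm.1
  · have := hm.2
    rw [← ENNReal.rpow_intCast] at this; simpa using this

lemma dyadic_upper {P : ℝ} (hP : 0 < P) (y : ℝ≥0∞) :
    y ^ P ≤ ∑' m : ℤ, if (2:ℝ≥0∞) ^ ((m:ℝ) + 1) < y then (2:ℝ≥0∞) ^ (((m:ℝ) + 2) * P) else 0 := by
  rcases eq_or_ne y 0 with rfl | h0
  · simp [hP]
  rcases eq_or_ne y ∞ with rfl | ht
  · have : (∑' m : ℤ, if (2:ℝ≥0∞) ^ ((m:ℝ) + 1) < ∞ then (2:ℝ≥0∞) ^ (((m:ℝ) + 2) * P) else 0) = ∞ := by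
      rw [eq_top_iff]
      calc ∞ = ∑' m : ℕ, (1 : ℝ≥0∞) := by
            rw [ENNReal.tsum_const_eq_top_of_ne_zero one_ne_zero]
        _ ≤ ∑' m : ℕ, (2:ℝ≥0∞) ^ (((m:ℝ) + 2) * P) := by
            gcongr with m
            exact ENNReal.one_le_rpow (by norm_num) (by positivity)
        _ = ∑' m : ℕ, (2:ℝ≥0∞) ^ ((((m:ℤ):ℝ) + 2) * P) := by simp
        _ ≤ ∑' m : ℤ, (2:ℝ≥0∞) ^ (((m:ℝ) + 2) * P) :=
            ENNReal.tsum_comp_le_tsum_of_injective (f := fun m : ℕ => (m:ℤ)) Nat.cast_injective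
              (fun m : ℤ => (2:ℝ≥0∞) ^ (((m:ℝ) + 2) * P))
        _ = _ := by
            congr 1; ext m; rw [if_pos (lt_top_iff_ne_top.2 (two_rpow_ne_top _))]
    rw [this]; exact le_top
  obtain ⟨m, h1, h2⟩ := exists_dyadic h0 ht
  refine le_trans ?_ (ENNReal.le_tsum (m - 1))
  have : (((m - 1 : ℤ) : ℝ) + 1) = m := by push_cast; ring
  rw [this, if_pos h1]
  have e : (((m - 1 : ℤ) : ℝ) + 2) = m + 1 := by push_cast; ring
  rw [e, ENNReal.rpow_mul]
  gcongr

lemma dyadic_lower {P : ℝ} (hP : 1 < P) (y : ℝ≥0∞) :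
    y * (∑' m : ℤ, if (2:ℝ≥0∞) ^ (m:ℝ) < y then (2:ℝ≥0∞) ^ ((m:ℝ) * (P - 1)) else 0)
      ≤ geomC (P - 1) * y ^ P := by
  have hg : geomC (P - 1) ≠ 0 := by
    have : (1:ℝ≥0∞) ≤ geomC (P - 1) := by
      refine le_trans ?_ (ENNReal.le_tsum (0:ℤ)); simp
    exact (lt_of_lt_of_le one_pos this).ne'
  rcases eq_or_ne y 0 with rfl | h0
  · simp
  rcases eq_or_ne y ∞ with rfl | ht
  · rw [ENNReal.top_rpow_of_pos (by linarith), ENNReal.mul_top hg]; exact le_top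
  obtain ⟨m0, h1, h2⟩ := exists_dyadic h0 ht
  have : (∑' m : ℤ, if (2:ℝ≥0∞) ^ (m:ℝ) < y then (2:ℝ≥0∞) ^ ((m:ℝ) * (P - 1)) else 0) ≤
      ∑' m : ℤ, (2:ℝ≥0∞) ^ ((m0:ℝ) * (P - 1)) * (2:ℝ≥0∞) ^ (-((P - 1) * |((m - m0 : ℤ):ℝ)|)) := by
    gcongr with m
    split_ifs with h
    · rw [← two_rpow_add]
      apply two_rpow_le
      have h3 : (2:ℝ≥0∞) ^ (m:ℝ) < 2 ^ ((m0:ℝ) + 1) := h.trans_le h2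
      have h4 : (m:ℝ) < m0 + 1 := by
        by_contra hc
        exact absurd h3 (not_lt.2 (two_rpow_le (not_lt.1 hc)))
      have h5 : m ≤ m0 := by
        have : m < m0 + 1 := by exact_mod_cast h4
        omega
      have h6 : (m:ℝ) ≤ m0 := by exact_mod_cast h5
      push_cast
      rw [abs_of_nonpos (by linarith)]
      apply le_of_eq; ring
    · exact zero_le
  have e0 := (Equiv.subRight m0).tsum_eq (fun m : ℤ => (2:ℝ≥0∞) ^ (-((P - 1) * |(m:ℝ)|)))
  simp only [Equiv.subRight_apply] at e0
  rw [ENNReal.tsum_mul_left, e0] at this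
  calc _ ≤ y * (2 ^ ((m0:ℝ) * (P - 1)) * geomC (P - 1)) := by gcongr; exact this
    _ ≤ y * (y ^ (P - 1) * geomC (P - 1)) := by
        rw [ENNReal.rpow_mul]
        have : 0 ≤ P - 1 := by linarith
        gcongr
    _ = geomC (P - 1) * y ^ P := by
        have : y ^ P = y ^ (1 + (P - 1)) := by congr 1; ring
        rw [this, ENNReal.rpow_add _ _ h0 ht, ENNReal.rpow_one]; ring

lemma strong_HM (n : ℕ) {P : ℝ} (hP : 1 < P) : ∃ C : ℝ≥0∞, C < ∞ ∧ ∀ u : Rn n → ℝ≥0∞, Measurable u →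
    ∫⁻ x, HM u x ^ P ≤ C * ∫⁻ x, u x ^ P := by
  refine ⟨2 ^ (2 * P) * (ENNReal.ofReal (5 ^ n) * geomC (P - 1)), ?_, fun u hu => ?_⟩
  · exact ENNReal.mul_lt_top (two_rpow_ne_top _).lt_top (ENNReal.mul_lt_top (by simp) (tsum_int_geom (by linarith)))
  have hM := measurable_HM hu
  have key : ∀ m : ℤ, (2:ℝ≥0∞) ^ (((m:ℝ) + 2) * P) * volume {x | (2:ℝ≥0∞) ^ ((m:ℝ) + 1) < HM u x} ≤
      2 ^ (2 * P) * (ENNReal.ofReal (5 ^ n) *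
        ∫⁻ x, u x * (if (2:ℝ≥0∞) ^ (m:ℝ) < u x then (2:ℝ≥0∞) ^ ((m:ℝ) * (P - 1)) else 0)) := by
    intro m
    have h := weak_HM' u hu (2 ^ (m:ℝ))
    have e1 : (2:ℝ≥0∞) * 2 ^ (m:ℝ) = 2 ^ ((m:ℝ) + 1) := by
      rw [two_rpow_add, ENNReal.rpow_one, mul_comm]
    rw [e1] at h
    have e2 : (2:ℝ≥0∞) ^ (((m:ℝ) + 2) * P) = 2 ^ (2 * P) * (2 ^ ((m:ℝ) * (P - 1)) * 2 ^ (m:ℝ)) := by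
      rw [← two_rpow_add, ← two_rpow_add]; congr 1; ring
    have e3 : ∫⁻ x, u x * (if (2:ℝ≥0∞) ^ (m:ℝ) < u x then (2:ℝ≥0∞) ^ ((m:ℝ) * (P - 1)) else 0) =
        2 ^ ((m:ℝ) * (P - 1)) * ∫⁻ z, {y | (2:ℝ≥0∞) ^ (m:ℝ) < u y}.indicator u z := by
      rw [← lintegral_const_mul' _ _ (two_rpow_ne_top _)]
      congr 1; ext x
      by_cases hx : (2:ℝ≥0∞) ^ (m:ℝ) < u x
      · rw [if_pos hx, indicator_of_mem (by exact hx), mul_comm]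
      · rw [if_neg hx, indicator_of_notMem (by exact hx), mul_zero, mul_zero]
    rw [e2, e3, mul_assoc, mul_assoc]
    refine mul_le_mul' le_rfl ?_
    rw [mul_left_comm (ENNReal.ofReal _)]
    exact mul_le_mul' le_rfl h
  calc ∫⁻ x, HM u x ^ P ≤ ∫⁻ x, ∑' m : ℤ, if (2:ℝ≥0∞) ^ ((m:ℝ) + 1) < HM u x then (2:ℝ≥0∞) ^ (((m:ℝ) + 2) * P) else 0 := by
        gcongr with x; exact dyadic_upper (by linarith) _
    _ = ∑' m : ℤ, (2:ℝ≥0∞) ^ (((m:ℝ) + 2) * P) * volume {x | (2:ℝ≥0∞) ^ ((m:ℝ) + 1) < HM u x} := by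
        rw [lintegral_tsum]
        · congr 1; ext m
          rw [← lintegral_indicator_const (measurableSet_lt measurable_const hM)]
          congr 1; ext x
          by_cases hx : (2:ℝ≥0∞) ^ ((m:ℝ) + 1) < HM u x
          · rw [if_pos hx, indicator_of_mem (by exact hx)]
          · rw [if_neg hx, indicator_of_notMem (by exact hx)]
        · intro m
          exact (Measurable.ite (measurableSet_lt measurable_const hM) measurable_const measurable_const).aemeasurable
    _ ≤ _ := ENNReal.tsum_le_tsum key
    _ = 2 ^ (2 * P) * (ENNReal.ofReal (5 ^ n) *
        ∫⁻ x, u x * ∑' m : ℤ, (if (2:ℝ≥0∞) ^ (m:ℝ) < u x then (2:ℝ≥0∞) ^ ((m:ℝ) * (P - 1)) else 0)) := by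
        rw [ENNReal.tsum_mul_left, ENNReal.tsum_mul_left, ← lintegral_tsum]
        · simp_rw [ENNReal.tsum_mul_left]
        · intro m
          exact (hu.mul (Measurable.ite (measurableSet_lt measurable_const hu) measurable_const measurable_const)).aemeasurable
    _ ≤ 2 ^ (2 * P) * (ENNReal.ofReal (5 ^ n) * ∫⁻ x, geomC (P - 1) * u x ^ P) := by
        exact mul_le_mul' le_rfl (mul_le_mul' le_rfl (lintegral_mono fun x => dyadic_lower hP _))
    _ = _ := by
        rw [lintegral_const_mul _ (by fun_prop)]; ring

end TL
end

section
namespace TL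

/-- weight `1 + 2^k |x|`. -/
def W {n : ℕ} (k : ℕ) (x : Rn n) : ℝ≥0∞ := ENNReal.ofReal (1 + 2 ^ k * ‖x‖)

def eta {n : ℕ} (k : ℕ) (L : ℝ) (x : Rn n) : ℝ≥0∞ := 2 ^ ((k:ℝ) * n) * W k x ^ (-L)

def T {n : ℕ} (k : ℕ) (u : Rn n → ℝ≥0∞) (x : Rn n) : ℝ≥0∞ := ∫⁻ z, eta k ((n:ℝ) + 1) (x - z) * u z

lemma W_one_le {n : ℕ} (k : ℕ) (x : Rn n) : 1 ≤ W k x := by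
  rw [W, ENNReal.one_le_ofReal]; have := norm_nonneg x; nlinarith [pow_pos (two_pos (α := ℝ)) k]
lemma W_ne_zero {n : ℕ} (k : ℕ) (x : Rn n) : W k x ≠ 0 := (one_pos.trans_le (W_one_le k x)).ne'
lemma W_ne_top {n : ℕ} (k : ℕ) (x : Rn n) : W k x ≠ ∞ := ENNReal.ofReal_ne_top
@[fun_prop] lemma measurable_W {n : ℕ} (k : ℕ) : Measurable (W (n := n) k) := by unfold W; fun_prop
@[fun_prop] lemma measurable_eta {n : ℕ} (k : ℕ) (L : ℝ) : Measurable (eta (n := n) k L) := by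
  unfold eta; fun_prop
lemma eta_comm {n : ℕ} (k : ℕ) (L : ℝ) (x y : Rn n) : eta k L (x - y) = eta k L (y - x) := by
  unfold eta W; rw [norm_sub_rev]
lemma W_comm {n : ℕ} (k : ℕ) (x y : Rn n) : W k (x - y) = W k (y - x) := by
  unfold W; rw [norm_sub_rev]

lemma W_mono {n : ℕ} {k l : ℕ} (h : k ≤ l) (x : Rn n) : W k x ≤ W l x := by
  unfold W; gcongr; norm_num

lemma W_add {n : ℕ} (k : ℕ) (x y : Rn n) : W k (x + y) ≤ W k x * W k y := by
  unfold W
  rw [← ENNReal.ofReal_mul (by positivity)]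
  apply ENNReal.ofReal_le_ofReal
  have h := norm_add_le x y
  have h2 : (0:ℝ) < 2 ^ k := by positivity
  nlinarith [mul_nonneg (mul_nonneg h2.le (norm_nonneg x)) (mul_nonneg h2.le (norm_nonneg y))]

lemma W_sub {n : ℕ} (k : ℕ) (x y z : Rn n) : W k (x - z) ≤ W k (x - y) * W k (y - z) := by
  have := W_add k (x - y) (y - z); simpa using this

lemma vol_cb {n : ℕ} (x : Rn n) {r : ℝ} (hr : 0 ≤ r) :
    volume (closedBall x r) = ENNReal.ofReal (r ^ n) * volume (closedBall (0 : Rn n) 1) := by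
  rw [Measure.addHaar_closedBall' volume x hr, finrank_euclideanSpace_fin]

lemma W_dyadic {n : ℕ} (k : ℕ) (y : Rn n) : W k y ^ (-((n:ℝ) + 1)) ≤
    ∑' i : ℕ, (2:ℝ≥0∞) ^ (-((i:ℝ) * (n + 1))) *
      (closedBall (0 : Rn n) ((2:ℝ) ^ ((i:ℤ) + 1 - k))).indicator (fun _ => 1) y := by
  obtain ⟨i, hi⟩ := exists_nat_pow_near (x := 1 + 2 ^ k * ‖y‖) (y := (2:ℝ))
    (by have := norm_nonneg y; nlinarith [pow_pos (two_pos (α := ℝ)) k]) (by norm_num)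
  refine le_trans ?_ (ENNReal.le_tsum i)
  rw [indicator_of_mem, mul_one]
  · rw [ENNReal.rpow_neg, ENNReal.rpow_neg, ENNReal.rpow_mul]
    gcongr
    unfold W
    rw [two_rpow_ofReal]
    apply ENNReal.ofReal_le_ofReal
    simpa using hi.1
  · rw [mem_closedBall_zero_iff]
    have h2 : (0:ℝ) < 2 ^ k := by positivity
    have : (2:ℝ) ^ ((i:ℤ) + 1 - k) = 2 ^ (i + 1) / 2 ^ k := by
      rw [zpow_sub₀ (by norm_num)]; norm_cast
    rw [this, le_div_iff₀ h2]
    nlinarith [hi.2]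

lemma T_le_HM (n : ℕ) : ∃ C : ℝ≥0∞, C < ∞ ∧ ∀ (k : ℕ) (u : Rn n → ℝ≥0∞), Measurable u → ∀ x,
    T k u x ≤ C * HM u x := by
  refine ⟨(∑' i : ℕ, (2 : ℝ≥0∞) ^ (-((1:ℝ) * i))) * (2 ^ (n:ℝ) * volume (closedBall (0 : Rn n) 1)), ?_, ?_⟩
  · exact ENNReal.mul_lt_top (tsum_nat_geom one_pos)
      (ENNReal.mul_lt_top (two_rpow_ne_top _).lt_top (vol_cb_top _ _).lt_top)
  intro k u hu x
  have hmeas : ∀ i : ℕ, Measurable fun z => (closedBall (0 : Rn n) ((2:ℝ) ^ ((i:ℤ) + 1 - k))).indicator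
      (fun _ => (1:ℝ≥0∞)) (x - z) := fun i =>
    (measurable_const.indicator measurableSet_closedBall).comp (measurable_const.sub measurable_id)
  calc T k u x ≤ ∫⁻ z, ∑' i : ℕ, 2 ^ ((k:ℝ) * n) * ((2:ℝ≥0∞) ^ (-((i:ℝ) * (n + 1))) *
      (closedBall (0 : Rn n) ((2:ℝ) ^ ((i:ℤ) + 1 - k))).indicator (fun _ => 1) (x - z)) * u z := by
        refine lintegral_mono fun z => ?_
        simp only
        rw [ENNReal.tsum_mul_right, ENNReal.tsum_mul_left]
        unfold eta
        gcongr
        exact W_dyadic k _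
    _ = ∑' i : ℕ, 2 ^ ((k:ℝ) * n) * ((2:ℝ≥0∞) ^ (-((i:ℝ) * (n + 1))) *
          ∫⁻ z in closedBall x ((2:ℝ) ^ ((i:ℤ) + 1 - k)), u z) := by
        rw [lintegral_tsum]
        · congr 1; ext i
          rw [← lintegral_indicator measurableSet_closedBall, ← mul_assoc,
            ← lintegral_const_mul' _ _ (ENNReal.mul_ne_top (two_rpow_ne_top _) (two_rpow_ne_top _))]
          congr 1; ext z
          by_cases hz : z ∈ closedBall x ((2:ℝ) ^ ((i:ℤ) + 1 - k))
          · rw [indicator_of_mem, indicator_of_mem hz, mul_one]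
            rw [mem_closedBall_zero_iff, ← dist_eq_norm, dist_comm]; exact hz
          · rw [indicator_of_notMem, indicator_of_notMem hz]
            · simp
            rw [mem_closedBall_zero_iff, ← dist_eq_norm, dist_comm]; exact hz
        · intro i
          exact (((hmeas i).const_mul _).const_mul _ |>.mul hu).aemeasurable
    _ ≤ ∑' i : ℕ, (2 : ℝ≥0∞) ^ (-((1:ℝ) * i)) * (2 ^ (n:ℝ) * volume (closedBall (0 : Rn n) 1)) * HM u x := by
        refine ENNReal.tsum_le_tsum fun i => ?_
        have h1 : ∫⁻ z in closedBall x ((2:ℝ) ^ ((i:ℤ) + 1 - k)), u z ≤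
            volume (closedBall x ((2:ℝ) ^ ((i:ℤ) + 1 - k))) * HM u x := by
          refine le_trans (le_of_eq ?_) (mul_le_mul' le_rfl (le_iSup (fun m : ℤ => av ((2:ℝ) ^ m) u x) ((i:ℤ) + 1 - k)))
          simp only [av]
          rw [← mul_assoc, ENNReal.mul_inv_cancel (vol_cb_pos _ (by positivity)) (vol_cb_top _ _), one_mul]
        refine (mul_le_mul' le_rfl (mul_le_mul' le_rfl h1)).trans (le_of_eq ?_)
        rw [vol_cb x (by positivity)]
        have h3 : ENNReal.ofReal (((2:ℝ) ^ ((i:ℤ) + 1 - k)) ^ n) = 2 ^ (((i:ℝ) + 1 - k) * n) := by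
          rw [two_rpow_ofReal]; congr 1
          rw [Real.rpow_mul (by norm_num), Real.rpow_natCast]
          congr 1
          rw [← Real.rpow_intCast]; push_cast; rfl
        rw [h3]
        simp only [← mul_assoc]
        rw [← two_rpow_add, ← two_rpow_add, ← two_rpow_add]
        congr 3; ring
    _ = _ := by
        rw [ENNReal.tsum_mul_right, ENNReal.tsum_mul_right]

lemma HM_one_le {n : ℕ} (x : Rn n) : HM (fun _ => 1) x ≤ 1 := by
  refine iSup_le fun m => ?_
  simp only [av, setLIntegral_const, one_mul]
  rw [ENNReal.inv_mul_cancel (vol_cb_pos _ (by positivity)) (vol_cb_top _ _)]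

def TC (n : ℕ) : ℝ≥0∞ := (T_le_HM n).choose
lemma TC_lt (n : ℕ) : TC n < ∞ := (T_le_HM n).choose_spec.1
lemma T_le {n : ℕ} (k : ℕ) {u : Rn n → ℝ≥0∞} (hu : Measurable u) (x : Rn n) : T k u x ≤ TC n * HM u x :=
  (T_le_HM n).choose_spec.2 k u hu x

lemma int_eta {n : ℕ} (k : ℕ) (x : Rn n) : ∫⁻ z, eta k ((n:ℝ) + 1) (x - z) ≤ TC n := by
  have := T_le k (u := fun _ : Rn n => 1) measurable_const x
  simp only [T, mul_one] at this
  exact this.trans (mul_le_of_le_one_right' (HM_one_le x))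

lemma meas_eta_sub {n : ℕ} (k : ℕ) (L : ℝ) (x : Rn n) : Measurable fun z => eta k L (x - z) :=
  (measurable_eta k L).comp (measurable_const.sub measurable_id)

@[fun_prop] lemma measurable_T {n : ℕ} (k : ℕ) {u : Rn n → ℝ≥0∞} (hu : Measurable u) : Measurable (T k u) := by
  unfold T
  refine Measurable.lintegral_prod_right' (f := fun p : Rn n × Rn n => eta k ((n:ℝ) + 1) (p.1 - p.2) * u p.2) ?_
  exact ((measurable_eta k _).comp (measurable_fst.sub measurable_snd)).mul (hu.comp measurable_snd)

lemma T_swap {n : ℕ} (k : ℕ) {u v : Rn n → ℝ≥0∞} (hu : Measurable u) (hv : Measurable v) :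
    ∫⁻ x, T k u x * v x = ∫⁻ x, u x * T k v x := by
  have h1 : ∀ x, T k u x * v x = ∫⁻ z, eta k ((n:ℝ) + 1) (x - z) * u z * v x := by
    intro x
    have hm : Measurable fun z => eta k ((n:ℝ) + 1) (x - z) * u z := (meas_eta_sub k _ x).mul hu
    rw [lintegral_mul_const _ hm]; rfl
  have h2 : ∀ z, u z * T k v z = ∫⁻ x, eta k ((n:ℝ) + 1) (x - z) * u z * v x := by
    intro z
    have hm : Measurable fun x => eta k ((n:ℝ) + 1) (z - x) * v x := (meas_eta_sub k _ z).mul hv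
    rw [T, ← lintegral_const_mul _ hm]
    congr 1; ext x; rw [eta_comm]; ring
  simp_rw [h1, h2]
  rw [lintegral_lintegral_swap]
  refine Measurable.aemeasurable ?_
  exact (((measurable_eta k _).comp (measurable_fst.sub measurable_snd)).mul (hu.comp measurable_snd)).mul
    (hv.comp measurable_fst)

lemma T_jensen {n : ℕ} (k : ℕ) {Q : ℝ} (hQ : 1 < Q) {u : Rn n → ℝ≥0∞} (hu : Measurable u) (x : Rn n) :
    T k u x ^ Q ≤ TC n ^ (Q - 1) * T k (fun z => u z ^ Q) x := by
  have := holder_jensen volume hQ (fun z => eta k ((n:ℝ) + 1) (x - z)) u (meas_eta_sub _ _ _) hu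
  refine this.trans ?_
  have h : 0 ≤ Q - 1 := by linarith
  refine mul_le_mul' (ENNReal.rpow_le_rpow (int_eta k x) h) le_rfl

end TL
end

section
namespace TL

lemma mmul {α : Type*} [MeasurableSpace α] {f g : α → ℝ≥0∞} (hf : Measurable f) (hg : Measurable g) :
    Measurable fun x => f x * g x := hf.mul hg

lemma T_sum_pair {n : ℕ} {F : ℕ → Rn n → ℝ≥0∞} (hF : ∀ k, Measurable (F k)) {h : Rn n → ℝ≥0∞}
    (hh : Measurable h) :
    ∫⁻ x, (∑' k, T k (F k) x) * h x ≤ ∫⁻ x, (∑' k, F k x) * (TC n * HM h x) := by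
  calc ∫⁻ x, (∑' k, T k (F k) x) * h x = ∑' k, ∫⁻ x, T k (F k) x * h x := by
        simp_rw [← ENNReal.tsum_mul_right]
        rw [lintegral_tsum fun k => (mmul (measurable_T k (hF k)) hh).aemeasurable]
    _ = ∑' k, ∫⁻ x, F k x * T k h x := by
        congr 1; ext k; exact T_swap k (hF k) hh
    _ = ∫⁻ x, ∑' k, F k x * T k h x := by
        rw [lintegral_tsum fun k => (mmul (hF k) (measurable_T k hh)).aemeasurable]
    _ ≤ _ := by
        refine lintegral_mono fun x => ?_
        simp only
        rw [← ENNReal.tsum_mul_right]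
        refine ENNReal.tsum_le_tsum fun k => mul_le_mul' le_rfl (T_le k hh x)

lemma rpow_absorb {I D Y : ℝ≥0∞} {a b : ℝ} (hab : a.HolderConjugate b) (hI : I ≠ ∞)
    (h : I ≤ D * I ^ (1 / b)) : I ≤ D ^ a := by
  rcases eq_or_ne I 0 with rfl | h0
  · exact zero_le
  have e : I = I ^ (1 / a) * I ^ (1 / b) := by
    rw [← ENNReal.rpow_add _ _ h0 hI]
    have := hab.inv_add_inv_eq_one
    rw [one_div, one_div, this, ENNReal.rpow_one]
  have hb : I ^ (1 / b) ≠ 0 := by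
    rw [Ne, ENNReal.rpow_eq_zero_iff]; simp [h0, hI]
  have hb' : I ^ (1 / b) ≠ ∞ := ENNReal.rpow_ne_top_of_nonneg (by have := hab.symm.pos; positivity) hI
  have h2 : I ^ (1 / a) ≤ D := by
    have h5 : I ^ (1 / a) * I ^ (1 / b) ≤ D * I ^ (1 / b) := by rw [← e]; exact h
    exact (ENNReal.mul_le_mul_iff_left hb hb').1 h5
  calc I = (I ^ (1 / a)) ^ a := by
        rw [← ENNReal.rpow_mul, one_div, inv_mul_cancel₀ hab.pos.ne', ENNReal.rpow_one]
    _ ≤ D ^ a := ENNReal.rpow_le_rpow h2 hab.pos.le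

lemma FS_ge (n : ℕ) {a : ℝ} (ha : 1 ≤ a) : ∃ C : ℝ≥0∞, C < ∞ ∧ ∀ F : ℕ → Rn n → ℝ≥0∞,
    (∀ k, Measurable (F k)) → ∫⁻ x, (∑' k, T k (F k) x) ^ a ≤ C * ∫⁻ x, (∑' k, F k x) ^ a := by
  rcases ha.eq_or_lt with rfl | ha
  · refine ⟨TC n, TC_lt n, fun F hF => ?_⟩
    have := T_sum_pair hF (h := fun _ => 1) measurable_const
    simp only [mul_one] at this
    simp only [ENNReal.rpow_one]
    refine this.trans ?_
    rw [← lintegral_const_mul _ (Measurable.tsum hF)]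
    refine lintegral_mono fun x => ?_
    simp only
    rw [mul_comm (TC n) (tsum _)]
    exact mul_le_mul' le_rfl (mul_le_of_le_one_right' (HM_one_le x))
  have hc := Real.HolderConjugate.conjExponent ha
  set b := Real.conjExponent a
  obtain ⟨C, hC, hM⟩ := strong_HM n hc.symm.lt
  have hb0 : 0 < 1 / b := one_div_pos.2 hc.symm.pos
  have ha0 : 0 < a := hc.pos
  refine ⟨(TC n * C ^ (1 / b)) ^ a, ENNReal.rpow_lt_top_of_nonneg ha0.le
    (ENNReal.mul_lt_top (TC_lt n) (ENNReal.rpow_lt_top_of_nonneg hb0.le hC.ne)).ne, fun F hF => ?_⟩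
  set X := ∫⁻ x, (∑' k, F k x) ^ a with hX
  set A : Rn n → ℝ≥0∞ := fun x => ∑' k, T k (F k) x with hA
  have hAm : Measurable A := Measurable.tsum fun k => measurable_T k (hF k)
  have hBm : Measurable fun x => ∑' k, F k x := Measurable.tsum hF
  have pair : ∀ h : Rn n → ℝ≥0∞, Measurable h →
      ∫⁻ x, A x * h x ≤ TC n * C ^ (1 / b) * X ^ (1 / a) * (∫⁻ x, h x ^ b) ^ (1 / b) := by
    intro h hh
    refine (T_sum_pair hF hh).trans ?_
    have hHM := measurable_HM hh
    calc _ = TC n * ∫⁻ x, (∑' k, F k x) * HM h x := by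
          rw [← lintegral_const_mul _ (mmul hBm hHM)]
          congr 1; ext x; ring
      _ ≤ TC n * (X ^ (1 / a) * (∫⁻ x, HM h x ^ b) ^ (1 / b)) := by
          refine mul_le_mul' le_rfl ?_
          exact ENNReal.lintegral_mul_le_Lp_mul_Lq volume hc hBm.aemeasurable hHM.aemeasurable
      _ ≤ TC n * (X ^ (1 / a) * (C * ∫⁻ x, h x ^ b) ^ (1 / b)) := by
          have := hM h hh
          gcongr
      _ = _ := by
          rw [ENNReal.mul_rpow_of_nonneg _ _ hb0.le]; ring
  set AN : ℕ → Rn n → ℝ≥0∞ := fun N => (ball (0 : Rn n) N).indicator (fun x => min (A x) N) with hAN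
  have hANm : ∀ N, Measurable (AN N) := fun N =>
    (hAm.min measurable_const).indicator measurableSet_ball
  have hANle : ∀ N x, AN N x ≤ A x := fun N x => by
    by_cases hx : x ∈ ball (0 : Rn n) N
    · simp only [hAN, indicator_of_mem hx]; exact min_le_left _ _
    · simp only [hAN, indicator_of_notMem hx]; exact zero_le
  have hfin : ∀ N, ∫⁻ x, AN N x ^ a ≠ ∞ := by
    intro N
    have : ∫⁻ x, AN N x ^ a ≤ ∫⁻ x, (ball (0 : Rn n) N).indicator (fun _ => (N:ℝ≥0∞) ^ a) x := by
      refine lintegral_mono fun x => ?_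
      by_cases hx : x ∈ ball (0 : Rn n) N
      · simp only [hAN, indicator_of_mem hx]
        exact ENNReal.rpow_le_rpow (min_le_right _ _) ha0.le
      · simp only [hAN, indicator_of_notMem hx]
        rw [ENNReal.zero_rpow_of_pos ha0]
    refine (this.trans_lt ?_).ne
    rw [lintegral_indicator_const measurableSet_ball]
    exact ENNReal.mul_lt_top (ENNReal.rpow_lt_top_of_nonneg ha0.le (by simp)) measure_ball_lt_top
  have hbound : ∀ N, ∫⁻ x, AN N x ^ a ≤ (TC n * C ^ (1 / b)) ^ a * X := by
    intro N
    have h1 := pair (fun x => AN N x ^ (a - 1)) ((hANm N).pow_const _)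
    have e1 : ∀ x, (AN N x ^ (a - 1)) ^ b = AN N x ^ a := by
      intro x; rw [← ENNReal.rpow_mul, hc.sub_one_mul_conj]
    simp_rw [e1] at h1
    have h2 : ∫⁻ x, AN N x ^ a ≤ ∫⁻ x, A x * AN N x ^ (a - 1) := by
      refine lintegral_mono fun x => ?_
      have : AN N x ^ a = AN N x * AN N x ^ (a - 1) := by
        have := ENNReal.rpow_add_of_nonneg (x := AN N x) 1 (a - 1) (by norm_num) (by linarith)
        rw [ENNReal.rpow_one] at this
        rw [← this]; congr 1; ring
      simp only
      rw [this]
      exact mul_le_mul' (hANle N x) le_rfl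
    have h3 := rpow_absorb (Y := 0) hc (hfin N) (h2.trans h1)
    refine h3.trans (le_of_eq ?_)
    rw [ENNReal.mul_rpow_of_nonneg _ _ ha0.le, ← ENNReal.rpow_mul X, one_div_mul_cancel ha0.ne',
      ENNReal.rpow_one]
  have hlim : ∀ x, Tendsto (fun N => AN N x ^ a) atTop (𝓝 (A x ^ a)) := by
    intro x
    refine (ENNReal.continuous_rpow_const.tendsto _).comp ?_
    have h1 : Tendsto (fun N : ℕ => min (A x) (N:ℝ≥0∞)) atTop (𝓝 (min (A x) ∞)) :=
      tendsto_const_nhds.min ENNReal.tendsto_nat_nhds_top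
    rw [min_eq_left le_top] at h1
    refine h1.congr' ?_
    obtain ⟨N0, hN0⟩ := exists_nat_gt ‖x‖
    filter_upwards [eventually_ge_atTop N0] with N hN
    have : x ∈ ball (0 : Rn n) N := by
      rw [mem_ball_zero_iff]; exact hN0.trans_le (by exact_mod_cast hN)
    simp only [hAN, indicator_of_mem this]
  calc ∫⁻ x, A x ^ a = ∫⁻ x, liminf (fun N => AN N x ^ a) atTop := by
        congr 1; ext x; rw [(hlim x).liminf_eq]
    _ ≤ liminf (fun N => ∫⁻ x, AN N x ^ a) atTop := lintegral_liminf_le fun N => (hANm N).pow_const _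
    _ ≤ _ := by
        refine liminf_le_of_le (by isBoundedDefault) fun c hc => ?_
        obtain ⟨N, hN⟩ := hc.exists
        exact hN.trans (hbound N)

lemma FS_lt (n : ℕ) {p q : ℝ} (hp : 1 < p) (hpq : p < q) : ∃ C : ℝ≥0∞, C < ∞ ∧
    ∀ g : ℕ → Rn n → ℝ≥0∞, (∀ k, Measurable (g k)) →
    ∫⁻ x, (∑' k, T k (g k) x ^ q) ^ (p / q) ≤ C * ∫⁻ x, (∑' k, g k x ^ q) ^ (p / q) := by
  have hq : 1 < q := hp.trans hpq
  have hc := Real.HolderConjugate.conjExponent hq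
  set q' := Real.conjExponent q with hq'
  have hq0 : 0 < q := by linarith
  have hp0 : 0 < p := by linarith
  have hd : 0 < q - p := by linarith
  have hq'0 : 0 < q' := hc.symm.pos
  -- exponent t
  have hqq : q / q' = q - 1 := by
    have := hc.sub_one_mul_conj
    field_simp; linarith
  set t := (q - 1) * (p / (q - p)) with ht
  have ht1 : 1 < t := by
    rw [ht, ← mul_div_assoc, lt_div_iff₀ hd]; nlinarith
  obtain ⟨C, hC, hM⟩ := strong_HM n ht1
  have hpq1 : 0 < 1 - p / q := by
    rw [sub_pos, div_lt_one hq0]; exact hpq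
  refine ⟨1 + (TC n ^ (q - 1)) ^ (p / q) * (TC n) ^ (p / q) * C ^ (1 - p / q), ?_, fun g hg => ?_⟩
  · refine ENNReal.add_lt_top.2 ⟨by simp, ?_⟩
    have h1 := (TC_lt n).ne
    refine ENNReal.mul_lt_top (ENNReal.mul_lt_top ?_ ?_) ?_
    · exact ENNReal.rpow_lt_top_of_nonneg (by positivity) (ENNReal.rpow_ne_top_of_nonneg (by linarith) h1)
    · exact ENNReal.rpow_lt_top_of_nonneg (by positivity) h1
    · exact ENNReal.rpow_lt_top_of_nonneg hpq1.le hC.ne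
  set h : Rn n → ℝ≥0∞ := fun x => ∑' k, g k x ^ q with hh
  have hhm : Measurable h := Measurable.tsum fun k => (hg k).pow_const _
  set X := ∫⁻ x, h x ^ (p / q) with hX
  by_cases hXt : X = ∞
  · rw [hXt, ENNReal.mul_top (by simp)]; exact le_top
  have hfin : ∀ᵐ x, h x ≠ ∞ := by
    have := ae_lt_top (hhm.pow_const (p / q)) hXt
    filter_upwards [this] with x hx hx2
    rw [hx2, ENNReal.top_rpow_of_pos (by positivity)] at hx
    exact absurd hx (lt_irrefl _)
  -- v = h^((q-p)/q)
  set e := (q - p) / q with he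
  have he0 : 0 < e := by positivity
  set v : Rn n → ℝ≥0∞ := fun x => h x ^ e with hv
  have hvm : Measurable v := hhm.pow_const _
  set vv : Rn n → ℝ≥0∞ := fun x => v x ^ (q' / q) with hvv
  have hvvm : Measurable vv := hvm.pow_const _
  set F : ℕ → Rn n → ℝ≥0∞ := fun k x => g k x ^ q * (v x)⁻¹ with hF
  have hFm : ∀ k, Measurable (F k) := fun k => ((hg k).pow_const _).mul hvm.inv
  have step1 : ∀ k x, T k (g k) x ^ q ≤ T k (F k) x * (TC n * HM vv x) ^ (q - 1) := by
    intro k x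
    set κ : Rn n → ℝ≥0∞ := fun z => eta k ((n:ℝ) + 1) (x - z) with hκ
    have hκm : Measurable κ := meas_eta_sub _ _ _
    have hol := ENNReal.lintegral_mul_le_Lp_mul_Lq volume hc
      (f := fun z => κ z ^ (1 / q) * F k z ^ (1 / q)) (g := fun z => κ z ^ (1 / q') * vv z ^ (1 / q'))
      ((hκm.pow_const _).mul ((hFm k).pow_const _)).aemeasurable
      ((hκm.pow_const _).mul (hvvm.pow_const _)).aemeasurable
    have i1 : ∀ z, (κ z ^ (1 / q) * F k z ^ (1 / q)) ^ q = κ z * F k z := by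
      intro z
      rw [← ENNReal.mul_rpow_of_nonneg _ _ (by positivity), ← ENNReal.rpow_mul, one_div,
        inv_mul_cancel₀ hq0.ne', ENNReal.rpow_one]
    have i2 : ∀ z, (κ z ^ (1 / q') * vv z ^ (1 / q')) ^ q' = κ z * vv z := by
      intro z
      rw [← ENNReal.mul_rpow_of_nonneg _ _ (by positivity), ← ENNReal.rpow_mul, one_div,
        inv_mul_cancel₀ hq'0.ne', ENNReal.rpow_one]
    simp only [i1, i2] at hol
    have i3 : T k (g k) x ≤ ∫⁻ z, ((fun z => κ z ^ (1 / q) * F k z ^ (1 / q)) *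
        (fun z => κ z ^ (1 / q') * vv z ^ (1 / q'))) z := by
      refine lintegral_mono_ae ?_
      filter_upwards [hfin] with z hz
      simp only [Pi.mul_apply]
      have j1 : κ z = κ z ^ (1 / q) * κ z ^ (1 / q') := by
        rw [← ENNReal.rpow_add_of_nonneg _ _ (by positivity) (by positivity)]
        have := hc.inv_add_inv_eq_one
        rw [one_div, one_div, this, ENNReal.rpow_one]
      have j2 : g k z ≤ F k z ^ (1 / q) * vv z ^ (1 / q') := by
        have j3 : vv z ^ (1 / q') = v z ^ (1 / q) := by
          simp only [hvv]
          rw [← ENNReal.rpow_mul]; congr 1; field_simp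
        rw [j3, ← ENNReal.mul_rpow_of_nonneg _ _ (by positivity), one_div, ENNReal.le_rpow_inv_iff hq0]
        simp only [hF]
        have hle : g k z ^ q ≤ h z := ENNReal.le_tsum k
        rcases eq_or_ne (h z) 0 with h0 | h0
        · rw [h0] at hle
          rw [le_zero_iff.1 hle]; exact zero_le
        · have v0 : v z ≠ 0 := by
            simp only [hv]; rw [Ne, ENNReal.rpow_eq_zero_iff]; simp [h0, hz]
          have vt : v z ≠ ∞ := ENNReal.rpow_ne_top_of_nonneg he0.le hz
          rw [mul_assoc, ENNReal.inv_mul_cancel v0 vt, mul_one]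
      calc κ z * g k z ≤ (κ z ^ (1 / q) * κ z ^ (1 / q')) * (F k z ^ (1 / q) * vv z ^ (1 / q')) := by
            rw [← j1]; exact mul_le_mul' le_rfl j2
        _ = _ := by ring
    calc T k (g k) x ^ q ≤ (T k (F k) x ^ (1 / q) * T k vv x ^ (1 / q')) ^ q :=
          ENNReal.rpow_le_rpow (i3.trans hol) hq0.le
      _ = T k (F k) x * T k vv x ^ (q - 1) := by
          rw [ENNReal.mul_rpow_of_nonneg _ _ hq0.le, ← ENNReal.rpow_mul, ← ENNReal.rpow_mul, one_div,
            inv_mul_cancel₀ hq0.ne', ENNReal.rpow_one, ← hqq]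
          congr 2; ring
      _ ≤ _ := mul_le_mul' le_rfl (ENNReal.rpow_le_rpow (T_le k hvvm x) (by linarith))
  set D : Rn n → ℝ≥0∞ := fun x => ∑' k, T k (F k) x with hD
  have hDm : Measurable D := Measurable.tsum fun k => measurable_T k (hFm k)
  have hHm : Measurable (HM vv) := measurable_HM hvvm
  have hDint : ∫⁻ x, D x ≤ TC n * X := by
    have := T_sum_pair hFm (h := fun _ => 1) measurable_const
    simp only [mul_one] at this
    refine this.trans ?_
    rw [hX, ← lintegral_const_mul _ (hhm.pow_const _)]
    refine lintegral_mono_ae ?_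
    filter_upwards [hfin] with x hx
    rw [mul_comm (TC n) (h x ^ (p / q))]
    refine mul_le_mul' ?_ (mul_le_of_le_one_right' (HM_one_le x))
    simp only [hF]
    rw [ENNReal.tsum_mul_right]
    change h x * (v x)⁻¹ ≤ _
    rcases eq_or_ne (h x) 0 with h0 | h0
    · rw [h0, zero_mul]; exact zero_le
    · simp only [hv]
      rw [← ENNReal.rpow_neg]
      nth_rewrite 1 [← ENNReal.rpow_one (h x)]
      rw [← ENNReal.rpow_add _ _ h0 hx]
      apply le_of_eq; congr 1; rw [he]; field_simp; ring
  have hHint : ∫⁻ x, HM vv x ^ t ≤ C * X := by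
    refine (hM vv hvvm).trans (mul_le_mul' le_rfl (le_of_eq ?_))
    congr 1; ext x
    simp only [hvv, hv]
    rw [← ENNReal.rpow_mul, ← ENNReal.rpow_mul]; congr 1
    rw [he, ht, ← hqq]; field_simp
  -- Holder
  have hc2 : (q / p).HolderConjugate (q / (q - p)) := by
    rw [Real.holderConjugate_iff]
    refine ⟨by rw [lt_div_iff₀ hp0]; linarith, ?_⟩
    rw [inv_div, inv_div]; field_simp; ring
  have hol := ENNReal.lintegral_mul_le_Lp_mul_Lq volume hc2
      (f := fun x => D x ^ (p / q)) (g := fun x => (HM vv x ^ (q - 1)) ^ (p / q))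
      (hDm.pow_const _).aemeasurable ((hHm.pow_const _).pow_const _).aemeasurable
  have k1 : ∀ x, (D x ^ (p / q)) ^ (q / p) = D x := by
    intro x; rw [← ENNReal.rpow_mul]
    have : p / q * (q / p) = 1 := by field_simp
    rw [this, ENNReal.rpow_one]
  have k2 : ∀ x, ((HM vv x ^ (q - 1)) ^ (p / q)) ^ (q / (q - p)) = HM vv x ^ t := by
    intro x; rw [← ENNReal.rpow_mul, ← ENNReal.rpow_mul]; congr 1
    rw [ht]; field_simp
  simp only [k1, k2] at hol
  have k3 : (1 / (q / p)) = p / q := by field_simp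
  have k4 : (1 / (q / (q - p))) = 1 - p / q := by field_simp
  rw [k3, k4] at hol
  calc ∫⁻ x, (∑' k, T k (g k) x ^ q) ^ (p / q)
      ≤ ∫⁻ x, (TC n ^ (q - 1)) ^ (p / q) * (D x ^ (p / q) * (HM vv x ^ (q - 1)) ^ (p / q)) := by
        refine lintegral_mono fun x => ?_
        have : ∑' k, T k (g k) x ^ q ≤ TC n ^ (q - 1) * (D x * HM vv x ^ (q - 1)) := by
          refine (ENNReal.tsum_le_tsum fun k => step1 k x).trans ?_
          rw [ENNReal.tsum_mul_right, ENNReal.mul_rpow_of_nonneg _ _ (by linarith)]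
          apply le_of_eq; simp only [hD]; ring
        refine (ENNReal.rpow_le_rpow this (by positivity)).trans ?_
        rw [ENNReal.mul_rpow_of_nonneg _ _ (by positivity), ENNReal.mul_rpow_of_nonneg _ _ (by positivity)]
    _ = (TC n ^ (q - 1)) ^ (p / q) * ∫⁻ x, (D x ^ (p / q) * (HM vv x ^ (q - 1)) ^ (p / q)) := by
        have hm : Measurable fun x => D x ^ (p / q) * (HM vv x ^ (q - 1)) ^ (p / q) :=
          (hDm.pow_const _).mul ((hHm.pow_const _).pow_const _)
        rw [lintegral_const_mul _ hm]
    _ ≤ (TC n ^ (q - 1)) ^ (p / q) * ((∫⁻ x, D x) ^ (p / q) * (∫⁻ x, HM vv x ^ t) ^ (1 - p / q)) :=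
        mul_le_mul' le_rfl hol
    _ ≤ (TC n ^ (q - 1)) ^ (p / q) * ((TC n * X) ^ (p / q) * (C * X) ^ (1 - p / q)) := by
        refine mul_le_mul' le_rfl (mul_le_mul' ?_ ?_)
        · exact ENNReal.rpow_le_rpow hDint (by positivity)
        · exact ENNReal.rpow_le_rpow hHint hpq1.le
    _ = (TC n ^ (q - 1)) ^ (p / q) * (TC n) ^ (p / q) * C ^ (1 - p / q) * (X ^ (p / q) * X ^ (1 - p / q)) := by
        rw [ENNReal.mul_rpow_of_nonneg _ _ (by positivity), ENNReal.mul_rpow_of_nonneg _ _ hpq1.le]; ring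
    _ = (TC n ^ (q - 1)) ^ (p / q) * (TC n) ^ (p / q) * C ^ (1 - p / q) * X := by
        rw [← ENNReal.rpow_add_of_nonneg _ _ (by positivity) hpq1.le]; simp
    _ ≤ _ := mul_le_mul' le_add_self le_rfl

lemma FS (n : ℕ) {P : ℝ} (hP : 1 < P) (Q : ℝ≥0∞) (hQ : 1 < Q) : ∃ C : ℝ≥0∞, C < ∞ ∧
    ∀ G : ℕ → Rn n → ℝ≥0∞, (∀ k, Measurable (G k)) →
    ∫⁻ x, lqSum Q (fun k => T k (G k) x) ^ P ≤ C * ∫⁻ x, lqSum Q (fun k => G k x) ^ P := by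
  by_cases hQt : Q = ∞
  · obtain ⟨C, hC, hM⟩ := strong_HM n hP
    refine ⟨TC n ^ P * C, ENNReal.mul_lt_top (ENNReal.rpow_lt_top_of_nonneg (by linarith) (TC_lt n).ne) hC, ?_⟩
    intro G hG
    simp only [lqSum, hQt, if_true]
    have hm : Measurable fun x => ⨆ k, G k x := Measurable.iSup hG
    calc ∫⁻ x, (⨆ k, T k (G k) x) ^ P ≤ ∫⁻ x, TC n ^ P * HM (fun x => ⨆ k, G k x) x ^ P := by
          refine lintegral_mono fun x => ?_
          simp only
          rw [← ENNReal.mul_rpow_of_nonneg _ _ (by linarith)]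
          refine ENNReal.rpow_le_rpow (iSup_le fun k => ?_) (by linarith)
          refine (T_le k (hG k) x).trans (mul_le_mul' le_rfl (HM_mono (fun y => ?_) x))
          exact le_iSup (fun k => G k y) k
      _ ≤ _ := by
          rw [lintegral_const_mul _ ((measurable_HM hm).pow_const _), mul_assoc]
          exact mul_le_mul' le_rfl (hM _ hm)
  set q := Q.toReal with hq
  have hq1 : 1 < q := by
    rw [hq, ← ENNReal.toReal_one]; exact (ENNReal.toReal_lt_toReal (by simp) hQt).2 hQ
  have hq0 : 0 < q := by linarith
  have e : ∀ a : ℕ → ℝ≥0∞, lqSum Q a ^ P = (∑' k, a k ^ q) ^ (P / q) := by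
    intro a
    simp only [lqSum, hQt, if_false]
    rw [← ENNReal.rpow_mul]; congr 1; rw [← hq]; ring
  simp only [e]
  rcases lt_or_ge P q with h | h
  · exact FS_lt n hP h
  · have ha : 1 ≤ P / q := by rw [le_div_iff₀ hq0]; linarith
    obtain ⟨C, hC, hM⟩ := FS_ge n ha
    refine ⟨(TC n ^ (q - 1)) ^ (P / q) * C, ENNReal.mul_lt_top (ENNReal.rpow_lt_top_of_nonneg (by linarith)
      (ENNReal.rpow_ne_top_of_nonneg (by linarith) (TC_lt n).ne)) hC, fun G hG => ?_⟩
    have hGm : ∀ k, Measurable fun z => G k z ^ q := fun k => (hG k).pow_const _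
    calc _ ≤ ∫⁻ x, (TC n ^ (q - 1)) ^ (P / q) * (∑' k, T k (fun z => G k z ^ q) x) ^ (P / q) := by
          refine lintegral_mono fun x => ?_
          simp only
          rw [← ENNReal.mul_rpow_of_nonneg _ _ (by linarith)]
          refine ENNReal.rpow_le_rpow ?_ (by linarith)
          rw [← ENNReal.tsum_mul_left]
          exact ENNReal.tsum_le_tsum fun k => T_jensen k hq1 (hG k) x
      _ = (TC n ^ (q - 1)) ^ (P / q) * ∫⁻ x, (∑' k, T k (fun z => G k z ^ q) x) ^ (P / q) := by
          rw [lintegral_const_mul _ ((Measurable.tsum fun k => measurable_T k (hGm k)).pow_const _)]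
      _ ≤ _ := by
          rw [mul_assoc]; exact mul_le_mul' le_rfl (hM _ hGm)

end TL
end

section
namespace TL

lemma W_neg {n : ℕ} {N : ℝ} (hN : 0 ≤ N) {k l : ℕ} (h : k ≤ l) (y z w : Rn n) :
    W k (y - z) ^ (-N) * W l (z - w) ^ (-N) ≤ W k (y - w) ^ (-N) := by
  have h1 : W k (y - w) ≤ W k (y - z) * W l (z - w) :=
    (W_sub k y z w).trans (mul_le_mul' le_rfl (W_mono h _))
  rw [← ENNReal.mul_rpow_of_ne_top (W_ne_top _ _) (W_ne_top _ _), ENNReal.rpow_neg, ENNReal.rpow_neg]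
  exact ENNReal.inv_le_inv.2 (ENNReal.rpow_le_rpow h1 hN)

lemma W_neg_le_one {n : ℕ} {N : ℝ} (hN : 0 ≤ N) (k : ℕ) (y : Rn n) : W k y ^ (-N) ≤ 1 := by
  rw [ENNReal.rpow_neg, ENNReal.inv_le_one]
  rcases hN.eq_or_lt with rfl | hN
  · simp
  exact ENNReal.one_le_rpow (W_one_le _ _) hN

lemma W_rpow_ne_top {n : ℕ} (N : ℝ) (k : ℕ) (y : Rn n) : W k y ^ N ≠ ∞ := by
  rw [Ne, ENNReal.rpow_eq_top_iff]; simp [W_ne_zero, W_ne_top]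

/-- Peetre-type maximal function. -/
def MN {n : ℕ} (N : ℝ) (g : ℕ → Rn n → ℝ≥0∞) (k : ℕ) (y : Rn n) : ℝ≥0∞ :=
  ⨆ i : ℕ, ⨆ z : Rn n, 2 ^ (-((i:ℝ) * N)) * W k (y - z) ^ (-N) * g (k + i) z

def Rt {n : ℕ} (N r : ℝ) (g : ℕ → Rn n → ℝ≥0∞) (k i : ℕ) (y : Rn n) : ℝ≥0∞ :=
  2 ^ (-((i:ℝ) * (N * r))) * 2 ^ (((k + i : ℕ):ℝ) * n) * ∫⁻ w, W k (y - w) ^ (-(N * r)) * g (k + i) w ^ r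

def RN {n : ℕ} (N r : ℝ) (g : ℕ → Rn n → ℝ≥0∞) (k : ℕ) (y : Rn n) : ℝ≥0∞ := ∑' i : ℕ, Rt N r g k i y

def HypN {n : ℕ} (CN : ℕ → ℝ≥0∞) (g : ℕ → Rn n → ℝ≥0∞) : Prop :=
  ∀ N k : ℕ, ∀ y, g k y ≤ CN N * ∑' i : ℕ, 2 ^ (-((i:ℝ) * N)) * ∫⁻ z, eta k N (y - z) * g (k + i) z

def HypT {n : ℕ} (g : ℕ → Rn n → ℝ≥0∞) : Prop :=
  ∃ A : ℕ, ∃ C : ℝ≥0∞, C < ∞ ∧ ∀ k z, g k z ≤ C * 2 ^ ((k:ℝ) * A) * W 0 z ^ (A:ℝ)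

lemma g_le_MN {n : ℕ} (N : ℝ) (g : ℕ → Rn n → ℝ≥0∞) (k : ℕ) (y : Rn n) : g k y ≤ MN N g k y := by
  refine le_trans ?_ (le_iSup_of_le 0 (le_iSup_of_le y le_rfl))
  simp [W]

lemma RN_shift {n : ℕ} {N r : ℝ} (hN : 0 ≤ N) (hr : 0 ≤ r) (g : ℕ → Rn n → ℝ≥0∞) (k i : ℕ) (y z : Rn n) :
    2 ^ (-((i:ℝ) * (N * r))) * W k (y - z) ^ (-(N * r)) * RN N r g (k + i) z ≤ RN N r g k y := by
  have h : ∀ l, 2 ^ (-((i:ℝ) * (N * r))) * W k (y - z) ^ (-(N * r)) * Rt N r g (k + i) l z ≤ Rt N r g k (i + l) y := by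
    intro l
    unfold Rt
    have e : k + (i + l) = k + i + l := by ring
    rw [e]
    have e2 : (2:ℝ≥0∞) ^ (-((i + l : ℕ):ℝ) * (N * r)) = 2 ^ (-((i:ℝ) * (N * r))) * 2 ^ (-((l:ℝ) * (N * r))) := by
      rw [← two_rpow_add]; congr 1; push_cast; ring
    rw [← neg_mul] at e2 ⊢
    rw [← neg_mul ((i + l : ℕ):ℝ), e2]
    calc _ = 2 ^ (-(i:ℝ) * (N * r)) * 2 ^ (-((l:ℝ) * (N * r))) * 2 ^ (((k + i + l : ℕ):ℝ) * n) *
        ∫⁻ w, W k (y - z) ^ (-(N * r)) * (W (k + i) (z - w) ^ (-(N * r)) * g (k + i + l) w ^ r) := by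
          rw [lintegral_const_mul' _ _ (W_rpow_ne_top _ _ _)]; ring
      _ ≤ _ := by
          rw [← neg_mul]
          refine mul_le_mul' le_rfl (lintegral_mono fun w => ?_)
          simp only
          rw [← mul_assoc]
          refine mul_le_mul' ?_ le_rfl
          have := W_neg (mul_nonneg hN hr) (Nat.le_add_right k i) y z w
          simpa only [neg_mul] using this
  unfold RN
  rw [← ENNReal.tsum_mul_left]
  refine (ENNReal.tsum_le_tsum h).trans ?_
  exact ENNReal.tsum_comp_le_tsum_of_injective (f := fun l : ℕ => i + l) (fun a b h => by simpa using h)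
    (fun m => Rt N r g k m y)

lemma MN_le {n : ℕ} {r : ℝ} (hr : 0 < r) (hr1 : r ≤ 1) {CN : ℕ → ℝ≥0∞} {g : ℕ → Rn n → ℝ≥0∞}
    (hg : HypN CN g) (N k : ℕ) (y : Rn n) (hMt : MN N g k y ≠ ∞) :
    MN N g k y ≤ CN N * (MN N g k y ^ (1 - r) * RN N r g k y) := by
  refine iSup_le fun i => iSup_le fun z => ?_
  have hN0 : (0:ℝ) ≤ N := by positivity
  refine (mul_le_mul' le_rfl (hg N (k + i) z)).trans ?_
  rw [mul_left_comm]
  refine mul_le_mul' le_rfl ?_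
  rw [← ENNReal.tsum_mul_left]
  have h : ∀ l : ℕ, 2 ^ (-((i:ℝ) * N)) * W k (y - z) ^ (-(N:ℝ)) *
      (2 ^ (-((l:ℝ) * N)) * ∫⁻ w, eta (k + i) N (z - w) * g (k + i + l) w) ≤
      MN N g k y ^ (1 - r) * Rt N r g k (i + l) y := by
    intro l
    have e : k + (i + l) = k + i + l := by ring
    set c : ℝ≥0∞ := 2 ^ (-((i:ℝ) * N)) * 2 ^ (-((l:ℝ) * N)) with hc
    have hct : c ≠ ∞ := ENNReal.mul_ne_top (two_rpow_ne_top _) (two_rpow_ne_top _)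
    have hc' : c = 2 ^ (-(((i + l : ℕ):ℝ) * N)) := by
      rw [hc, ← two_rpow_add]; congr 1; push_cast; ring
    have ha : ∀ w, c * W k (y - w) ^ (-(N:ℝ)) * g (k + i + l) w ≤
        MN N g k y ^ (1 - r) * (c ^ r * (W k (y - w) ^ (-(N * r)) * g (k + i + l) w ^ r)) := by
      intro w
      set a := c * W k (y - w) ^ (-(N:ℝ)) * g (k + i + l) w with ha
      have h1 : a ≤ MN N g k y := by
        refine le_trans ?_ (le_iSup_of_le (i + l) (le_iSup_of_le w le_rfl))
        rw [ha, hc', e]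
      have h2 : a ^ r = c ^ r * (W k (y - w) ^ (-(N * r)) * g (k + i + l) w ^ r) := by
        rw [ha, ENNReal.mul_rpow_of_nonneg _ _ hr.le, ENNReal.mul_rpow_of_nonneg _ _ hr.le, mul_assoc,
          ← ENNReal.rpow_mul, neg_mul]
      rw [← h2]
      calc a = a ^ (1 - r) * a ^ r := by
            rw [← ENNReal.rpow_add_of_nonneg _ _ (by linarith) hr.le]; simp
        _ ≤ _ := mul_le_mul' (ENNReal.rpow_le_rpow h1 (by linarith)) le_rfl
    calc _ = 2 ^ (((k + i : ℕ):ℝ) * n) * ∫⁻ w, c * (W k (y - z) ^ (-(N:ℝ)) *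
          (W (k + i) (z - w) ^ (-(N:ℝ)) * g (k + i + l) w)) := by
          unfold eta
          simp_rw [mul_assoc]
          rw [lintegral_const_mul' _ _ hct, lintegral_const_mul' _ _ (W_rpow_ne_top _ _ _),
            lintegral_const_mul' _ _ (two_rpow_ne_top _), hc]
          ring
      _ ≤ 2 ^ (((k + i + l : ℕ):ℝ) * n) * ∫⁻ w, c * W k (y - w) ^ (-(N:ℝ)) * g (k + i + l) w := by
          refine mul_le_mul' (two_rpow_le ?_) (lintegral_mono fun w => ?_)
          · exact mul_le_mul_of_nonneg_right (by exact_mod_cast Nat.le_add_right _ _) (by positivity)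
          · simp only
            rw [← mul_assoc (W k (y - z) ^ (-(N:ℝ))), ← mul_assoc]
            exact mul_le_mul' (mul_le_mul' le_rfl (W_neg hN0 (Nat.le_add_right k i) y z w)) le_rfl
      _ ≤ 2 ^ (((k + i + l : ℕ):ℝ) * n) * ∫⁻ w, MN N g k y ^ (1 - r) *
            (c ^ r * (W k (y - w) ^ (-(N * r)) * g (k + i + l) w ^ r)) :=
          mul_le_mul' le_rfl (lintegral_mono ha)
      _ ≤ _ := by
          have hM : MN N g k y ^ (1 - r) ≠ ∞ := ENNReal.rpow_ne_top_of_nonneg (by linarith) hMt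
          rw [lintegral_const_mul' _ _ hM, lintegral_const_mul' _ _ (ENNReal.rpow_ne_top_of_nonneg hr.le hct),
            hc', ← ENNReal.rpow_mul]
          unfold Rt
          rw [e]
          apply le_of_eq
          have e3 : -(((i + l : ℕ):ℝ) * N) * r = -(((i + l : ℕ):ℝ) * (N * r)) := by ring
          rw [e3]; ring
  refine (ENNReal.tsum_le_tsum h).trans ?_
  rw [ENNReal.tsum_mul_left]
  refine mul_le_mul' le_rfl ?_
  exact ENNReal.tsum_comp_le_tsum_of_injective (f := fun l : ℕ => i + l) (fun a b h => by simpa using h)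
    (fun m => Rt N r g k m y)

lemma MN_rpow_le {n : ℕ} {r : ℝ} (hr : 0 < r) (hr1 : r ≤ 1) {CN : ℕ → ℝ≥0∞} {g : ℕ → Rn n → ℝ≥0∞}
    (hg : HypN CN g) (N k : ℕ) (y : Rn n) (hMt : MN N g k y ≠ ∞) :
    MN N g k y ^ r ≤ CN N * RN N r g k y := by
  have h := MN_le hr hr1 hg N k y hMt
  set M := MN N g k y
  rcases eq_or_ne M 0 with h0 | h0
  · rw [h0, ENNReal.zero_rpow_of_pos hr]; exact zero_le
  have hM : M ^ (1 - r) ≠ ∞ := ENNReal.rpow_ne_top_of_nonneg (by linarith) hMt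
  have hM0 : M ^ (1 - r) ≠ 0 := by rw [Ne, ENNReal.rpow_eq_zero_iff]; simp [h0, hMt]
  have e : M = M ^ (1 - r) * M ^ r := by
    rw [← ENNReal.rpow_add _ _ h0 hMt]; simp
  rw [mul_left_comm] at h
  have h5 : M ^ (1 - r) * M ^ r ≤ M ^ (1 - r) * (CN N * RN N r g k y) := by rw [← e]; exact h
  exact (ENNReal.mul_le_mul_iff_right hM0 hM).1 h5

lemma MN_fin {n : ℕ} {g : ℕ → Rn n → ℝ≥0∞} {A : ℕ} {C : ℝ≥0∞} (hC : C < ∞)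
    (hg : ∀ k z, g k z ≤ C * 2 ^ ((k:ℝ) * A) * W 0 z ^ (A:ℝ)) {N : ℕ} (hN : A ≤ N) (k : ℕ) (y : Rn n) :
    MN N g k y ≠ ∞ := by
  have hA : (A:ℝ) ≤ N := by exact_mod_cast hN
  have hle : MN N g k y ≤ C * 2 ^ ((k:ℝ) * A) * W 0 y ^ (A:ℝ) := by
    refine iSup_le fun i => iSup_le fun z => ?_
    refine (mul_le_mul' le_rfl (hg (k + i) z)).trans ?_
    have h1 : W 0 z ^ (A:ℝ) ≤ W 0 y ^ (A:ℝ) * W k (y - z) ^ (A:ℝ) := by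
      rw [← ENNReal.mul_rpow_of_nonneg _ _ (by positivity)]
      refine ENNReal.rpow_le_rpow ?_ (by positivity)
      have := W_sub 0 z y 0
      rw [sub_zero, sub_zero, mul_comm, W_comm] at this
      exact this.trans (mul_le_mul' le_rfl (W_mono (Nat.zero_le _) _))
    have h2 : W k (y - z) ^ (-(N:ℝ)) * W k (y - z) ^ (A:ℝ) ≤ 1 := by
      rw [← ENNReal.rpow_add _ _ (W_ne_zero _ _) (W_ne_top _ _)]
      have := W_neg_le_one (N := N - A) (by linarith) k (y - z)
      rwa [show -((N:ℝ) - A) = -N + A by ring] at this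
    have h3 : (2:ℝ≥0∞) ^ (-((i:ℝ) * N)) * 2 ^ (((k + i : ℕ):ℝ) * A) ≤ 2 ^ ((k:ℝ) * A) := by
      rw [← two_rpow_add]; apply two_rpow_le; push_cast
      nlinarith [mul_le_mul_of_nonneg_left hA (Nat.cast_nonneg (α := ℝ) i)]
    calc _ ≤ 2 ^ (-((i:ℝ) * N)) * W k (y - z) ^ (-(N:ℝ)) *
          (C * 2 ^ (((k + i : ℕ):ℝ) * A) * (W 0 y ^ (A:ℝ) * W k (y - z) ^ (A:ℝ))) :=
          mul_le_mul' le_rfl (mul_le_mul' le_rfl h1)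
      _ = C * (2 ^ (-((i:ℝ) * N)) * 2 ^ (((k + i : ℕ):ℝ) * A)) * W 0 y ^ (A:ℝ) *
          (W k (y - z) ^ (-(N:ℝ)) * W k (y - z) ^ (A:ℝ)) := by ring
      _ ≤ C * 2 ^ ((k:ℝ) * A) * W 0 y ^ (A:ℝ) * 1 :=
          mul_le_mul' (mul_le_mul' (mul_le_mul' le_rfl h3) le_rfl) h2
      _ = _ := mul_one _
  refine (hle.trans_lt ?_).ne
  exact ENNReal.mul_lt_top (ENNReal.mul_lt_top hC (two_rpow_ne_top _).lt_top) (W_rpow_ne_top _ _ _).lt_top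

lemma RN_anti {n : ℕ} {r : ℝ} (hr : 0 ≤ r) {N N' : ℝ} (h : N ≤ N') (g : ℕ → Rn n → ℝ≥0∞) (k : ℕ) (y : Rn n) :
    RN N' r g k y ≤ RN N r g k y := by
  unfold RN Rt
  have h1 : N * r ≤ N' * r := mul_le_mul_of_nonneg_right h hr
  refine ENNReal.tsum_le_tsum fun i => ?_
  refine mul_le_mul' (mul_le_mul' (two_rpow_le ?_) le_rfl) (lintegral_mono fun w => mul_le_mul' ?_ le_rfl)
  · have := mul_le_mul_of_nonneg_left h1 (Nat.cast_nonneg (α := ℝ) i)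
    linarith
  · exact ENNReal.rpow_le_rpow_of_exponent_le (W_one_le _ _) (by linarith)

lemma rychkov {n : ℕ} {r : ℝ} (hr : 0 < r) (hr1 : r ≤ 1) {CN : ℕ → ℝ≥0∞} (hCN : ∀ N, CN N < ∞)
    {g : ℕ → Rn n → ℝ≥0∞} (hg : HypN CN g) (hT : HypT g) (N k : ℕ) (y : Rn n) :
    g k y ^ r ≤ (CN N + 1) * RN N r g k y := by
  obtain ⟨A, C, hC, hA⟩ := hT
  have big : ∀ k y, g k y ^ r ≤ CN (max N A) * RN N r g k y := by
    intro k y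
    have hf := MN_fin hC hA (le_max_right N A) k y
    refine (ENNReal.rpow_le_rpow (g_le_MN ((max N A : ℕ):ℝ) g k y) hr.le).trans ?_
    refine (MN_rpow_le hr hr1 hg (max N A) k y hf).trans (mul_le_mul' le_rfl ?_)
    exact RN_anti hr.le (by exact_mod_cast le_max_left _ _) g k y
  by_cases hR : RN N r g k y = ∞
  · rw [hR, ENNReal.mul_top (by simp)]; exact le_top
  have hM : MN N g k y ^ r ≤ CN (max N A) * RN N r g k y := by
    rw [← ENNReal.le_rpow_inv_iff hr]
    refine iSup_le fun i => iSup_le fun z => ?_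
    rw [ENNReal.le_rpow_inv_iff hr, ENNReal.mul_rpow_of_nonneg _ _ hr.le, ENNReal.mul_rpow_of_nonneg _ _ hr.le,
      ← ENNReal.rpow_mul, ← ENNReal.rpow_mul]
    refine (mul_le_mul' le_rfl (big (k + i) z)).trans ?_
    rw [mul_left_comm]
    refine mul_le_mul' le_rfl ?_
    have := RN_shift (N := N) (Nat.cast_nonneg N) hr.le g k i y z
    refine le_trans (le_of_eq ?_) this
    rw [neg_mul, neg_mul, mul_assoc (i:ℝ)]
  have hMt : MN N g k y ≠ ∞ := by
    intro h
    rw [h, ENNReal.top_rpow_of_pos hr, top_le_iff] at hM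
    exact ENNReal.mul_ne_top (hCN _).ne hR hM
  refine (ENNReal.rpow_le_rpow (g_le_MN (N:ℝ) g k y) hr.le).trans ?_
  exact (MN_rpow_le hr hr1 hg N k y hMt).trans (mul_le_mul' le_self_add le_rfl)

end TL
end

section
namespace TL

lemma exists_r {p : ℝ} (hp : 0 < p) {q : ℝ≥0∞} (hq : 0 < q) :
    ∃ r : ℝ, 0 < r ∧ r ≤ 1 ∧ r < p ∧ ENNReal.ofReal r < q := by
  obtain ⟨t, ht0, htq⟩ := exists_between hq
  have ht : t ≠ ∞ := (htq.trans_le le_top).ne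
  have ht1 : 0 < t.toReal := ENNReal.toReal_pos ht0.ne' ht
  refine ⟨min (min 1 (p / 2)) t.toReal, by positivity, (min_le_left _ _).trans (min_le_left _ _), ?_, ?_⟩
  · refine ((min_le_left _ _).trans (min_le_right _ _)).trans_lt (by linarith)
  · refine lt_of_le_of_lt (ENNReal.ofReal_le_ofReal (min_le_right _ _)) ?_
    rwa [ENNReal.ofReal_toReal ht]

lemma tsum_shift_le (a : ℕ → ℝ≥0∞) (k : ℕ) :
    ∑' i : ℕ, (2:ℝ≥0∞) ^ (-(i:ℝ)) * a (k + i) ≤ ∑' m, gk 1 k m * a m := by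
  refine le_trans (le_of_eq ?_) (ENNReal.tsum_comp_le_tsum_of_injective (f := fun i : ℕ => k + i)
    (fun a b h => by simpa using h) (fun m => gk 1 k m * a m))
  congr 1; ext i
  simp [gk]

theorem main_abs (n : ℕ) (s : ℝ) {p : ℝ} (hp : 0 < p) {q : ℝ≥0∞} (hq : 0 < q) {δ : ℝ} (hδ : 0 < δ)
    (Cb CN : ℕ → ℝ≥0∞) (hCb : ∀ L, Cb L < ∞) (hCN : ∀ N, CN N < ∞) :
    ∃ C : ℝ≥0∞, C < ∞ ∧ ∀ g b : ℕ → Rn n → ℝ≥0∞, (∀ k, Measurable (g k)) → HypN CN g → HypT g →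
      (∀ L j : ℕ, ∀ x, b j x ≤ Cb L * ∑' k, gk δ j k * 2 ^ (((k:ℝ) - j) * s) * ∫⁻ z, eta k L (x - z) * g k z) →
      ∫⁻ x, lqSum q (fun j => 2 ^ ((j:ℝ) * s) * b j x) ^ p ≤
        C * ∫⁻ x, lqSum q (fun k => 2 ^ ((k:ℝ) * s) * g k x) ^ p := by
  obtain ⟨r, hr, hr1, hrp, hrq⟩ := exists_r hp hq
  obtain ⟨N, hN⟩ := exists_nat_ge (max (((n:ℝ) + 1) / r) (((n:ℝ) + 1) / r - s))
  have hN1 : (n:ℝ) + 1 ≤ N * r := by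
    have := (le_max_left _ _).trans hN
    rwa [div_le_iff₀ hr] at this
  have hN2 : (n:ℝ) + 1 ≤ (N + s) * r := by
    have := (le_max_right _ _).trans hN
    rw [← div_le_iff₀ hr]; linarith
  have hr' : ENNReal.ofReal r ≠ 0 := by simpa using hr
  have hQ : 1 < q / ENNReal.ofReal r := by
    rw [ENNReal.lt_div_iff_mul_lt (Or.inl hr') (Or.inl ENNReal.ofReal_ne_top), one_mul]; exact hrq
  have hP : 1 < p / r := by rw [lt_div_iff₀ hr]; linarith
  obtain ⟨C1, hC1, conv1⟩ := lqSum_conv q hq hδ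
  obtain ⟨C2, hC2, conv2⟩ := lqSum_conv (q / ENNReal.ofReal r) (one_pos.trans hQ) (δ := 1) one_pos
  obtain ⟨C3, hC3, fs⟩ := FS n hP (q / ENNReal.ofReal r) hQ
  set L : ℕ := N + (n + 1) with hL
  set D : ℝ≥0∞ := Cb L * (TC n * (CN N + 1) ^ (1 / r)) with hD
  have hDt : D < ∞ := ENNReal.mul_lt_top (hCb L) (ENNReal.mul_lt_top (TC_lt n)
    (ENNReal.rpow_lt_top_of_nonneg (by positivity) (ENNReal.add_lt_top.2 ⟨hCN N, by simp⟩).ne))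
  refine ⟨(D * C1) ^ p * (C3 * C2 ^ (p / r)), ?_, ?_⟩
  · refine ENNReal.mul_lt_top (ENNReal.rpow_lt_top_of_nonneg hp.le (ENNReal.mul_lt_top hDt hC1).ne)
      (ENNReal.mul_lt_top hC3 (ENNReal.rpow_lt_top_of_nonneg (by positivity) hC2.ne))
  intro g b hgm hHN hHT hb
  set a : ℕ → Rn n → ℝ≥0∞ := fun k x => (2 ^ ((k:ℝ) * s) * g k x) ^ r with ha
  have ham : ∀ k, Measurable (a k) := fun k => ((hgm k).const_mul _).pow_const _
  set G : ℕ → Rn n → ℝ≥0∞ := fun k x => ∑' i : ℕ, (2:ℝ≥0∞) ^ (-(i:ℝ)) * a (k + i) x with hG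
  have hGm : ∀ k, Measurable (G k) := fun k => Measurable.tsum fun i => (ham _).const_mul _
  have hR : ∀ (k : ℕ) (x : Rn n), (2 ^ ((k:ℝ) * s)) ^ r * RN N r g k x ≤ T k (G k) x := by
    intro k x
    have e : T k (G k) x = ∑' i : ℕ, ∫⁻ z, eta k ((n:ℝ) + 1) (x - z) * ((2:ℝ≥0∞) ^ (-(i:ℝ)) * a (k + i) z) := by
      rw [← lintegral_tsum]
      · simp_rw [ENNReal.tsum_mul_left]; rfl
      · exact fun i => (mmul (meas_eta_sub _ _ _) ((ham _).const_mul _)).aemeasurable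
    rw [e, RN, ← ENNReal.tsum_mul_left]
    refine ENNReal.tsum_le_tsum fun i => ?_
    unfold Rt
    rw [← mul_assoc, ← mul_assoc, ← ENNReal.rpow_mul, ← two_rpow_add, ← two_rpow_add,
      ← lintegral_const_mul' _ _ (two_rpow_ne_top _)]
    refine lintegral_mono fun w => ?_
    simp only [ha, eta]
    rw [ENNReal.mul_rpow_of_nonneg _ _ hr.le, ← ENNReal.rpow_mul]
    calc _ ≤ (2:ℝ≥0∞) ^ ((k:ℝ) * n + -(i:ℝ) + ((k + i : ℕ):ℝ) * s * r) *
          (W k (x - w) ^ (-((n:ℝ) + 1)) * g (k + i) w ^ r) := by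
          refine mul_le_mul' (two_rpow_le ?_) (mul_le_mul' ?_ le_rfl)
          · push_cast
            nlinarith [mul_le_mul_of_nonneg_left hN2 (Nat.cast_nonneg (α := ℝ) i)]
          · exact ENNReal.rpow_le_rpow_of_exponent_le (W_one_le _ _) (by linarith)
      _ = _ := by
          rw [two_rpow_add, two_rpow_add]; ring
  have hI : ∀ (k : ℕ) (x : Rn n), ∫⁻ z, eta k L (x - z) * g k z ≤ TC n * (((CN N + 1) * RN N r g k x) ^ (1 / r)) := by
    intro k x
    have h1 : ∀ z, eta k L (x - z) * g k z ≤ eta k ((n:ℝ) + 1) (x - z) * ((CN N + 1) * RN N r g k x) ^ (1 / r) := by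
      intro z
      have e : eta k L (x - z) = eta k ((n:ℝ) + 1) (x - z) * W k (x - z) ^ (-(N:ℝ)) := by
        unfold eta
        rw [mul_assoc, ← ENNReal.rpow_add _ _ (W_ne_zero _ _) (W_ne_top _ _)]
        congr 2; rw [hL]; push_cast; ring
      rw [e, mul_assoc]
      refine mul_le_mul' le_rfl ?_
      rw [one_div, ENNReal.le_rpow_inv_iff hr, ENNReal.mul_rpow_of_nonneg _ _ hr.le, ← ENNReal.rpow_mul]
      refine (mul_le_mul' le_rfl (rychkov hr hr1 hCN hHN hHT N k z)).trans ?_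
      rw [mul_left_comm]
      refine mul_le_mul' le_rfl ?_
      have := RN_shift (N := N) (Nat.cast_nonneg N) hr.le g k 0 x z
      refine le_trans (le_of_eq ?_) this
      simp
    refine (lintegral_mono h1).trans ?_
    rw [lintegral_mul_const _ (meas_eta_sub _ _ _)]
    exact mul_le_mul' (int_eta k x) le_rfl
  have hB : ∀ (j : ℕ) (x : Rn n), 2 ^ ((j:ℝ) * s) * b j x ≤ D * ∑' k, gk δ j k * T k (G k) x ^ (1 / r) := by
    intro j x
    refine (mul_le_mul' le_rfl (hb L j x)).trans ?_
    rw [hD, mul_left_comm, mul_assoc]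
    refine mul_le_mul' le_rfl ?_
    rw [← ENNReal.tsum_mul_left, ← ENNReal.tsum_mul_left]
    refine ENNReal.tsum_le_tsum fun k => ?_
    calc _ ≤ 2 ^ ((j:ℝ) * s) * (gk δ j k * 2 ^ (((k:ℝ) - j) * s) *
          (TC n * (((CN N + 1) * RN N r g k x) ^ (1 / r)))) :=
          mul_le_mul' le_rfl (mul_le_mul' le_rfl (hI k x))
      _ = TC n * (CN N + 1) ^ (1 / r) * (gk δ j k * ((2 ^ ((j:ℝ) * s) * 2 ^ (((k:ℝ) - j) * s)) * RN N r g k x ^ (1 / r))) := by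
          rw [ENNReal.mul_rpow_of_nonneg _ _ (by positivity)]; ring
      _ ≤ _ := by
          refine mul_le_mul' le_rfl (mul_le_mul' le_rfl ?_)
          refine le_trans (le_of_eq ?_) (ENNReal.rpow_le_rpow (hR k x) (by positivity : 0 ≤ 1 / r))
          rw [ENNReal.mul_rpow_of_nonneg _ _ (by positivity), ← ENNReal.rpow_mul, mul_one_div_cancel hr.ne',
            ENNReal.rpow_one, ← two_rpow_add]
          congr 2; ring
  have e1 : ∀ u : ℕ → ℝ≥0∞, lqSum q (fun k => u k ^ (1 / r)) ^ p = lqSum (q / ENNReal.ofReal r) u ^ (p / r) := by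
    intro u
    rw [lqSum_rpow q hq hr, ← ENNReal.rpow_mul]; congr 1; ring
  calc ∫⁻ x, lqSum q (fun j => 2 ^ ((j:ℝ) * s) * b j x) ^ p
      ≤ ∫⁻ x, (D * C1) ^ p * lqSum (q / ENNReal.ofReal r) (fun k => T k (G k) x) ^ (p / r) := by
        refine lintegral_mono fun x => ?_
        simp only
        rw [← e1, ← ENNReal.mul_rpow_of_nonneg _ _ hp.le]
        refine ENNReal.rpow_le_rpow ?_ hp.le
        refine (lqSum_mono q (fun j => hB j x)).trans ?_
        rw [lqSum_const_mul q hq, mul_assoc D C1]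
        exact mul_le_mul' le_rfl (conv1 _)
    _ = (D * C1) ^ p * ∫⁻ x, lqSum (q / ENNReal.ofReal r) (fun k => T k (G k) x) ^ (p / r) := by
        rw [lintegral_const_mul']
        exact ENNReal.rpow_ne_top_of_nonneg hp.le (ENNReal.mul_lt_top hDt hC1).ne
    _ ≤ (D * C1) ^ p * (C3 * ∫⁻ x, lqSum (q / ENNReal.ofReal r) (fun k => G k x) ^ (p / r)) :=
        mul_le_mul' le_rfl (fs G hGm)
    _ ≤ (D * C1) ^ p * (C3 * ∫⁻ x, C2 ^ (p / r) * lqSum (q / ENNReal.ofReal r) (fun k => a k x) ^ (p / r)) := by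
        refine mul_le_mul' le_rfl (mul_le_mul' le_rfl (lintegral_mono fun x => ?_))
        simp only
        rw [← ENNReal.mul_rpow_of_nonneg _ _ (by positivity)]
        refine ENNReal.rpow_le_rpow ?_ (by positivity)
        refine (lqSum_mono _ (fun k => tsum_shift_le (fun m => a m x) k)).trans ?_
        exact conv2 _
    _ = (D * C1) ^ p * (C3 * (C2 ^ (p / r) * ∫⁻ x, lqSum (q / ENNReal.ofReal r) (fun k => a k x) ^ (p / r))) := by
        rw [lintegral_const_mul']
        exact ENNReal.rpow_ne_top_of_nonneg (by positivity) hC2.ne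
    _ = (D * C1) ^ p * (C3 * C2 ^ (p / r)) * ∫⁻ x, lqSum q (fun k => 2 ^ ((k:ℝ) * s) * g k x) ^ p := by
        rw [← mul_assoc C3, ← mul_assoc]
        congr 2; ext x
        rw [← e1]
        congr 2; ext k
        simp only [ha]
        rw [← ENNReal.rpow_mul, mul_one_div_cancel hr.ne', ENNReal.rpow_one]

end TL
end

section
namespace TL

variable {n : ℕ}

def bv (i : Fin n) : Rn n := EuclideanSpace.single i (1 : ℝ)

lemma norm_bv (i : Fin n) : ‖bv i‖ = 1 := by simp [bv]

def Dl : List (Fin n) → (Sch n →L[ℂ] Sch n)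
  | [] => ContinuousLinearMap.id ℂ _
  | i :: l => (LineDeriv.lineDerivOpCLM ℂ (Sch n) (bv i)).comp (Dl l)

lemma Dl_nil (φ : Sch n) : Dl [] φ = φ := rfl

lemma Dl_cons (i : Fin n) (l : List (Fin n)) (φ : Sch n) (x : Rn n) :
    Dl (i :: l) φ x = fderiv ℝ (Dl l φ) x (bv i) := rfl

lemma Dl_cons' (i : Fin n) (l : List (Fin n)) (φ : Sch n) :
    ⇑(Dl (i :: l) φ) = pd i ⇑(Dl l φ) := by
  ext x
  rw [Dl_cons, pd, ← (Dl l φ).differentiableAt.lineDeriv_eq_fderiv]; rfl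

lemma Dl_foldr (l : List (Fin n)) (φ : Sch n) : ⇑(Dl l φ) = l.foldr pd ⇑φ := by
  induction l with
  | nil => rfl
  | cons i l ih => rw [Dl_cons', ih]; rfl

def la (α : Fin n → ℕ) : List (Fin n) := (List.finRange n).flatMap fun i => List.replicate (α i) i

lemma foldr_replicate (i : Fin n) (k : ℕ) (g : Rn n → ℂ) :
    (List.replicate k i).foldr pd g = (pd i)^[k] g := by
  induction k with
  | zero => rfl
  | succ k ih => rw [List.replicate_succ, List.foldr_cons, ih, Function.iterate_succ_apply']

lemma mderiv_eq (α : Fin n → ℕ) (φ : Sch n) : mderiv α (fun y => φ y) = ⇑(Dl (la α) φ) := by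
  rw [Dl_foldr, mderiv, la]
  induction List.finRange n with
  | nil => rfl
  | cons i l ih =>
    rw [List.flatMap_cons, List.foldr_append, List.foldr_cons, ih, foldr_replicate]

lemma Dl_apply (l : List (Fin n)) (φ : Sch n) (x : Rn n) :
    Dl l φ x = iteratedFDeriv ℝ l.length φ x (fun k => bv (l.get k)) := by
  induction l generalizing x with
  | nil => simp [Dl_nil]
  | cons i l ih =>
    rw [Dl_cons]
    have h : ⇑(Dl l φ) = fun x => iteratedFDeriv ℝ l.length φ x (fun k => bv (l.get k)) :=
      funext ih
    have hd : DifferentiableAt ℝ (iteratedFDeriv ℝ l.length φ) x :=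
      ((φ.smooth ⊤).differentiable_iteratedFDeriv (by exact_mod_cast ENat.coe_lt_top _)) x
    rw [h, fderiv_continuousMultilinear_apply_const hd]
    refine Eq.trans ?_ (iteratedFDeriv_succ_apply_left (n := l.length)
      (fun k => bv ((i :: l).get k))).symm
    rfl

lemma Dl_swap (φ : Sch n) (i j : Fin n) (l : List (Fin n)) :
    Dl (i :: j :: l) φ = Dl (j :: i :: l) φ := by
  ext x
  have key : ∀ i j : Fin n, Dl (i :: j :: l) φ x
      = fderiv ℝ (fderiv ℝ (Dl l φ)) x (bv i) (bv j) := by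
    intro i j
    rw [Dl_cons]
    have h : ⇑(Dl (j :: l) φ) = fun y => fderiv ℝ (Dl l φ) y (bv j) := rfl
    have hd : DifferentiableAt ℝ (fderiv ℝ (Dl l φ)) x := by
      have := ((Dl l φ).smooth 2).fderiv_right (m := 1) (by norm_num)
      exact (this.differentiable (by norm_num)) x
    rw [h, fderiv_clm_apply hd (by fun_prop)]
    simp
  rw [key, key]
  have := ((Dl l φ).contDiffAt 2 (x := x)).isSymmSndFDerivAt (by simp)
  exact this _ _

lemma Dl_perm (φ : Sch n) {l l' : List (Fin n)} (h : l.Perm l') : Dl l φ = Dl l' φ := by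
  induction h with
  | nil => rfl
  | cons i _ ih => ext x; rw [Dl_cons, Dl_cons, ih]
  | swap i j l => exact Dl_swap _ _ _ _
  | trans _ _ h1 h2 => exact h1.trans h2

lemma count_la (α : Fin n → ℕ) (i : Fin n) : (la α).count i = α i := by
  rw [la, List.count_flatMap]
  have : (List.count i ∘ fun i => List.replicate (α i) i) = fun j => if j = i then α i else 0 := by
    funext j
    simp only [Function.comp, List.count_replicate]
    by_cases h : j = i <;> simp [h]
  rw [this, ← List.ofFn_eq_map, List.sum_ofFn]
  simp

lemma exists_mi (l : List (Fin n)) : ∃ α : Fin n → ℕ, mdeg α = l.length ∧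
    ∀ (φ : Sch n), ⇑(Dl l φ) = mderiv α (fun y => φ y) := by
  refine ⟨fun i => l.count i, ?_, fun φ => ?_⟩
  · rw [mdeg]
    simpa using Multiset.sum_count_eq_card (s := Finset.univ) (m := (l : Multiset (Fin n)))
      (by simp)
  · rw [mderiv_eq, Dl_perm φ]
    rw [List.perm_iff_count]
    intro a; rw [count_la]

lemma euclid_sum (v : Rn n) : v = ∑ i, v i • bv i := by
  conv_lhs => rw [← (EuclideanSpace.basisFun (Fin n) ℝ).sum_repr v]
  simp [bv]

lemma norm_coord_le (v : Rn n) (i : Fin n) : ‖v i‖ ≤ ‖v‖ := PiLp.norm_apply_le v i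

lemma iter_le (φ : Sch n) (x : Rn n) (i : ℕ) (B : ℝ) (hB : 0 ≤ B)
    (h : ∀ α : Fin n → ℕ, mdeg α = i → ‖mderiv α (fun y => φ y) x‖ ≤ B) :
    ‖iteratedFDeriv ℝ i φ x‖ ≤ (n : ℝ) ^ i * B := by
  refine ContinuousMultilinearMap.opNorm_le_bound (by positivity) fun v => ?_
  have hv : v = fun k => ∑ j, v k j • bv j := funext fun k => euclid_sum _
  conv_lhs => rw [hv]
  rw [ContinuousMultilinearMap.map_sum]
  have h1 : ∀ m : Fin i → Fin n, ‖iteratedFDeriv ℝ i φ x (fun k => v k (m k) • bv (m k))‖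
      ≤ B * ∏ k, ‖v k‖ := by
    intro m
    rw [ContinuousMultilinearMap.map_smul_univ, norm_smul, mul_comm, norm_prod]
    refine mul_le_mul ?_ (Finset.prod_le_prod (fun _ _ => norm_nonneg _)
      fun k _ => norm_coord_le _ _) (by positivity) hB
    obtain ⟨α, ha, hα⟩ := exists_mi (List.ofFn m)
    have h2 := Dl_apply (List.ofFn m) φ x
    have h3 : iteratedFDeriv ℝ i φ x (fun k => bv (m k)) = Dl (List.ofFn m) φ x := by
      rw [h2]
      have : ∀ (j : ℕ) (hj : i = j) (m' : Fin j → Fin n), (∀ k, m' (Fin.cast hj k) = m k) →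
        iteratedFDeriv ℝ i φ x (fun k => bv (m k)) =
        iteratedFDeriv ℝ j φ x (fun k => bv (m' k)) := by
        intro j hj m' hm; subst hj
        congr 1; funext k; rw [← hm]; rfl
      exact this _ (by simp) _ (by simp)
    rw [h3, hα]
    exact h _ (by simpa using ha)
  refine (norm_sum_le _ _).trans ((Finset.sum_le_sum fun m _ => h1 m).trans ?_)
  simp [mul_assoc]
end TL
end

section
namespace TL

variable {n : ℕ}

/-- product of Schwartz functions -/
def pm (m A : Sch n) : Sch n := SchwartzMap.pairing (ContinuousLinearMap.mul ℂ ℂ) m A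

lemma pm_apply (m A : Sch n) (x : Rn n) : pm m A x = m x * A x := rfl

/-- convolution of Schwartz functions -/
def cv (m A : Sch n) : Sch n := SchwartzMap.convolution (ContinuousLinearMap.mul ℂ ℂ) m A

lemma cv_eq (m A : Sch n) : cv m A = 𝓕⁻ (pm (𝓕 m) (𝓕 A)) := rfl

lemma invS_eq (m : Sch n) : invFourierS m = 𝓕⁻ m := rfl

lemma inv_pm (m A : Sch n) : invFourierS (pm m A) = cv (invFourierS m) (invFourierS A) := by
  rw [cv_eq, invS_eq, invS_eq, invS_eq, FourierTransform.fourier_fourierInv_eq,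
    FourierTransform.fourier_fourierInv_eq]

lemma cv_apply (m A : Sch n) (x y : Rn n) :
    cv m A (x - y) = ∫ z, m (x - z) * A (z - y) := by
  rw [cv, SchwartzMap.convolution_apply, MeasureTheory.convolution_def,
    ← integral_sub_left_eq_self _ volume x]
  congr 1; ext z
  simp only [ContinuousLinearMap.mul_apply']
  congr 2; abel

lemma lineDeriv_cv (v : Rn n) (m A : Sch n) :
    LineDeriv.lineDerivOp v (cv m A) = cv m (LineDeriv.lineDerivOp v A) := by
  rw [cv_eq, cv_eq, SchwartzMap.lineDerivOp_fourierInv_eq, SchwartzMap.fourier_lineDerivOp_eq]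
  congr 1
  ext x
  have h1 : Function.HasTemperateGrowth (fun w : Rn n => (inner ℝ w v)) := by fun_prop
  simp only [pm_apply, smul_apply]
  rw [SchwartzMap.smulLeftCLM_apply_apply (by fun_prop), 
    SchwartzMap.smulLeftCLM_apply_apply (by fun_prop)]
  simp [pm_apply]; ring

lemma Dl_cv (l : List (Fin n)) (m A : Sch n) : Dl l (cv m A) = cv m (Dl l A) := by
  induction l with
  | nil => rfl
  | cons i l ih =>
    change LineDeriv.lineDerivOp (bv i) (Dl l (cv m A)) = cv m (LineDeriv.lineDerivOp (bv i) (Dl l A))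
    rw [ih, lineDeriv_cv]

lemma sR_apply (ψ : Sch n) (x y : Rn n) : shiftReflect ψ x y = ψ (x - y) := rfl

lemma Dl_sR (l : List (Fin n)) (ψ : Sch n) (x : Rn n) :
    Dl l (shiftReflect ψ x) = (-1 : ℂ) ^ l.length • shiftReflect (Dl l ψ) x := by
  induction l with
  | nil => simp [Dl_nil]
  | cons i l ih =>
    ext y
    rw [Dl_cons, ih]
    have : ⇑((-1 : ℂ) ^ l.length • shiftReflect (Dl l ψ) x)
      = fun y => (-1 : ℂ) ^ l.length • (Dl l ψ) (x - y) := rfl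
    have h2 : HasFDerivAt (fun y => (Dl l ψ) (x - y)) 
       ((fderiv ℝ (Dl l ψ) (x - y)).comp (-(ContinuousLinearMap.id ℝ (Rn n)))) y := by
      refine HasFDerivAt.comp y ((Dl l ψ).hasFDerivAt _) ?_
      exact (hasFDerivAt_id y).const_sub x
    rw [this, (h2.fun_const_smul _).fderiv]
    simp [sR_apply, Dl_cons, pow_succ]

/-- joint seminorm -/
def SN (N : ℕ) : Seminorm ℂ (Sch n) :=
  (Finset.Iic (N, N)).sup (fun m => SchwartzMap.seminorm ℂ m.1 m.2)

lemma SN_nonneg (N : ℕ) (φ : Sch n) : 0 ≤ SN N φ := apply_nonneg _ _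

lemma le_SN {N k i : ℕ} (hk : k ≤ N) (hi : i ≤ N) (φ : Sch n) (x : Rn n) :
    (1 + ‖x‖) ^ k * ‖iteratedFDeriv ℝ i φ x‖ ≤ 2 ^ N * SN N φ :=
  SchwartzMap.one_add_le_sup_seminorm_apply (m := (N, N)) hk hi φ x

lemma SN_le {N : ℕ} {φ : Sch n} {B : ℝ} (hB : 0 ≤ B)
    (h : ∀ k ≤ N, ∀ i ≤ N, ∀ x : Rn n, ‖x‖ ^ k * ‖iteratedFDeriv ℝ i φ x‖ ≤ B) : SN N φ ≤ B := by
  refine Seminorm.finset_sup_apply_le hB fun m hm => ?_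
  rw [Finset.mem_Iic] at hm
  exact SchwartzMap.seminorm_le_bound ℂ _ _ _ hB fun x => h _ hm.1 _ hm.2 x

lemma SN_le' {N : ℕ} {φ : Sch n} {B : ℝ} (hB : 0 ≤ B)
    (h : ∀ i ≤ N, ∀ x : Rn n, (1 + ‖x‖) ^ N * ‖iteratedFDeriv ℝ i φ x‖ ≤ B) : SN N φ ≤ B := by
  refine SN_le hB fun k hk i hi x => le_trans ?_ (h i hi x)
  gcongr
  calc ‖x‖ ^ k ≤ (1 + ‖x‖) ^ k := by gcongr; linarith
    _ ≤ _ := pow_le_pow_right₀ (by linarith [norm_nonneg x]) hk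

lemma SN_mono {N M : ℕ} (h : N ≤ M) (φ : Sch n) : SN N φ ≤ SN M φ := by
  have : (SN N : Seminorm ℂ (Sch n)) ≤ SN M :=
    Finset.sup_mono (Finset.Iic_subset_Iic.2 ⟨h, h⟩)
  exact this φ

lemma SN_clm (T : Sch n →L[ℂ] Sch n) (N : ℕ) :
    ∃ C : ℝ, 0 ≤ C ∧ ∃ M : ℕ, ∀ φ, SN N (T φ) ≤ C * SN M φ := by
  have hc : Continuous ((SN N).comp (T : Sch n →ₗ[ℂ] Sch n)) := by
    have : Continuous (SN N : Seminorm ℂ (Sch n)) := by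
      refine Seminorm.continuous_of_le (q := ∑ m ∈ Finset.Iic (N, N),
        SchwartzMap.seminorm ℂ m.1 m.2) ?_ (Seminorm.finset_sup_le_sum _ _)
      have h1 : ⇑(∑ m ∈ Finset.Iic (N, N), SchwartzMap.seminorm ℂ (E := Rn n) (F := ℂ) m.1 m.2)
          = fun φ => ∑ m ∈ Finset.Iic (N, N), SchwartzMap.seminorm ℂ m.1 m.2 φ := by
        funext φ
        rw [← Seminorm.coeFnAddMonoidHom_apply, map_sum, Finset.sum_apply]; rfl
      rw [h1]
      exact continuous_finsetSum _ fun m _ =>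
        (schwartz_withSeminorms ℂ (Rn n) ℂ).continuous_seminorm m
    exact this.comp T.continuous
  obtain ⟨s, C, -, h⟩ := Seminorm.bound_of_continuous (schwartz_withSeminorms ℂ (Rn n) ℂ) _ hc
  refine ⟨C, C.2, s.sup (fun m => max m.1 m.2), fun φ => (h φ).trans ?_⟩
  simp only [Seminorm.smul_apply]
  refine mul_le_mul_of_nonneg_left ?_ C.2
  refine Seminorm.finset_sup_apply_le (SN_nonneg _ _) fun m hm => ?_
  have h1 : m ∈ Finset.Iic ((s.sup (fun m => max m.1 m.2)), (s.sup (fun m => max m.1 m.2))) := by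
    rw [Finset.mem_Iic]
    have := Finset.le_sup (f := fun m : ℕ × ℕ => max m.1 m.2) hm
    exact ⟨(le_max_left _ _).trans this, (le_max_right _ _).trans this⟩
  have h2 : SchwartzMap.seminorm ℂ m.1 m.2 ≤ (SN (s.sup (fun m => max m.1 m.2)) : Seminorm ℂ (Sch n)) :=
    Finset.le_sup (f := fun m : ℕ × ℕ => SchwartzMap.seminorm ℂ m.1 m.2) h1
  exact h2 φ

end TL
end

section
open scoped BoundedContinuousFunction
namespace TL

variable {n : ℕ} {E : Type*} [NormedAddCommGroup E] [NormedSpace ℂ E] [CompleteSpace E]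

/-- transfer of Bochner integrals through an operator bounded by `J` -/
lemma bochner_transfer {X Y : Type*} [AddCommGroup X] [Module ℂ X] [NormedAddCommGroup Y]
    [NormedSpace ℂ Y] [CompleteSpace Y] (J : X →ₗ[ℂ] Y) (F : X →ₗ[ℂ] E) (C : ℝ)
    (hC : ∀ x, ‖F x‖ ≤ C * ‖J x‖) :
    (∀ v : Rn n → X, Continuous (fun z => J (v z)) → Continuous fun z => F (v z)) ∧
    ∀ (v : Rn n → X) (k : Rn n → ℂ) (w : X), Integrable (fun z => k z • J (v z)) →
      J w = ∫ z, k z • J (v z) → F w = ∫ z, k z • F (v z) := by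
  let V : Submodule ℂ Y := (LinearMap.range J).topologicalClosure
  have hV : ∀ x, J x ∈ V := fun x => Submodule.le_topologicalClosure _ ⟨x, rfl⟩
  let e : X →ₗ[ℂ] V := J.codRestrict V hV
  have hd : DenseRange e := by
    intro y
    rw [closure_subtype]
    have h1 : (Subtype.val '' (Set.range e)) = (LinearMap.range J : Set Y) := by
      ext z; constructor
      · rintro ⟨_, ⟨x, rfl⟩, rfl⟩; exact ⟨x, rfl⟩
      · rintro ⟨x, rfl⟩; exact ⟨e x, ⟨x, rfl⟩, rfl⟩
    rw [h1]; exact y.2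
  haveI : CompleteSpace V := (Submodule.isClosed_topologicalClosure _).completeSpace_coe
  let G : V →L[ℂ] E := F.extendOfNorm e
  have hG : ∀ x, G (e x) = F x := LinearMap.extendOfNorm_eq hd ⟨C, hC⟩
  constructor
  · intro v hv
    have : (fun z => F (v z)) = fun z => G (e (v z)) := by funext z; rw [hG]
    rw [this]
    exact G.continuous.comp (hv.subtype_mk _)
  · intro v k w hi hw
    have hi' : Integrable (fun z => k z • e (v z)) := by
      have hm : AEStronglyMeasurable (fun z => k z • e (v z)) volume :=
        (Topology.IsEmbedding.subtypeVal.aestronglyMeasurable_comp_iff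
          (g := (Subtype.val : V → Y))).1 hi.1
      exact ⟨hm, hi.2⟩
    have h1 : e w = ∫ z, k z • e (v z) := by
      apply Subtype.ext
      have := V.subtypeL.integral_comp_comm hi'
      simp only [map_smul] at this
      exact hw.trans this
    rw [← hG, h1, ← G.integral_comp_comm hi']
    simp only [map_smul, hG]

def wgt (K : ℕ) (y : Rn n) : ℝ := (1 + ‖y‖ ^ 2) ^ K

lemma wgt_tg (K : ℕ) : Function.HasTemperateGrowth (fun y : Rn n => (wgt K y : ℂ)) := by
  have h1 : Function.HasTemperateGrowth (fun y : Rn n => ((1 + ‖y‖ ^ 2 : ℝ) : ℂ)) :=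
    Function.Complex.hasTemperateGrowth_ofReal.comp ((Function.HasTemperateGrowth.const 1).add
      (Function.hasTemperateGrowth_norm_sq (Rn n)))
  have := h1.pow K
  have h2 : (fun y : Rn n => (wgt K y : ℂ)) = (fun y : Rn n => ((1 + ‖y‖ ^ 2 : ℝ) : ℂ)) ^ K := by
    funext y; simp [wgt]
  rw [h2]; exact this

lemma wgt_pos (K : ℕ) (y : Rn n) : 0 < wgt K y := by unfold wgt; positivity

lemma wgt_le (K : ℕ) (z y : Rn n) : wgt K y ≤ (1 + ‖z‖) ^ (2 * K) * (1 + ‖z - y‖) ^ (2 * K) := by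
  rw [wgt, ← mul_pow, pow_mul]
  have h : ‖y‖ ≤ ‖z‖ + ‖z - y‖ := by
    calc ‖y‖ = ‖z - (z - y)‖ := by simp
      _ ≤ _ := norm_sub_le _ _
  have hz := norm_nonneg z
  have hy := norm_nonneg y
  have hzy := norm_nonneg (z - y)
  gcongr
  have : 1 + ‖y‖ ≤ (1 + ‖z‖) * (1 + ‖z - y‖) := by nlinarith
  calc 1 + ‖y‖ ^ 2 ≤ (1 + ‖y‖) ^ 2 := by nlinarith
    _ ≤ _ := by gcongr

def jc (K : ℕ) (l : List (Fin n)) : Sch n →L[ℂ] (Rn n →ᵇ ℂ) :=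
  (SchwartzMap.toBoundedContinuousFunctionCLM ℂ (Rn n) ℂ).comp
    ((SchwartzMap.smulLeftCLM ℂ (fun y : Rn n => (wgt K y : ℂ))).comp (Dl l))

lemma jc_apply (K : ℕ) (l : List (Fin n)) (φ : Sch n) (y : Rn n) :
    jc K l φ y = wgt K y * Dl l φ y := by
  simp only [jc, ContinuousLinearMap.comp_apply,
    SchwartzMap.toBoundedContinuousFunctionCLM_apply]
  rw [SchwartzMap.smulLeftCLM_apply_apply (wgt_tg K)]; rfl

lemma jc_sR (K : ℕ) (l : List (Fin n)) (ψ : Sch n) (z y : Rn n) :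
    jc K l (shiftReflect ψ z) y = wgt K y * ((-1) ^ l.length * Dl l ψ (z - y)) := by
  rw [jc_apply, Dl_sR]; rfl

lemma jc_growth (K : ℕ) (l : List (Fin n)) (ψ : Sch n) (z : Rn n) :
    ‖jc K l (shiftReflect ψ z)‖ ≤ 2 ^ (2 * K) * SN (2 * K) (Dl l ψ) * (1 + ‖z‖) ^ (2 * K) := by
  have hs := SN_nonneg (2 * K) (Dl l ψ)
  refine (BoundedContinuousFunction.norm_le (by positivity)).2 fun y => ?_
  rw [jc_sR]
  simp only [norm_mul, norm_pow, norm_neg, norm_one, one_pow, one_mul, Complex.norm_real,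
    Real.norm_of_nonneg (wgt_pos K y).le]
  have h1 := le_SN (le_refl (2 * K)) (Nat.zero_le _) (Dl l ψ) (z - y)
  rw [norm_iteratedFDeriv_zero] at h1
  calc _ ≤ ((1 + ‖z‖) ^ (2 * K) * (1 + ‖z - y‖) ^ (2 * K)) * ‖Dl l ψ (z - y)‖ := by
        gcongr; exact wgt_le K z y
    _ = (1 + ‖z‖) ^ (2 * K) * ((1 + ‖z - y‖) ^ (2 * K) * ‖Dl l ψ (z - y)‖) := by ring
    _ ≤ (1 + ‖z‖) ^ (2 * K) * (2 ^ (2 * K) * SN (2 * K) (Dl l ψ)) := by gcongr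
    _ = _ := by ring

lemma jc_cont (K : ℕ) (l : List (Fin n)) (ψ : Sch n) :
    Continuous fun z => jc K l (shiftReflect ψ z) := by
  set η := Dl l ψ with hη
  set N := max (2 * K) 1
  have hs := SN_nonneg N η
  rw [continuous_iff_continuousAt]
  intro z
  set D : ℝ := (1 + ‖z‖) ^ (2 * K) * 2 ^ (2 * K) * (2 ^ N * SN N η)
  have hD : 0 ≤ D := by positivity
  have key : ∀ z' ∈ ball z 1, dist (jc K l (shiftReflect ψ z')) (jc K l (shiftReflect ψ z))
      ≤ D * dist z' z := by
    intro z' hz'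
    rw [mem_ball] at hz'
    refine (BoundedContinuousFunction.dist_le (by positivity)).2 fun y => ?_
    rw [jc_sR, jc_sR, dist_eq_norm, ← mul_sub, ← mul_sub]
    simp only [norm_mul, norm_pow, norm_neg, norm_one, one_pow, one_mul, Complex.norm_real,
      Real.norm_of_nonneg (wgt_pos K y).le]
    have h2 : ∀ w ∈ ball (z - y) 1, ‖fderiv ℝ η w‖ ≤ 2 ^ (2 * K) * (2 ^ N * SN N η) *
        ((1 + ‖z - y‖) ^ (2 * K))⁻¹ := by
      intro w hw
      rw [mem_ball, dist_eq_norm] at hw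
      have h1 := le_SN (le_max_left (2 * K) 1) (le_max_right (2 * K) 1) η w
      rw [norm_iteratedFDeriv_one] at h1
      have h3 : 1 + ‖z - y‖ ≤ 2 * (1 + ‖w‖) := by
        have : ‖z - y‖ ≤ ‖w‖ + ‖w - (z - y)‖ := by
          calc ‖z - y‖ = ‖w - (w - (z - y))‖ := by simp
            _ ≤ _ := norm_sub_le _ _
        linarith [norm_nonneg w]
      have h4 : (0:ℝ) < (1 + ‖z - y‖) ^ (2 * K) := by positivity
      rw [← div_eq_mul_inv, le_div_iff₀ h4]
      calc _ ≤ ‖fderiv ℝ η w‖ * (2 * (1 + ‖w‖)) ^ (2 * K) := by gcongr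
        _ = 2 ^ (2 * K) * ((1 + ‖w‖) ^ (2 * K) * ‖fderiv ℝ η w‖) := by rw [mul_pow]; ring
        _ ≤ _ := by gcongr
    have h5 := (convex_ball (z - y) 1).norm_image_sub_le_of_norm_fderiv_le
      (f := η) (𝕜 := ℝ) (fun w _ => η.differentiableAt) h2 (x := z - y) (y := z' - y)
      (mem_ball_self one_pos) (by rw [mem_ball, dist_eq_norm] at *; simpa using hz')
    have h6 : ‖z' - y - (z - y)‖ = dist z' z := by rw [dist_eq_norm]; congr 1; abel
    rw [h6] at h5
    have h4 : (0:ℝ) < (1 + ‖z - y‖) ^ (2 * K) := by positivity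
    calc _ ≤ ((1 + ‖z‖) ^ (2 * K) * (1 + ‖z - y‖) ^ (2 * K)) * _ :=
          mul_le_mul (wgt_le K z y) h5 (norm_nonneg _) (by positivity)
      _ = D * dist z' z * ((1 + ‖z - y‖) ^ (2 * K) * ((1 + ‖z - y‖) ^ (2 * K))⁻¹) := by
          simp only [D]; ring
      _ = _ := by rw [mul_inv_cancel₀ h4.ne', mul_one]
  rw [ContinuousAt, tendsto_iff_dist_tendsto_zero]
  have hlim : Tendsto (fun z' => D * dist z' z) (𝓝 z) (𝓝 0) := by
    have : Continuous fun z' : Rn n => D * dist z' z := by fun_prop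
    simpa using this.tendsto z
  refine squeeze_zero' (Eventually.of_forall fun _ => dist_nonneg) ?_ hlim
  filter_upwards [ball_mem_nhds z one_pos] with z' hz' using key z' hz'

def JJ (n K L : ℕ) : Sch n →ₗ[ℂ] ((Fin n → Fin (L + 1)) → (Rn n →ᵇ ℂ)) :=
  LinearMap.pi fun α => (jc K (la fun i => (α i : ℕ)) : Sch n →ₗ[ℂ] (Rn n →ᵇ ℂ))

lemma JJ_apply (K L : ℕ) (φ : Sch n) (α) : JJ n K L φ α = jc K (la fun i => (α i : ℕ)) φ := rfl

lemma bound_J (f : TDist n E) : ∃ C : ℝ, ∃ K L : ℕ, 0 ≤ C ∧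
    ∀ φ, ‖f.toFun φ‖ ≤ C * ‖JJ n K L φ‖ := by
  obtain ⟨c, K, L, h⟩ := f.bound
  refine ⟨|c| * Fintype.card (Fin n → Fin (L + 1)), K, L, by positivity, fun φ => ?_⟩
  have h1 : schSemi K L φ ≤ Fintype.card (Fin n → Fin (L + 1)) * ‖JJ n K L φ‖ := by
    refine Real.iSup_le (fun x => ?_) (by positivity)
    rw [Finset.mul_sum]
    have : ∀ α ∈ (Finset.univ : Finset (Fin n → Fin (L + 1))), (1 + ‖x‖ ^ 2) ^ ((K : ℝ) / 2) *
        (if mdeg (fun i => (α i : ℕ)) ≤ L then ‖mderiv (fun i => (α i : ℕ)) (fun y => φ y) x‖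
          else 0) ≤ ‖JJ n K L φ‖ := by
      intro α _
      have h2 : ‖JJ n K L φ α x‖ ≤ ‖JJ n K L φ‖ :=
        ((JJ n K L φ α).norm_coe_le_norm x).trans (norm_le_pi_norm _ α)
      rw [JJ_apply, jc_apply] at h2
      simp only [norm_mul, Complex.norm_real, Real.norm_of_nonneg (wgt_pos K x).le] at h2
      refine le_trans ?_ h2
      rw [mderiv_eq]
      refine mul_le_mul ?_ (by split_ifs <;> simp) (by split_ifs <;> simp) (wgt_pos K x).le
      rw [wgt, ← Real.rpow_natCast (1 + ‖x‖ ^ 2) K]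
      have hx : (1:ℝ) ≤ 1 + ‖x‖ ^ 2 := by have := sq_nonneg ‖x‖; linarith
      refine Real.rpow_le_rpow_of_exponent_le hx ?_
      have : (0:ℝ) ≤ K := by positivity
      linarith
    refine (Finset.sum_le_sum this).trans ?_
    simp
  calc _ ≤ c * schSemi K L φ := h φ
    _ ≤ |c| * schSemi K L φ := by
      gcongr
      · exact Real.iSup_nonneg fun x => mul_nonneg (by positivity)
          (Finset.sum_nonneg fun _ _ => by split_ifs <;> positivity)
      · exact le_abs_self c
    _ ≤ _ := by rw [mul_assoc]; gcongr

lemma JJ_cont (K L : ℕ) (ψ : Sch n) : Continuous fun z => JJ n K L (shiftReflect ψ z) :=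
  continuous_pi fun _ => jc_cont K _ ψ

lemma JJ_growth (n K L : ℕ) : ∃ C : ℝ, 0 ≤ C ∧ ∃ M : ℕ, ∀ (ψ : Sch n) (z : Rn n),
    ‖JJ n K L (shiftReflect ψ z)‖ ≤ C * SN M ψ * (1 + ‖z‖) ^ (2 * K) := by
  choose C hC M hM using fun α : Fin n → Fin (L + 1) => SN_clm (Dl (la fun i => (α i : ℕ))) (2 * K)
  refine ⟨2 ^ (2 * K) * ∑ α, C α, mul_nonneg (by positivity) (Finset.sum_nonneg fun α _ => hC α),
    Finset.univ.sup M, fun ψ z => ?_⟩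
  have hs : ∀ M, 0 ≤ SN M ψ := fun M => SN_nonneg M ψ
  have hS : 0 ≤ ∑ α, C α := Finset.sum_nonneg fun α _ => hC α
  have := hs (Finset.univ.sup M)
  refine (pi_norm_le_iff_of_nonneg (by positivity)).2 fun α => ?_
  refine (jc_growth K _ ψ z).trans ?_
  rw [mul_assoc (2 ^ (2 * K) : ℝ) (∑ α, C α)]
  gcongr
  refine (hM α ψ).trans ?_
  refine mul_le_mul (Finset.single_le_sum (fun α _ => hC α) (Finset.mem_univ α))
    (SN_mono (Finset.le_sup (Finset.mem_univ α)) ψ) (hs _) hS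

lemma conv_identity (f : TDist n E) (k ψ : Sch n) (x : Rn n) :
    f.toFun (shiftReflect (cv k ψ) x) = ∫ z, k (x - z) • f.toFun (shiftReflect ψ z) := by
  obtain ⟨C, K, L, hC, h⟩ := bound_J f
  obtain ⟨C', hC', M, hM⟩ := JJ_growth n K L
  have hI : Integrable fun z => k (x - z) • JJ n K L (shiftReflect ψ z) := by
    have hi : Integrable fun z : Rn n => (C' * SN M ψ) * (2 ^ (2 * K) * ((1 + ‖x‖) ^ (2 * K) *
        ((‖x - z‖ ^ 0 * ‖k (x - z)‖) + (‖x - z‖ ^ (2 * K) * ‖k (x - z)‖)))) := by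
      have h0 := ((k.integrable_pow_mul volume 0).add (k.integrable_pow_mul volume (2 * K)))
      have h1 := h0.comp_sub_left x
      exact ((h1.const_mul _).const_mul _).const_mul _
    refine hi.mono' ?_ (Eventually.of_forall fun z => ?_)
    · haveI : SecondCountableTopologyEither (Rn n) ((Fin n → Fin (L + 1)) → Rn n →ᵇ ℂ) :=
        ⟨Or.inl inferInstance⟩
      exact ((k.continuous.comp (by fun_prop)).smul (JJ_cont K L ψ)).aestronglyMeasurable
    · rw [norm_smul]
      have h1 := hM ψ z
      have hs := SN_nonneg M ψ
      have h2 : (1 + ‖z‖) ^ (2 * K) ≤ (1 + ‖x‖) ^ (2 * K) * (1 + ‖x - z‖) ^ (2 * K) := by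
        rw [← mul_pow]
        have : ‖z‖ ≤ ‖x‖ + ‖x - z‖ := by
          calc ‖z‖ = ‖x - (x - z)‖ := by simp
            _ ≤ _ := norm_sub_le _ _
        gcongr
        nlinarith [norm_nonneg x, norm_nonneg (x - z)]
      have h3 : (1 + ‖x - z‖) ^ (2 * K) ≤ 2 ^ (2 * K) * (1 + ‖x - z‖ ^ (2 * K)) := by
        have h4 := add_pow_le (zero_le_one' ℝ) (norm_nonneg (x - z)) (2 * K)
        rw [one_pow] at h4
        refine h4.trans ?_
        gcongr
        · norm_num
        · omega
      calc _ ≤ ‖k (x - z)‖ * (C' * SN M ψ * ((1 + ‖x‖) ^ (2 * K) *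
              (2 ^ (2 * K) * (1 + ‖x - z‖ ^ (2 * K))))) := by
            gcongr
            refine h1.trans ?_
            gcongr
            exact h2.trans (by gcongr)
        _ = _ := by ring
  refine (bochner_transfer (JJ n K L) f.toFun C h).2 (shiftReflect ψ) (fun z => k (x - z)) _ hI ?_
  funext α; ext y
  let ev : ((Fin n → Fin (L + 1)) → (Rn n →ᵇ ℂ)) →L[ℂ] ℂ :=
    (BoundedContinuousFunction.evalCLM ℂ y).comp (ContinuousLinearMap.proj α)
  have h1 := ev.integral_comp_comm hI
  change _ = ev _
  rw [← h1, JJ_apply, jc_sR, Dl_cv, cv_apply, ← integral_const_mul, ← integral_const_mul]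
  congr 1; ext z
  change _ = k (x - z) * jc K _ (shiftReflect ψ z) y
  rw [jc_sR]; ring

lemma mOp_cont (A : Sch n) (f : TDist n E) : Continuous (mOp A f) := by
  obtain ⟨C, K, L, hC, h⟩ := bound_J f
  exact ((bochner_transfer (JJ n K L) f.toFun C h).1 _ (JJ_cont K L _)).const_smul _

lemma mOp_pm (m A : Sch n) (f : TDist n E) (x : Rn n) :
    ‖mOp (pm m A) f x‖ₑ ≤ ∫⁻ z, ‖invFourierS m (x - z)‖ₑ * ‖mOp A f z‖ₑ := by
  have h : mOp (pm m A) f x = ∫ z, invFourierS m (x - z) • mOp A f z := by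
    simp only [mOp, tdConv]
    rw [inv_pm, conv_identity, ← integral_smul]
    congr 1; ext z
    rw [smul_comm]
  rw [h]
  refine (enorm_integral_le_lintegral_enorm _).trans ?_
  refine lintegral_mono fun z => ?_
  simp only [enorm_smul, le_refl]

lemma mOp_clm (f : TDist n E) : ∃ C : ℝ, 0 ≤ C ∧ ∃ M A : ℕ, ∀ (φ : Sch n) (z : Rn n),
    ‖mOp φ f z‖ ≤ C * SN M φ * (1 + ‖z‖) ^ A := by
  obtain ⟨C, K, L, hC, h⟩ := bound_J f
  obtain ⟨C', hC', M, hM⟩ := JJ_growth n K L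
  obtain ⟨C₂, hC₂, M₂, hM₂⟩ := SN_clm ((FourierTransform.fourierCLE ℂ (Sch n)).symm :
    Sch n →L[ℂ] Sch n) M
  refine ⟨(2 * π) ^ (-(n : ℝ) / 2) * (C * (C' * C₂)), by positivity, M₂, 2 * K, fun φ z => ?_⟩
  have h3 : SN M (invFourierS φ) ≤ C₂ * SN M₂ φ := hM₂ φ
  rw [mOp, tdConv, norm_smul, Real.norm_of_nonneg (by positivity)]
  calc _ ≤ (2 * π) ^ (-(n : ℝ) / 2) * (C * (C' * SN M (invFourierS φ) * (1 + ‖z‖) ^ (2 * K))) := by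
        gcongr
        refine (h _).trans ?_
        gcongr
        exact hM _ z
    _ ≤ (2 * π) ^ (-(n : ℝ) / 2) * (C * (C' * (C₂ * SN M₂ φ) * (1 + ‖z‖) ^ (2 * K))) := by
        gcongr
    _ = _ := by ring

lemma mOp_add (φ ψ : Sch n) (f : TDist n E) (x : Rn n) :
    mOp (φ + ψ) f x = mOp φ f x + mOp ψ f x := by
  have h1 : invFourierS (φ + ψ) = invFourierS φ + invFourierS ψ := map_add _ _ _
  have h2 : shiftReflect (invFourierS φ + invFourierS ψ) x
    = shiftReflect (invFourierS φ) x + shiftReflect (invFourierS ψ) x := map_add _ _ _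
  simp only [mOp, tdConv]
  rw [h1, h2, map_add, smul_add]

end TL
end

section
namespace TL

variable {n : ℕ} {E : Type*} [NormedAddCommGroup E] [NormedSpace ℂ E] [CompleteSpace E]

lemma dilate_apply (m : Sch n) {t : ℝ} (ht : t ≠ 0) (x : Rn n) : dilate m t x = m (t • x) := by
  rw [dilate, dif_neg ht]; rfl

lemma dilate_dilate (m : Sch n) {s t : ℝ} (hs : s ≠ 0) (ht : t ≠ 0) :
    dilate (dilate m s) t = dilate m (s * t) := by
  ext x
  rw [dilate_apply _ ht, dilate_apply _ hs, dilate_apply _ (mul_ne_zero hs ht), smul_smul]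

lemma inv_dilate (m : Sch n) {t : ℝ} (ht : 0 < t) (x : Rn n) :
    invFourierS (dilate m t) x = ((t⁻¹) ^ n : ℝ) • invFourierS m (t⁻¹ • x) := by
  rw [invS_eq, invS_eq, SchwartzMap.fourierInv_coe, SchwartzMap.fourierInv_coe,
    Real.fourierInv_eq, Real.fourierInv_eq]
  have h1 : (fun v : Rn n => Real.fourierChar (inner ℝ v x) • dilate m t v)
      = fun v => (fun w => Real.fourierChar (inner ℝ w (t⁻¹ • x)) • m w) (t • v) := by
    funext v
    simp only [dilate_apply _ ht.ne', inner_smul_left, inner_smul_right]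
    congr 3
    simp [inv_mul_cancel₀ ht.ne', ← mul_assoc]
  rw [h1, Measure.integral_comp_smul volume
    (fun w : Rn n => Real.fourierChar (inner ℝ w (t⁻¹ • x)) • m w) t]
  simp [abs_of_pos ht]

/-- dyadic dilation -/
def dk (k : ℕ) (m : Sch n) : Sch n := dilate m ((2 : ℝ) ^ (-(k : ℝ)))

lemma dk_apply (k : ℕ) (m : Sch n) (x : Rn n) : dk k m x = m ((2 : ℝ) ^ (-(k : ℝ)) • x) :=
  dilate_apply _ (by positivity) _

lemma inv_decay (n L : ℕ) : ∃ C : ℝ, 0 ≤ C ∧ ∃ M : ℕ, ∀ (m : Sch n) (y : Rn n),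
    (1 + ‖y‖) ^ L * ‖invFourierS m y‖ ≤ C * SN M m := by
  obtain ⟨C₂, hC₂, M₂, hM₂⟩ := SN_clm ((FourierTransform.fourierCLE ℂ (Sch n)).symm :
    Sch n →L[ℂ] Sch n) L
  refine ⟨2 ^ L * C₂, by positivity, M₂, fun m y => ?_⟩
  have h3 : SN L (invFourierS m) ≤ C₂ * SN M₂ m := hM₂ m
  have h4 := le_SN (le_refl L) (Nat.zero_le _) (invFourierS m) y
  rw [norm_iteratedFDeriv_zero] at h4
  rw [mul_assoc]
  exact h4.trans (by gcongr)

lemma K1 (n L : ℕ) : ∃ C : ℝ, 0 ≤ C ∧ ∃ M : ℕ, ∀ (k : ℕ) (m A : Sch n) (f : TDist n E) (x : Rn n),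
    ‖mOp (pm (dk k m) A) f x‖ₑ ≤ ENNReal.ofReal (C * SN M m) *
      ∫⁻ z, eta k L (x - z) * ‖mOp A f z‖ₑ := by
  obtain ⟨C, hC, M, hM⟩ := inv_decay n L
  refine ⟨C, hC, M, fun k m A f x => ?_⟩
  have hs := SN_nonneg M m
  have key : ∀ y : Rn n, ‖invFourierS (dk k m) y‖ₑ ≤ ENNReal.ofReal (C * SN M m) * eta k L y := by
    intro y
    rw [dk, inv_dilate m (by positivity)]
    have h2 : ((2:ℝ) ^ (-(k:ℝ)))⁻¹ = 2 ^ k := by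
      rw [Real.rpow_neg (by norm_num), inv_inv, Real.rpow_natCast]
    rw [h2, enorm_smul]
    have h3 := hM m ((2:ℝ) ^ k • y)
    rw [norm_smul, norm_pow, Real.norm_ofNat] at h3
    have h5 : (0:ℝ) < 1 + 2 ^ k * ‖y‖ := by positivity
    have h4 : ‖invFourierS m ((2:ℝ) ^ k • y)‖ ≤ C * SN M m * ((1 + 2 ^ k * ‖y‖) ^ L)⁻¹ := by
      rw [← div_eq_mul_inv, le_div_iff₀ (by positivity), mul_comm]; exact h3
    have h6 : W k y ^ (-(L:ℝ)) = ENNReal.ofReal ((1 + 2 ^ k * ‖y‖) ^ L)⁻¹ := by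
      rw [W, ENNReal.ofReal_rpow_of_pos h5, Real.rpow_neg h5.le, Real.rpow_natCast]
    have h7 : ‖(((2:ℝ) ^ k) ^ n : ℝ)‖ₑ = (2:ℝ≥0∞) ^ ((k:ℝ) * n) := by
      rw [Real.enorm_of_nonneg (by positivity), ENNReal.ofReal_pow (by positivity),
        ENNReal.ofReal_pow (by positivity), ← pow_mul, ← Nat.cast_mul, ENNReal.rpow_natCast]
      simp
    rw [eta, h7, h6, ← mul_assoc, mul_comm (ENNReal.ofReal _) ((2:ℝ≥0∞) ^ _), mul_assoc]
    refine mul_le_mul' le_rfl ?_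
    rw [← ENNReal.ofReal_mul (by positivity), ← ofReal_norm]
    exact ENNReal.ofReal_le_ofReal h4
  refine (mOp_pm _ _ _ _).trans ?_
  rw [← lintegral_const_mul' _ _ ENNReal.ofReal_ne_top]
  refine lintegral_mono fun z => ?_
  simp only
  rw [← mul_assoc]
  exact mul_le_mul' (key _) le_rfl

end TL
end

section
namespace TL

variable {n : ℕ} {E : Type*} [NormedAddCommGroup E] [NormedSpace ℂ E] [CompleteSpace E]

lemma iter_dilate (m : Sch n) {t : ℝ} (ht : 0 < t) (i : ℕ) (ξ : Rn n) :
    ‖iteratedFDeriv ℝ i (dilate m t) ξ‖ = t ^ i * ‖iteratedFDeriv ℝ i m (t • ξ)‖ := by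
  have h1 : (dilate m t : Rn n → ℂ) = fun x => m (t • x) := by
    funext x; exact dilate_apply m ht.ne' x
  rw [h1, iteratedFDeriv_comp_const_smul t ((m.smooth ⊤).of_le (by exact_mod_cast le_top)),
    norm_smul, norm_pow, Real.norm_eq_abs, abs_of_pos ht]

lemma iter_zero_of_ball (h : Rn n → ℂ) {c : ℝ} (hv : ∀ ξ : Rn n, ‖ξ‖ < c → h ξ = 0) (i : ℕ)
    {x : Rn n} (hx : ‖x‖ < c) : iteratedFDeriv ℝ i h x = 0 := by
  have h1 : h =ᶠ[𝓝 x] fun _ => 0 := by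
    have : Metric.ball (0 : Rn n) c ∈ 𝓝 x := isOpen_ball.mem_nhds (by simpa using hx)
    filter_upwards [this] with y hy
    exact hv y (by simpa using hy)
  have h2 := (h1.iteratedFDeriv ℝ i).eq_of_nhds
  rw [h2]
  simp

lemma K2 (N Q : ℕ) {g : Rn n → ℂ} (hg : ContDiff ℝ (⊤ : ℕ∞) g) (τ h : Sch n)
    (hh : ∀ ξ, h ξ = g ξ * τ ξ) {c : ℝ} (hv : ∀ ξ : Rn n, ‖ξ‖ < c → h ξ = 0) {B : ℝ} (hB : 0 ≤ B)
    (hgb : ∀ i ≤ N, ∀ ξ : Rn n, c ≤ ‖ξ‖ → ‖iteratedFDeriv ℝ i g ξ‖ ≤ B * (1 + ‖ξ‖) ^ Q) :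
    SN N h ≤ (2 ^ N * 2 ^ (N + Q) * SN (N + Q) τ) * B := by
  have hs := SN_nonneg (N + Q) τ
  refine SN_le' (by positivity) fun i hi x => ?_
  rcases lt_or_ge ‖x‖ c with hx | hx
  · rw [iter_zero_of_ball h hv i hx]
    simp only [norm_zero, mul_zero]; positivity
  have h1 : (h : Rn n → ℂ) = fun ξ => g ξ * τ ξ := by funext ξ; exact hh ξ
  rw [h1]
  have h2 := norm_iteratedFDeriv_mul_le (𝕜 := ℝ) (N := (⊤ : ℕ∞)) (n := i) hg (τ.smooth ⊤) x
    (by exact_mod_cast le_top)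
  calc (1 + ‖x‖) ^ N * ‖iteratedFDeriv ℝ i (fun ξ => g ξ * τ ξ) x‖
      ≤ (1 + ‖x‖) ^ N * ∑ j ∈ Finset.range (i + 1), (i.choose j : ℝ) *
          ‖iteratedFDeriv ℝ j g x‖ * ‖iteratedFDeriv ℝ (i - j) τ x‖ := by gcongr
    _ ≤ ∑ j ∈ Finset.range (i + 1), (i.choose j : ℝ) * (B * (2 ^ (N + Q) * SN (N + Q) τ)) := by
        rw [Finset.mul_sum]
        refine Finset.sum_le_sum fun j hj => ?_
        have hj' : j ≤ i := by simpa [Nat.lt_succ_iff] using hj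
        have h3 := hgb j (hj'.trans hi) x hx
        have h4 := le_SN (N := N + Q) le_rfl (show i - j ≤ N + Q by omega) τ x
        calc (1 + ‖x‖) ^ N * ((i.choose j : ℝ) * ‖iteratedFDeriv ℝ j g x‖ *
              ‖iteratedFDeriv ℝ (i - j) τ x‖)
            ≤ (1 + ‖x‖) ^ N * ((i.choose j : ℝ) * (B * (1 + ‖x‖) ^ Q) *
              ‖iteratedFDeriv ℝ (i - j) τ x‖) := by gcongr
          _ = (i.choose j : ℝ) * (B * ((1 + ‖x‖) ^ (N + Q) * ‖iteratedFDeriv ℝ (i - j) τ x‖)) := by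
              rw [pow_add]; ring
          _ ≤ _ := by gcongr
    _ = 2 ^ i * (B * (2 ^ (N + Q) * SN (N + Q) τ)) := by
        rw [← Finset.sum_mul]; congr 1
        exact_mod_cast Nat.sum_range_choose i
    _ ≤ 2 ^ N * (B * (2 ^ (N + Q) * SN (N + Q) τ)) := by
        gcongr; norm_num
    _ = _ := by ring

lemma taylor_van (μ : Sch n) (R : ℕ) (h0 : ∀ i < R, iteratedFDeriv ℝ i μ 0 = 0) (d : ℕ) :
    ∀ i, i + d = R → ∀ x, ‖iteratedFDeriv ℝ i μ x‖ ≤ 2 ^ R * SN R μ * ‖x‖ ^ d := by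
  induction d with
  | zero =>
    intro i hi x
    have := le_SN (N := R) (Nat.zero_le _) (show i ≤ R by omega) μ x
    simpa using this
  | succ d ih =>
    intro i hi x
    have h1 := ih (i + 1) (by omega)
    have hd : Differentiable ℝ (iteratedFDeriv ℝ i μ) :=
      (μ.smooth ⊤).differentiable_iteratedFDeriv (by exact_mod_cast WithTop.coe_lt_top _)
    have hs := SN_nonneg R μ
    have h2 := (convex_closedBall (0 : Rn n) ‖x‖).norm_image_sub_le_of_norm_fderiv_le (𝕜 := ℝ)
      (f := iteratedFDeriv ℝ i μ) (C := 2 ^ R * SN R μ * ‖x‖ ^ d) (fun y _ => hd y)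
      (fun y hy => by
        rw [norm_fderiv_iteratedFDeriv]
        refine (h1 y).trans ?_
        have : ‖y‖ ≤ ‖x‖ := by simpa using hy
        gcongr) (x := 0) (y := x) (by simp) (by simp)
    rw [h0 i (by omega), sub_zero, sub_zero] at h2
    calc _ ≤ _ := h2
      _ = _ := by rw [pow_succ]; ring

lemma K2a (N R : ℕ) (τ : Sch n) : ∃ C : ℝ, 0 ≤ C ∧ ∀ (μ : Sch n) (t : ℝ), 0 < t → t ≤ 1 →
    (∀ i < R, iteratedFDeriv ℝ i μ 0 = 0) →
    SN N (pm (dilate μ t) τ) ≤ C * t ^ R * SN (N + R) μ := by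
  have hs := SN_nonneg (N + R) τ
  refine ⟨2 ^ N * 2 ^ (N + R) * SN (N + R) τ * 2 ^ (N + R), by positivity,
    fun μ t ht ht1 hv => ?_⟩
  have hs' := SN_nonneg (N + R) μ
  have := K2 N R (g := dilate μ t) ((dilate μ t).smooth ⊤) τ (pm (dilate μ t) τ)
    (fun ξ => rfl) (c := 0) (fun ξ h => absurd h (not_lt.2 (norm_nonneg _)))
    (B := t ^ R * (2 ^ (N + R) * SN (N + R) μ)) (by positivity) ?_
  · refine this.trans (le_of_eq ?_); ring
  intro i hi ξ _
  rw [iter_dilate μ ht]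
  have hx1 : 1 ≤ 1 + ‖ξ‖ := by linarith [norm_nonneg ξ]
  rcases le_total i R with hiR | hiR
  · have h1 := taylor_van μ R hv (R - i) i (by omega) (t • ξ)
    have h2 : 2 ^ R * SN R μ ≤ 2 ^ (N + R) * SN (N + R) μ := by
      have := SN_mono (show R ≤ N + R by omega) μ
      have h0 := SN_nonneg R μ
      gcongr
      · norm_num
      · omega
    rw [norm_smul, Real.norm_eq_abs, abs_of_pos ht, mul_pow] at h1
    calc t ^ i * ‖iteratedFDeriv ℝ i μ (t • ξ)‖
        ≤ t ^ i * (2 ^ R * SN R μ * (t ^ (R - i) * ‖ξ‖ ^ (R - i))) := by gcongr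
      _ = (t ^ i * t ^ (R - i)) * (2 ^ R * SN R μ) * ‖ξ‖ ^ (R - i) := by ring
      _ = t ^ R * (2 ^ R * SN R μ) * ‖ξ‖ ^ (R - i) := by rw [← pow_add]; congr 3; omega
      _ ≤ t ^ R * (2 ^ (N + R) * SN (N + R) μ) * (1 + ‖ξ‖) ^ R := by
          gcongr ?_ * ?_ * ?_
          calc ‖ξ‖ ^ (R - i) ≤ (1 + ‖ξ‖) ^ (R - i) := by gcongr; linarith
            _ ≤ _ := pow_le_pow_right₀ hx1 (by omega)
  · have h1 := le_SN (N := N + R) (Nat.zero_le _) (show i ≤ N + R by omega) μ (t • ξ)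
    rw [pow_zero, one_mul] at h1
    calc t ^ i * ‖iteratedFDeriv ℝ i μ (t • ξ)‖
        ≤ t ^ R * (2 ^ (N + R) * SN (N + R) μ) := by
          gcongr ?_ * ?_
          exact pow_le_pow_of_le_one ht.le ht1 hiR
      _ ≤ _ := le_mul_of_one_le_right (by positivity) (one_le_pow₀ hx1)

lemma K2b (N P : ℕ) (τ : Sch n) {c : ℝ} (hc : 0 < c) (hτ : ∀ ξ : Rn n, ‖ξ‖ < c → τ ξ = 0) :
    ∃ C : ℝ, 0 ≤ C ∧ ∀ (μ : Sch n) (t : ℝ), 1 ≤ t →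
    SN N (pm (dilate μ t) τ) ≤ C * (t ^ P)⁻¹ * SN (N + P) μ := by
  have hs := SN_nonneg (N + 0) τ
  refine ⟨2 ^ N * 2 ^ (N + 0) * SN (N + 0) τ * ((c ^ (N + P))⁻¹ * 2 ^ (N + P)), by positivity,
    fun μ t ht1 => ?_⟩
  have ht : 0 < t := by linarith
  have hs' := SN_nonneg (N + P) μ
  have := K2 N 0 (g := dilate μ t) ((dilate μ t).smooth ⊤) τ (pm (dilate μ t) τ)
    (fun ξ => rfl) (c := c) (fun ξ h => by rw [pm_apply, hτ ξ h, mul_zero])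
    (B := (c ^ (N + P))⁻¹ * (t ^ P)⁻¹ * (2 ^ (N + P) * SN (N + P) μ)) (by positivity) ?_
  · refine this.trans (le_of_eq ?_); ring
  intro i hi ξ hξ
  rw [iter_dilate μ ht, pow_zero, mul_one]
  have h1 := le_SN (N := N + P) le_rfl (show i ≤ N + P by omega) μ (t • ξ)
  have h2 : t * c ≤ 1 + ‖t • ξ‖ := by
    rw [norm_smul, Real.norm_eq_abs, abs_of_pos ht]
    nlinarith
  have h3 : (t * c) ^ (N + P) * ‖iteratedFDeriv ℝ i μ (t • ξ)‖ ≤ 2 ^ (N + P) * SN (N + P) μ :=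
    le_trans (by gcongr) h1
  have h4 : ‖iteratedFDeriv ℝ i μ (t • ξ)‖ ≤ ((t * c) ^ (N + P))⁻¹ *
      (2 ^ (N + P) * SN (N + P) μ) := by
    rw [inv_mul_eq_div, le_div_iff₀ (by positivity), mul_comm]; exact h3
  calc t ^ i * ‖iteratedFDeriv ℝ i μ (t • ξ)‖
      ≤ t ^ N * (((t * c) ^ (N + P))⁻¹ * (2 ^ (N + P) * SN (N + P) μ)) := by
        gcongr ?_ * ?_
        · exact pow_le_pow_right₀ ht1 hi
    _ = _ := by
        rw [mul_pow, pow_add t]; field_simp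

lemma scale_id (j k : ℕ) (μ τ : Sch n) :
    pm (dk j μ) (dk k τ) = dk k (pm (dilate μ ((2:ℝ) ^ ((k:ℝ) - j))) τ) := by
  ext x
  rw [pm_apply, dk_apply, dk_apply, dk_apply, pm_apply, dilate_apply _ (by positivity), smul_smul,
    ← Real.rpow_add (by norm_num)]
  congr 4
  ring

lemma pm_assoc (a b c : Sch n) : pm a (pm b c) = pm (pm a b) c := by
  ext x; simp [pm_apply, mul_assoc]

lemma pm_comm (a b : Sch n) : pm a b = pm b a := by
  ext x; simp [pm_apply, mul_comm]

lemma dk_pm (k : ℕ) (a b : Sch n) : dk k (pm a b) = pm (dk k a) (dk k b) := by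
  ext x; simp [pm_apply, dk_apply]

lemma SN_dk (M k : ℕ) (a : Sch n) : SN M (dk k a) ≤ 2 ^ M * SN M a * (2 ^ k) ^ M := by
  have hs := SN_nonneg M a
  refine SN_le' (by positivity) fun i hi x => ?_
  have h2 : ((2:ℝ) ^ (-(k:ℝ))) = (2 ^ k)⁻¹ := by
      rw [Real.rpow_neg (by norm_num), Real.rpow_natCast]
  rw [dk, h2, iter_dilate a (by positivity)]
  have h1 := le_SN le_rfl hi a (((2:ℝ) ^ k)⁻¹ • x)
  have hk : (1:ℝ) ≤ 2 ^ k := one_le_pow₀ (by norm_num)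
  have h3 : 1 + ‖x‖ ≤ (1 + ‖((2:ℝ) ^ k)⁻¹ • x‖) * 2 ^ k := by
    rw [norm_smul, norm_inv, norm_pow, Real.norm_ofNat, add_mul, mul_assoc, mul_comm ‖x‖,
      inv_mul_cancel_left₀ (by positivity)]
    linarith
  calc (1 + ‖x‖) ^ M * ((((2:ℝ) ^ k)⁻¹) ^ i * ‖iteratedFDeriv ℝ i a (((2:ℝ) ^ k)⁻¹ • x)‖)
      ≤ ((1 + ‖((2:ℝ) ^ k)⁻¹ • x‖) * 2 ^ k) ^ M *
        (1 * ‖iteratedFDeriv ℝ i a (((2:ℝ) ^ k)⁻¹ • x)‖) := by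
        gcongr
        exact pow_le_one₀ (by positivity) (inv_le_one_of_one_le₀ hk)
    _ = ((1 + ‖((2:ℝ) ^ k)⁻¹ • x‖) ^ M * ‖iteratedFDeriv ℝ i a (((2:ℝ) ^ k)⁻¹ • x)‖)
        * (2 ^ k) ^ M := by rw [mul_pow]; ring
    _ ≤ _ := by gcongr

end TL
end

section
namespace TL

variable {n : ℕ} {E : Type*} [NormedAddCommGroup E] [NormedSpace ℂ E] [CompleteSpace E]

/-- two-member family -/
def fam (a b : Sch n) (k : ℕ) : Sch n := if k = 0 then a else b

lemma SN_fam (N : ℕ) (a b : Sch n) (k : ℕ) : SN N (fam a b k) ≤ max (SN N a) (SN N b) := by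
  unfold fam; split_ifs
  · exact le_max_left _ _
  · exact le_max_right _ _

structure Sys (A : ℕ → Sch n) (τ0 τ1 : Sch n) (P : ℕ → Sch n) : Prop where
  van : ∃ c : ℝ, 0 < c ∧ ∀ ξ : Rn n, ‖ξ‖ < c → τ1 ξ = 0
  P0 : P 0 = pm (dk 0 (fam τ0 τ1 0)) (A 0)
  Ps : ∀ K, P (K + 1) = P K + pm (dk (K + 1) (fam τ0 τ1 (K + 1))) (A (K + 1))
  bd : ∀ i : ℕ, ∃ C : ℝ, 0 ≤ C ∧ ∀ (K : ℕ) (ξ : Rn n),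
    ‖iteratedFDeriv ℝ i (P K) ξ‖ ≤ C * (1 + ‖ξ‖)
  one : ∃ c : ℝ, 0 < c ∧ ∀ (K : ℕ) (ξ : Rn n), ‖ξ‖ < c * 2 ^ K → P K ξ = 1

variable {A : ℕ → Sch n} {τ0 τ1 : Sch n} {P : ℕ → Sch n}

lemma mOp_sub (φ ψ : Sch n) (f : TDist n E) (x : Rn n) :
    mOp (φ - ψ) f x = mOp φ f x - mOp ψ f x := by
  rw [eq_sub_iff_add_eq, ← mOp_add, sub_add_cancel]

lemma iter_one_sub (P : Sch n) (i : ℕ) (ξ : Rn n) :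
    ‖iteratedFDeriv ℝ i (fun x => 1 - P x) ξ‖ ≤ 1 + ‖iteratedFDeriv ℝ i P ξ‖ := by
  have h1 : iteratedFDeriv ℝ i (fun x => 1 - P x) ξ =
      iteratedFDeriv ℝ i (fun _ : Rn n => (1:ℂ)) ξ - iteratedFDeriv ℝ i P ξ := by
    have := iteratedFDeriv_sub_apply (𝕜 := ℝ) (i := i) (x := ξ) (f := fun _ : Rn n => (1:ℂ)) (g := P)
      contDiff_const.contDiffAt ((P.smooth ⊤).of_le (by exact_mod_cast le_top)).contDiffAt
    exact this
  rw [h1]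
  refine (norm_sub_le _ _).trans ?_
  gcongr
  rcases Nat.eq_zero_or_pos i with rfl | hi
  · simp
  · rw [iteratedFDeriv_const_of_ne hi.ne']; simp

lemma Sys.lim (h : Sys A τ0 τ1 P) (ζ : Sch n) (N : ℕ) :
    Tendsto (fun K => SN N (ζ - pm (P K) ζ)) atTop (𝓝 0) := by
  obtain ⟨c, hc, h1⟩ := h.one
  choose C hC hCb using h.bd
  set D := 1 + ∑ i ∈ Finset.range (N + 1), C i with hD
  have hD0 : 0 ≤ D := add_nonneg zero_le_one (Finset.sum_nonneg fun i _ => hC i)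
  have hs := SN_nonneg (N + 2) ζ
  have key : ∀ K, SN N (ζ - pm (P K) ζ) ≤
      (2 ^ N * 2 ^ (N + 2) * SN (N + 2) ζ * (D / c)) * (1 / 2) ^ K := by
    intro K
    have hg : ContDiff ℝ (⊤ : ℕ∞) (fun x => 1 - P K x) := contDiff_const.sub ((P K).smooth ⊤)
    have := K2 N 2 hg ζ (ζ - pm (P K) ζ) (fun ξ => by
        rw [SchwartzMap.sub_apply, pm_apply]; ring) (c := c * 2 ^ K) (fun ξ hξ => by
        rw [SchwartzMap.sub_apply, pm_apply, h1 K ξ hξ]; ring) (B := D / (c * 2 ^ K)) (by positivity)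
        (fun i hi ξ hξ => by
          refine (iter_one_sub _ _ _).trans ?_
          have h2 := hCb i K ξ
          have h3 : C i ≤ ∑ i ∈ Finset.range (N + 1), C i :=
            Finset.single_le_sum (fun i _ => hC i) (Finset.mem_range.2 (by omega))
          have hx := norm_nonneg ξ
          calc 1 + ‖iteratedFDeriv ℝ i (P K) ξ‖ ≤ 1 * (1 + ‖ξ‖) + C i * (1 + ‖ξ‖) := by linarith
            _ = (1 + C i) * (1 + ‖ξ‖) := by ring
            _ ≤ D * (1 + ‖ξ‖) := by rw [hD]; gcongr
            _ = D * (1 + ‖ξ‖) * 1 := by ring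
            _ ≤ D * (1 + ‖ξ‖) * ((1 + ‖ξ‖) / (c * 2 ^ K)) := by
                gcongr
                rw [one_le_div (by positivity)]; linarith
            _ = _ := by ring)
    refine this.trans (le_of_eq ?_)
    rw [div_pow, one_pow]; field_simp
  refine squeeze_zero (fun K => SN_nonneg _ _) key ?_
  have := (tendsto_pow_atTop_nhds_zero_of_lt_one (r := (1/2 : ℝ)) (by norm_num)
    (by norm_num)).const_mul (2 ^ N * 2 ^ (N + 2) * SN (N + 2) ζ * (D / c))
  simpa using this

lemma pm_add (a b c : Sch n) : pm (a + b) c = pm a c + pm b c := by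
  ext x; simp [pm_apply, add_mul]

lemma Sys.repro (h : Sys A τ0 τ1 P) (ζ : Sch n) (f : TDist n E) (x : Rn n) (k : ℕ) :
    ‖mOp ζ f x‖ₑ ≤ ‖mOp (pm (P k) ζ) f x‖ₑ +
      ∑' i : ℕ, ‖mOp (pm (pm (dk (k + i + 1) (fam τ0 τ1 (k + i + 1))) (A (k + i + 1))) ζ) f x‖ₑ := by
  obtain ⟨C, hC, M, a, hM⟩ := mOp_clm f
  have h1 : Tendsto (fun K => mOp (pm (P K) ζ) f x) atTop (𝓝 (mOp ζ f x)) := by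
    rw [tendsto_iff_norm_sub_tendsto_zero]
    refine squeeze_zero (fun _ => norm_nonneg _) (g := fun K =>
      C * SN M (ζ - pm (P K) ζ) * (1 + ‖x‖) ^ a) (fun K => ?_) ?_
    · rw [norm_sub_rev, ← mOp_sub]; exact hM _ _
    · have := ((h.lim ζ M).const_mul C).mul_const ((1 + ‖x‖) ^ a)
      simpa using this
  have h2 : Tendsto (fun m : ℕ => ‖mOp (pm (P (m + k)) ζ) f x‖ₑ) atTop (𝓝 ‖mOp ζ f x‖ₑ) :=
    (h1.comp (tendsto_add_atTop_nat k)).enorm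
  refine le_of_tendsto' h2 fun m => ?_
  have h3 : ∀ m : ℕ, ‖mOp (pm (P (m + k)) ζ) f x‖ₑ ≤ ‖mOp (pm (P k) ζ) f x‖ₑ +
      ∑ i ∈ Finset.range m, ‖mOp (pm (pm (dk (k + i + 1) (fam τ0 τ1 (k + i + 1)))
        (A (k + i + 1))) ζ) f x‖ₑ := by
    intro m
    induction m with
    | zero => simp
    | succ m ih =>
      have e : m + 1 + k = (k + m) + 1 := by omega
      rw [e, h.Ps, pm_add, mOp_add, Finset.sum_range_succ, ← add_assoc]
      refine (enorm_add_le _ _).trans ?_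
      gcongr
      rw [add_comm k m]; exact ih
  refine (h3 m).trans ?_
  gcongr
  exact ENNReal.sum_le_tsum _

lemma Sys.repro0 (h : Sys A τ0 τ1 P) (ζ : Sch n) (f : TDist n E) (x : Rn n) :
    ‖mOp ζ f x‖ₑ ≤ ∑' k : ℕ, ‖mOp (pm (pm (dk k (fam τ0 τ1 k)) (A k)) ζ) f x‖ₑ := by
  refine (h.repro ζ f x 0).trans ?_
  rw [h.P0, tsum_eq_zero_add' (f := fun k : ℕ => ‖mOp (pm (pm (dk k (fam τ0 τ1 k)) (A k)) ζ) f x‖ₑ)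
    ENNReal.summable]
  simp

lemma pow_rpow_two (x : ℝ) (R : ℕ) : ((2:ℝ) ^ x) ^ R = 2 ^ (x * R) := by
  rw [Real.rpow_mul (by norm_num), Real.rpow_natCast]

lemma term_eq (j k : ℕ) (μ τ A : Sch n) : pm (pm (dk k τ) A) (dk j μ) =
    pm (dk k (pm (dilate μ ((2:ℝ) ^ ((k:ℝ) - j))) τ)) A := by
  rw [← scale_id]
  ext x; simp only [pm_apply]; ring

theorem bj_est (h : Sys A τ0 τ1 P) (s : ℝ) (R : ℕ) (μ : ℕ → Sch n)
    (hμ : ∀ N, ∃ C : ℝ, ∀ j, SN N (μ j) ≤ C)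
    (hv : ∀ j, 0 < j → ∀ i < R, iteratedFDeriv ℝ i (μ j) 0 = 0) :
    ∃ Cb : ℕ → ℝ≥0∞, (∀ L, Cb L < ∞) ∧ ∀ (f : TDist n E) (L j : ℕ) (x : Rn n),
      ‖mOp (dk j (μ j)) f x‖ₑ ≤ Cb L * ∑' k : ℕ, gk ((R:ℝ) - s) j k * 2 ^ (((k:ℝ) - j) * s) *
        ∫⁻ z, eta k L (x - z) * ‖mOp (A k) f z‖ₑ := by
  obtain ⟨c, hc, hcv⟩ := h.van
  obtain ⟨Q, hQ⟩ := exists_nat_ge ((R:ℝ) - 2 * s)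
  have main : ∀ M : ℕ, ∃ D : ℝ, 0 ≤ D ∧ ∀ j k : ℕ,
      SN M (pm (dilate (μ j) ((2:ℝ) ^ ((k:ℝ) - j))) (fam τ0 τ1 k)) ≤
        D * 2 ^ (-((R - s) * |(j:ℝ) - k|) + ((k:ℝ) - j) * s) := by
    intro M
    obtain ⟨B1, hB1⟩ := hμ (M + R)
    obtain ⟨B2, hB2⟩ := hμ (M + 0)
    obtain ⟨B3, hB3⟩ := hμ (M + Q)
    have hB1' := (SN_nonneg _ _).trans (hB1 0)
    have hB2' := (SN_nonneg _ _).trans (hB2 0)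
    have hB3' := (SN_nonneg _ _).trans (hB3 0)
    obtain ⟨C0, hC0, h0⟩ := K2a M 0 τ0
    obtain ⟨C1, hC1, h1⟩ := K2a M R τ0
    obtain ⟨C2, hC2, h2⟩ := K2a M R τ1
    obtain ⟨C3, hC3, h3⟩ := K2b M Q τ1 hc hcv
    refine ⟨C0 * B2 + C1 * B1 + C2 * B1 + C3 * B3, by positivity, fun j k => ?_⟩
    rcases Nat.eq_zero_or_pos j with rfl | hj
    · rcases Nat.eq_zero_or_pos k with rfl | hk
      · have := h0 (μ 0) ((2:ℝ) ^ (((0:ℕ):ℝ) - (0:ℕ))) (by simp) (by simp)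
          (fun i hi => absurd hi (by omega))
        simp only [fam, if_true]
        refine this.trans ?_
        have := hB2 0
        have e1 : C0 * SN (M + 0) (μ 0) ≤ C0 * B2 := by gcongr
        simp only [pow_zero, mul_one]
        refine e1.trans ?_
        simp
        have a1 : 0 ≤ C1 * B1 := by positivity
        have a2 : 0 ≤ C2 * B1 := by positivity
        have a3 : 0 ≤ C3 * B3 := by positivity
        linarith
      · have hk1 : (1:ℝ) ≤ k := by exact_mod_cast hk
        have := h3 (μ 0) ((2:ℝ) ^ ((k:ℝ) - (0:ℕ))) (Real.one_le_rpow (by norm_num) (by simp))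
        rw [fam, if_neg hk.ne']
        refine this.trans ?_
        have hb := hB3 0
        rw [pow_rpow_two, ← Real.rpow_neg (by norm_num)]
        calc C3 * 2 ^ (-(((k:ℝ) - (0:ℕ)) * Q)) * SN (M + Q) (μ 0)
            ≤ C3 * 2 ^ (-((R - s) * |((0:ℕ):ℝ) - k|) + ((k:ℝ) - (0:ℕ)) * s) * B3 := by
              gcongr
              · norm_num
              · simp; nlinarith
          _ = C3 * B3 * 2 ^ (-((R - s) * |((0:ℕ):ℝ) - k|) + ((k:ℝ) - (0:ℕ)) * s) := by ring
          _ ≤ _ := by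
              gcongr
              have a1 : 0 ≤ C1 * B1 := by positivity
              have a2 : 0 ≤ C2 * B1 := by positivity
              have a3 : 0 ≤ C0 * B2 := by positivity
              linarith
    · rcases le_or_gt k j with hkj | hkj
      · have hkj' : (k:ℝ) ≤ j := by exact_mod_cast hkj
        have ht : (2:ℝ) ^ ((k:ℝ) - j) ≤ 1 :=
          Real.rpow_le_one_of_one_le_of_nonpos (by norm_num) (by linarith)
        have hb := hB1 j
        have : SN M (pm (dilate (μ j) ((2:ℝ) ^ ((k:ℝ) - j))) (fam τ0 τ1 k)) ≤
            (C1 + C2) * ((2:ℝ) ^ ((k:ℝ) - j)) ^ R * SN (M + R) (μ j) := by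
          have hs := SN_nonneg (M + R) (μ j)
          unfold fam; split_ifs
          · refine (h1 (μ j) _ (by positivity) ht (hv j hj)).trans ?_
            gcongr; linarith
          · refine (h2 (μ j) _ (by positivity) ht (hv j hj)).trans ?_
            gcongr; linarith
        refine this.trans ?_
        have e : ((2:ℝ) ^ ((k:ℝ) - j)) ^ R = 2 ^ (-((R - s) * |(j:ℝ) - k|) + ((k:ℝ) - j) * s) := by
          rw [pow_rpow_two, abs_of_nonneg (by linarith)]; congr 1; ring
        rw [e]
        calc (C1 + C2) * 2 ^ (-((R - s) * |(j:ℝ) - k|) + ((k:ℝ) - j) * s) * SN (M + R) (μ j)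
            ≤ (C1 + C2) * 2 ^ (-((R - s) * |(j:ℝ) - k|) + ((k:ℝ) - j) * s) * B1 := by gcongr
          _ = (C1 * B1 + C2 * B1) * 2 ^ (-((R - s) * |(j:ℝ) - k|) + ((k:ℝ) - j) * s) := by ring
          _ ≤ _ := by
              refine mul_le_mul_of_nonneg_right ?_ (by positivity)
              have a1 : 0 ≤ C0 * B2 := by positivity
              have a3 : 0 ≤ C3 * B3 := by positivity
              linarith
      · have hkj' : (j:ℝ) ≤ k := by exact_mod_cast hkj.le
        have := h3 (μ j) ((2:ℝ) ^ ((k:ℝ) - j)) (Real.one_le_rpow (by norm_num) (by linarith))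
        rw [fam, if_neg (by omega)]
        refine this.trans ?_
        have hb := hB3 j
        rw [pow_rpow_two, ← Real.rpow_neg (by norm_num)]
        calc C3 * 2 ^ (-(((k:ℝ) - j) * Q)) * SN (M + Q) (μ j)
            ≤ C3 * 2 ^ (-((R - s) * |(j:ℝ) - k|) + ((k:ℝ) - j) * s) * B3 := by
              gcongr
              · norm_num
              · rw [abs_of_nonpos (by linarith)]; nlinarith
          _ = C3 * B3 * 2 ^ (-((R - s) * |(j:ℝ) - k|) + ((k:ℝ) - j) * s) := by ring
          _ ≤ _ := by
              gcongr
              have a1 : 0 ≤ C1 * B1 := by positivity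
              have a2 : 0 ≤ C2 * B1 := by positivity
              have a3 : 0 ≤ C0 * B2 := by positivity
              linarith
  choose C hC M hM using fun L => K1 (E := E) n L
  choose D hD hDb using main
  refine ⟨fun L => ENNReal.ofReal (C L * D (M L)), fun L => ENNReal.ofReal_lt_top,
    fun f L j x => ?_⟩
  refine (h.repro0 _ f x).trans ?_
  rw [← ENNReal.tsum_mul_left]
  refine ENNReal.tsum_le_tsum fun k => ?_
  rw [term_eq]
  refine (hM L k _ _ f x).trans ?_
  rw [← mul_assoc]
  refine mul_le_mul' ?_ le_rfl
  rw [gk, ← two_rpow_add, two_rpow_ofReal, ← ENNReal.ofReal_mul (mul_nonneg (hC L) (hD _))]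
  refine ENNReal.ofReal_le_ofReal ?_
  rw [mul_assoc]
  exact mul_le_mul_of_nonneg_left (hDb (M L) j k) (hC L)

lemma hypT_of (a : ℕ → Sch n) (ha : ∀ N, ∃ C : ℝ, ∀ j, SN N (a j) ≤ C) (f : TDist n E) :
    HypT (fun k z => ‖mOp (dk k (a k)) f z‖ₑ) := by
  obtain ⟨C, hC, M, A, hM⟩ := mOp_clm f
  obtain ⟨B, hB⟩ := ha M
  have hB0 := (SN_nonneg _ _).trans (hB 0)
  refine ⟨max M A, ENNReal.ofReal (C * (2 ^ M * B)), ENNReal.ofReal_lt_top, fun k z => ?_⟩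
  have h1 := hM (dk k (a k)) z
  have h2 := SN_dk M k (a k)
  have h3 := hB k
  have hz := norm_nonneg z
  simp only
  rw [two_rpow_ofReal, W, ENNReal.ofReal_rpow_of_pos (by positivity),
    ← ENNReal.ofReal_mul (by positivity), ← ENNReal.ofReal_mul (by positivity),
    ← ofReal_norm_eq_enorm]
  refine ENNReal.ofReal_le_ofReal (h1.trans ?_)
  have hk : (1:ℝ) ≤ 2 ^ k := one_le_pow₀ (by norm_num)
  rw [Real.rpow_mul (by norm_num), Real.rpow_natCast, Real.rpow_natCast, Real.rpow_natCast]
  calc C * SN M (dk k (a k)) * (1 + ‖z‖) ^ A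
      ≤ C * (2 ^ M * B * (2 ^ k) ^ M) * (1 + ‖z‖) ^ A := by
        gcongr; exact h2.trans (by gcongr)
    _ = C * (2 ^ M * B) * (2 ^ k) ^ M * (1 + ‖z‖) ^ A := by ring
    _ ≤ C * (2 ^ M * B) * (2 ^ k) ^ (max M A) * (1 + 2 ^ 0 * ‖z‖) ^ (max M A) := by
        rw [pow_zero, one_mul]
        gcongr ?_ * ?_ * ?_
        · exact pow_le_pow_right₀ hk (le_max_left _ _)
        · exact pow_le_pow_right₀ (by linarith) (le_max_right _ _)

lemma hypN_phi (hA : ∀ k, A k = pm (dk k (fam τ0 τ1 k)) (A k)) :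
    ∃ CN : ℕ → ℝ≥0∞, (∀ N, CN N < ∞) ∧ ∀ f : TDist n E,
      HypN CN (fun k z => ‖mOp (A k) f z‖ₑ) := by
  choose C hC M hM using fun L => K1 (E := E) n L
  refine ⟨fun N => ENNReal.ofReal (C N * max (SN (M N) τ0) (SN (M N) τ1)),
    fun N => ENNReal.ofReal_lt_top, fun f N k y => ?_⟩
  simp only
  conv_lhs => rw [hA k]
  refine (hM N k _ _ f y).trans (mul_le_mul' ?_ ?_)
  · exact ENNReal.ofReal_le_ofReal (mul_le_mul_of_nonneg_left (SN_fam _ _ _ _) (hC N))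
  · refine le_trans (le_of_eq ?_) (ENNReal.le_tsum 0)
    simp

lemma eta_le {k l : ℕ} (hkl : k ≤ l) (N : ℕ) (x : Rn n) :
    eta l N x ≤ 2 ^ (((l:ℝ) - k) * n) * eta k N x := by
  rw [eta, eta, ← mul_assoc, ← two_rpow_add]
  refine mul_le_mul' (two_rpow_le (by linarith)) ?_
  rw [ENNReal.rpow_neg, ENNReal.rpow_neg, ENNReal.inv_le_inv]
  exact ENNReal.rpow_le_rpow (W_mono hkl x) (by positivity)

lemma hypN_Psi (h : Sys A τ0 τ1 P) (χ : Sch n) (hP : ∀ k, P k = dk k χ) (a : ℕ → Sch n)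
    (hA : ∀ k, A k = dk k (a k)) (ha : ∀ N, ∃ C : ℝ, ∀ j, SN N (a j) ≤ C) :
    ∃ CN : ℕ → ℝ≥0∞, (∀ N, CN N < ∞) ∧ ∀ f : TDist n E,
      HypN CN (fun k z => ‖mOp (A k) f z‖ₑ) := by
  obtain ⟨c, hc, hcv⟩ := h.van
  choose C hC M hM using fun L => K1 (E := E) n L
  choose D hD hDb using fun M P => K2b M P τ1 hc hcv
  choose B hB using ha
  have hB0 : ∀ N, 0 ≤ B N := fun N => (SN_nonneg _ _).trans (hB N 0)
  set F : ℕ → ℝ := fun N => C N * (D (M N) (N + n) * B (M N + (N + n))) with hF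
  have hF0 : ∀ N, 0 ≤ F N := fun N => mul_nonneg (hC N) (mul_nonneg (hD _ _) (hB0 _))
  refine ⟨fun N => ENNReal.ofReal (C N * SN (M N) χ) + ENNReal.ofReal (F N),
    fun N => by simp, fun f N k y => ?_⟩
  simp only
  refine (h.repro (A k) f y k).trans ?_
  rw [tsum_eq_zero_add' (f := fun i : ℕ => (2:ℝ≥0∞) ^ (-((i:ℝ) * N)) *
    ∫⁻ z, eta k N (y - z) * ‖mOp (A (k + i)) f z‖ₑ) ENNReal.summable, mul_add]
  refine add_le_add ?_ ?_
  · rw [hP]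
    refine (hM N k _ _ f y).trans (mul_le_mul' le_self_add ?_)
    simp
  · rw [← ENNReal.tsum_mul_left]
    refine ENNReal.tsum_le_tsum fun i => ?_
    have e : fam τ0 τ1 (k + i + 1) = τ1 := by simp [fam]
    have e2 : pm (pm (dk (k + i + 1) τ1) (A (k + i + 1))) (A k) =
      pm (dk (k + i + 1) (pm (dilate (a k) ((2:ℝ) ^ (((k + i + 1 : ℕ):ℝ) - k))) τ1))
        (A (k + i + 1)) := by
      conv_lhs => rw [hA k]
      exact term_eq _ _ _ _ _
    rw [e, e2]
    refine (hM N _ _ _ f y).trans ?_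
    have e3 : ((k + i + 1 : ℕ):ℝ) - k = ((i + 1 : ℕ):ℝ) := by push_cast; ring
    have h4 : ENNReal.ofReal (C N * SN (M N) (pm (dilate (a k) ((2:ℝ) ^ (((k + i + 1 : ℕ):ℝ) - k))) τ1))
        ≤ ENNReal.ofReal (F N) * 2 ^ (-(((i + 1 : ℕ):ℝ) * (N + n))) := by
      rw [two_rpow_ofReal, ← ENNReal.ofReal_mul (hF0 N)]
      refine ENNReal.ofReal_le_ofReal ?_
      rw [hF]
      simp only
      rw [mul_assoc]
      refine mul_le_mul_of_nonneg_left ?_ (hC N)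
      refine (hDb (M N) (N + n) (a k) _ (Real.one_le_rpow (by norm_num) (by rw [e3]; positivity))).trans ?_
      rw [pow_rpow_two, ← Real.rpow_neg (by norm_num), e3]
      have := hB (M N + (N + n)) k
      have := hD (M N) (N + n)
      calc _ ≤ D (M N) (N + n) * 2 ^ (-(((i + 1 : ℕ):ℝ) * ((N + n : ℕ):ℝ))) * B (M N + (N + n)) := by
            gcongr
        _ = _ := by push_cast; ring
    have h5 : ∫⁻ z, eta (k + i + 1) N (y - z) * ‖mOp (A (k + i + 1)) f z‖ₑ ≤
        2 ^ (((i + 1 : ℕ):ℝ) * n) * ∫⁻ z, eta k N (y - z) * ‖mOp (A (k + (i + 1))) f z‖ₑ := by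
      rw [← lintegral_const_mul' _ _ (two_rpow_ne_top _)]
      refine lintegral_mono fun z => ?_
      simp only
      rw [← mul_assoc, ← e3]
      exact mul_le_mul' (eta_le (by omega) N _) le_rfl
    refine (mul_le_mul' h4 h5).trans ?_
    rw [mul_assoc, ← mul_assoc (2 ^ _) (2 ^ _), ← two_rpow_add]
    refine mul_le_mul' le_add_self (mul_le_mul' (le_of_eq ?_) le_rfl)
    congr 1; ring

end TL
end

section
namespace TL

variable {n : ℕ} {E : Type*} [NormedAddCommGroup E] [NormedSpace ℂ E] [CompleteSpace E]

lemma quot_ex (a b : Rn n → ℂ) (ha : ContDiff ℝ (⊤ : ℕ∞) a) (hb : ContDiff ℝ (⊤ : ℕ∞) b)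
    {K : Set (Rn n)} (hK : IsCompact K) (h0 : ∀ ξ, ξ ∉ K → a ξ = 0) (hb0 : ∀ ξ ∈ K, b ξ ≠ 0) :
    ∃ τ : Sch n, (∀ ξ, τ ξ * b ξ = a ξ) ∧ ∀ ξ, a ξ = 0 → τ ξ = 0 := by
  have hc : HasCompactSupport (fun ξ => a ξ / b ξ) :=
    HasCompactSupport.intro hK fun ξ hξ => by simp [h0 ξ hξ]
  have hs : ContDiff ℝ (⊤ : ℕ∞) (fun ξ => a ξ / b ξ) := by
    rw [contDiff_iff_contDiffAt]
    intro ξ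
    by_cases hξ : ξ ∈ K
    · simp only [div_eq_mul_inv]
      exact ha.contDiffAt.mul (hb.contDiffAt.inv (hb0 ξ hξ))
    · have : (fun ξ => a ξ / b ξ) =ᶠ[𝓝 ξ] fun _ => 0 := by
        filter_upwards [hK.isClosed.isOpen_compl.mem_nhds hξ] with y hy
        simp [h0 y hy]
      exact contDiffAt_const.congr_of_eventuallyEq this
  refine ⟨hc.toSchwartzMap hs, fun ξ => ?_, fun ξ h => ?_⟩
  · change a ξ / b ξ * b ξ = a ξ
    by_cases hξ : ξ ∈ K
    · exact div_mul_cancel₀ _ (hb0 ξ hξ)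
    · simp [h0 ξ hξ]
  · change a ξ / b ξ = 0
    simp [h]

lemma bump_ex (n : ℕ) {r r' : ℝ} (hr : 0 < r) (hr' : r < r') : ∃ χ : Sch n,
    (∀ ξ, ‖ξ‖ ≤ r → χ ξ = 1) ∧ ∀ ξ, r' ≤ ‖ξ‖ → χ ξ = 0 := by
  let B : ContDiffBump (0 : Rn n) := ⟨r, r', hr, hr'⟩
  have hB : ContDiff ℝ (⊤ : ℕ∞) (fun ξ => ((B ξ : ℝ) : ℂ)) :=
    Complex.ofRealCLM.contDiff.comp (B.contDiff (n := (⊤ : ℕ∞)))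
  have h1 : ∀ ξ, r' ≤ ‖ξ‖ → B ξ = 0 := fun ξ h => B.zero_of_le_dist (by simpa using h)
  obtain ⟨χ, h, -⟩ := quot_ex (fun ξ => ((B ξ : ℝ) : ℂ)) (fun _ => 1) hB contDiff_const
    (isCompact_closedBall (0 : Rn n) r') (fun ξ hξ => by
      rw [h1 ξ (by simpa using (not_le.1 (by simpa using hξ)).le)]; simp) (fun _ _ => one_ne_zero)
  refine ⟨χ, fun ξ hξ => ?_, fun ξ hξ => ?_⟩
  · have := h ξ
    rw [mul_one] at this
    rw [this, B.one_of_mem_closedBall (by simpa using hξ)]; simp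
  · have := h ξ
    rw [mul_one] at this
    rw [this, h1 ξ hξ]; simp

lemma psi_sys {ε : ℝ} (hε : 0 < ε) (Ψ ψ : Sch n)
    (hΨ : ∀ x : Rn n, ‖x‖ < 2 * ε → 0 < ‖Ψ x‖)
    (hψ : ∀ x : Rn n, ε / 2 < ‖x‖ → ‖x‖ < 2 * ε → 0 < ‖ψ x‖) :
    ∃ χ τ0 τ1 : Sch n, Sys (fun k => dk k (fam Ψ ψ k)) τ0 τ1 (fun K => dk K χ) := by
  obtain ⟨χ, h1, h0⟩ := bump_ex n (show 0 < 5 * ε / 4 by positivity)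
    (show 5 * ε / 4 < 7 * ε / 4 by linarith)
  obtain ⟨τ0, ht0, -⟩ := quot_ex (K := closedBall (0 : Rn n) (7 * ε / 4)) χ Ψ (χ.smooth ⊤)
    (Ψ.smooth ⊤) (isCompact_closedBall _ _) (fun ξ hξ => h0 ξ (by
      have : 7 * ε / 4 < ‖ξ‖ := by simpa using hξ
      exact this.le)) (fun ξ hξ => norm_pos_iff.1 (hΨ ξ (by
      have : ‖ξ‖ ≤ 7 * ε / 4 := by simpa using hξ
      linarith)))
  have e2 : ∀ ξ, dilate χ 2 ξ = χ ((2:ℝ) • ξ) := fun ξ => dilate_apply χ (by norm_num) ξ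
  have n2 : ∀ ξ : Rn n, ‖(2:ℝ) • ξ‖ = 2 * ‖ξ‖ := fun ξ => by rw [norm_smul]; simp
  have hz : ∀ ξ : Rn n, ‖ξ‖ < 5 * ε / 8 → (χ - dilate χ 2) ξ = 0 := fun ξ h => by
    rw [SchwartzMap.sub_apply, e2, h1 ξ (by linarith), h1 _ (by rw [n2]; linarith), sub_self]
  have hz' : ∀ ξ : Rn n, 7 * ε / 4 < ‖ξ‖ → (χ - dilate χ 2) ξ = 0 := fun ξ h => by
    rw [SchwartzMap.sub_apply, e2, h0 ξ (by linarith), h0 _ (by rw [n2]; linarith), sub_self]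
  obtain ⟨τ1, ht1, ht1'⟩ := quot_ex (K := closedBall (0 : Rn n) (7 * ε / 4) \ ball 0 (5 * ε / 8))
    (χ - dilate χ 2 : Sch n) ψ
    ((χ - dilate χ 2 : Sch n).smooth ⊤) (ψ.smooth ⊤) ((isCompact_closedBall _ _).diff isOpen_ball)
    (fun ξ hξ => by
      by_cases h : ‖ξ‖ ≤ 7 * ε / 4
      · refine hz ξ ?_
        simpa [h] using hξ
      · exact hz' ξ (not_le.1 h))
    (fun ξ hξ => norm_pos_iff.1 (by
      have : ‖ξ‖ ≤ 7 * ε / 4 ∧ 5 * ε / 8 ≤ ‖ξ‖ := by simpa using hξ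
      exact hψ ξ (by linarith [this.2]) (by linarith [this.1])))
  refine ⟨χ, τ0, τ1, ⟨⟨5 * ε / 8, by positivity, fun ξ h => ht1' ξ (hz ξ h)⟩, ?_, fun K => ?_,
    fun i => ?_, ⟨5 * ε / 4, by positivity, fun K ξ h => ?_⟩⟩⟩
  · ext ξ
    simp only [dk_apply, pm_apply, fam, if_true]
    exact (ht0 _).symm
  · ext ξ
    simp only [dk_apply, pm_apply, fam, SchwartzMap.add_apply, if_neg (Nat.succ_ne_zero K)]
    rw [ht1, SchwartzMap.sub_apply, e2, smul_smul]
    have : (2:ℝ) * 2 ^ (-((K + 1 : ℕ):ℝ)) = 2 ^ (-(K:ℝ)) := by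
      nth_rewrite 1 [← Real.rpow_one (2:ℝ)]
      rw [← Real.rpow_add (by norm_num)]
      congr 1; push_cast; ring
    rw [this]; ring
  · have hs := SN_nonneg i χ
    refine ⟨2 ^ i * SN i χ, by positivity, fun K ξ => ?_⟩
    rw [dk, iter_dilate _ (by positivity)]
    have hx := norm_nonneg ξ
    have h2 := le_SN (Nat.zero_le _) le_rfl χ (((2:ℝ) ^ (-(K:ℝ))) • ξ) (N := i)
    rw [pow_zero, one_mul] at h2
    have h3 : ((2:ℝ) ^ (-(K:ℝ))) ^ i ≤ 1 := pow_le_one₀ (by positivity)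
      (Real.rpow_le_one_of_one_le_of_nonpos (by norm_num) (by simp))
    calc _ ≤ 1 * (2 ^ i * SN i χ) := by gcongr
      _ ≤ _ := by rw [one_mul]; exact le_mul_of_one_le_right (by positivity) (by linarith)
  · simp only [dk_apply]
    refine h1 _ ?_
    rw [norm_smul, Real.norm_eq_abs, abs_of_pos (by positivity), Real.rpow_neg (by norm_num),
      Real.rpow_natCast, inv_mul_le_iff₀ (by positivity)]
    linarith

section phi
variable {φ : ℕ → Sch n}

lemma phi_bd (hφ : SmoothResolution n φ) (i : ℕ) : ∃ C : ℝ, 0 ≤ C ∧ ∀ (k : ℕ) (ξ : Rn n),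
    ‖iteratedFDeriv ℝ i (φ k) ξ‖ ≤ C * (((2:ℝ) ^ k)⁻¹) ^ i := by
  choose c hc using hφ.deriv_bound
  set D := ∑ α ∈ Fintype.piFinset (fun _ : Fin n => Finset.range (i + 1)), |c α| with hD
  have hD0 : 0 ≤ D := Finset.sum_nonneg fun _ _ => abs_nonneg _
  refine ⟨(n:ℝ) ^ i * D, by positivity, fun k ξ => ?_⟩
  rw [mul_assoc]
  refine iter_le (φ k) ξ i _ (by positivity) fun α hα => ?_
  refine (hc α k ξ).trans ?_
  have e : (2:ℝ) ^ (-(k:ℝ) * (mdeg α : ℝ)) = (((2:ℝ) ^ k)⁻¹) ^ i := by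
    rw [hα, Real.rpow_mul (by norm_num), Real.rpow_neg (by norm_num), Real.rpow_natCast,
      Real.rpow_natCast]
  rw [e]
  gcongr
  refine (le_abs_self _).trans ?_
  refine Finset.single_le_sum (f := fun α => |c α|) (fun _ _ => abs_nonneg _) ?_
  rw [Fintype.mem_piFinset]
  intro j
  rw [Finset.mem_range, Nat.lt_succ_iff, ← hα]
  exact Finset.single_le_sum (f := α) (fun _ _ => Nat.zero_le _) (Finset.mem_univ j)

lemma phi_lo (hφ : SmoothResolution n φ) {k : ℕ} (hk : 0 < k) {ξ : Rn n} (h : ‖ξ‖ < 2 ^ k / 2) : φ k ξ = 0 := by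
  by_contra h1
  have := (hφ.suppj k hk h1).1
  rw [Real.rpow_sub_one (by norm_num), Real.rpow_natCast] at this
  linarith

lemma phi_hi (hφ : SmoothResolution n φ) (k : ℕ) {ξ : Rn n} (h : 2 ^ k * 2 < ‖ξ‖) : φ k ξ = 0 := by
  by_contra h1
  rcases Nat.eq_zero_or_pos k with rfl | hk
  · have : ‖ξ‖ ≤ 2 := hφ.supp0 h1
    rw [pow_zero] at h; linarith
  · have := (hφ.suppj k hk h1).2
    rw [Real.rpow_add_one (by norm_num), Real.rpow_natCast] at this
    linarith

lemma phi_bd' (hφ : SmoothResolution n φ) (i : ℕ) : ∃ C : ℝ, 0 ≤ C ∧ ∀ (k : ℕ) (ξ : Rn n),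
    ‖iteratedFDeriv ℝ i (φ k) ξ‖ ≤ C * (1 + ‖ξ‖) * (1 / 2) ^ k := by
  obtain ⟨C, hC, h⟩ := phi_bd hφ i
  refine ⟨2 * C, by positivity, fun k ξ => ?_⟩
  have hx := norm_nonneg ξ
  have e : ((1:ℝ) / 2) ^ k = (2 ^ k)⁻¹ := by rw [one_div, inv_pow]
  rw [e]
  rcases Nat.eq_zero_or_pos i with rfl | hi
  · have h1 := h k ξ
    rw [pow_zero, mul_one] at h1
    rcases Nat.eq_zero_or_pos k with rfl | hk
    · simp only [pow_zero, inv_one, mul_one]; nlinarith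
    · rcases lt_or_ge ‖ξ‖ (2 ^ k / 2) with hlt | hge
      · rw [norm_iteratedFDeriv_zero, phi_lo hφ hk hlt]
        simp only [norm_zero]; positivity
      · refine h1.trans ?_
        rw [le_mul_inv_iff₀ (by positivity)]
        nlinarith
  · refine (h k ξ).trans ?_
    have h2 : (((2:ℝ) ^ k)⁻¹) ^ i ≤ (((2:ℝ) ^ k)⁻¹) ^ 1 :=
      pow_le_pow_of_le_one (by positivity) (inv_le_one_of_one_le₀ (one_le_pow₀ (by norm_num))) hi
    rw [pow_one] at h2
    gcongr ?_ * ?_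
    nlinarith

lemma phi_sys (hφ : SmoothResolution n φ) : ∃ τ0 τ1 : Sch n, Sys φ τ0 τ1 (fun K => ∑ k ∈ Finset.range (K + 1), φ k) ∧
    ∀ k, φ k = pm (dk k (fam τ0 τ1 k)) (φ k) := by
  obtain ⟨χ, h1, h0⟩ := bump_ex n (show (0:ℝ) < 2 by norm_num) (show (2:ℝ) < 3 by norm_num)
  obtain ⟨χ', h1', h0'⟩ := bump_ex n (show (0:ℝ) < 1/8 by norm_num) (show (1/8:ℝ) < 1/4 by norm_num)
  have key : ∀ k, φ k = pm (dk k (fam χ (χ - χ') k)) (φ k) := by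
    intro k
    ext ξ
    rw [pm_apply, dk_apply]
    by_cases hz : φ k ξ = 0
    · simp [hz]
    have e : ‖(2:ℝ) ^ (-(k:ℝ)) • ξ‖ = ‖ξ‖ / 2 ^ k := by
      rw [norm_smul, Real.norm_eq_abs, abs_of_pos (by positivity), Real.rpow_neg (by norm_num),
      Real.rpow_natCast, inv_mul_eq_div]
    have hhi : ‖(2:ℝ) ^ (-(k:ℝ)) • ξ‖ ≤ 2 := by
      rw [e, div_le_iff₀ (by positivity)]
      by_contra h
      exact hz (phi_hi hφ k (by linarith))
    unfold fam
    split_ifs with hk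
    · rw [h1 _ hhi, one_mul]
    · rw [SchwartzMap.sub_apply, h1 _ hhi, h0', sub_zero, one_mul]
      rw [e, le_div_iff₀ (by positivity)]
      by_contra h
      have : (0:ℝ) < 2 ^ k := by positivity
      exact hz (phi_lo hφ (Nat.pos_of_ne_zero hk) (by linarith))
  refine ⟨χ, χ - χ', ⟨⟨1/8, by norm_num, fun ξ h => ?_⟩, ?_, fun K => ?_, fun i => ?_,
    ⟨1, one_pos, fun K ξ h => ?_⟩⟩, key⟩
  · rw [SchwartzMap.sub_apply, h1 ξ (by linarith), h1' ξ h.le, sub_self]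
  · rw [← key]; simp
  · rw [← key]; rw [Finset.sum_range_succ _ (K + 1)]
  · obtain ⟨C, hC, hb⟩ := phi_bd' hφ i
    refine ⟨C * 2, by positivity, fun K ξ => ?_⟩
    have e : (⇑(∑ k ∈ Finset.range (K + 1), φ k) : Rn n → ℂ) =
        fun x => ∑ k ∈ Finset.range (K + 1), φ k x := by
      funext x; simp [SchwartzMap.sum_apply]
    rw [e, iteratedFDeriv_sum (fun k _ => (φ k).smooth i)]
    rw [Finset.sum_apply]
    refine (norm_sum_le _ _).trans ?_
    have hx := norm_nonneg ξ
    calc _ ≤ ∑ k ∈ Finset.range (K + 1), C * (1 + ‖ξ‖) * (1 / 2) ^ k :=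
          Finset.sum_le_sum fun k _ => hb k ξ
      _ = C * (1 + ‖ξ‖) * ∑ k ∈ Finset.range (K + 1), (1 / 2 : ℝ) ^ k := by rw [Finset.mul_sum]
      _ ≤ C * (1 + ‖ξ‖) * 2 := by gcongr; exact sum_geometric_two_le _
      _ = _ := by ring
  · rw [SchwartzMap.sum_apply, ← hφ.sum_eq ξ]
    symm
    refine tsum_eq_sum fun k hk => phi_lo hφ ?_ ?_
    · simp at hk; omega
    · have hk' : K + 1 ≤ k := by simpa using hk
      have : (2:ℝ) ^ (K + 1) ≤ 2 ^ k := pow_le_pow_right₀ (by norm_num) hk'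
      rw [pow_succ] at this
      linarith

lemma dk_dil (k : ℕ) (a : Sch n) : dk k (dilate a ((2:ℝ) ^ k)) = a := by
  ext x
  rw [dk_apply, dilate_apply _ (by positivity), smul_smul, Real.rpow_neg (by norm_num),
    Real.rpow_natCast, mul_inv_cancel₀ (by positivity), one_smul]

lemma mu_bd (hφ : SmoothResolution n φ) (N : ℕ) : ∃ C : ℝ, ∀ j, SN N (dilate (φ j) ((2:ℝ) ^ j)) ≤ C := by
  choose C hC hb using phi_bd hφ
  refine ⟨3 ^ N * ∑ i ∈ Finset.range (N + 1), C i, fun j => ?_⟩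
  have h0 : 0 ≤ ∑ i ∈ Finset.range (N + 1), C i := Finset.sum_nonneg fun i _ => hC i
  refine SN_le' (by positivity) fun i hi x => ?_
  rw [iter_dilate _ (by positivity)]
  rcases le_or_gt ‖x‖ 2 with hx | hx
  · have h1 := hb i j ((2:ℝ) ^ j • x)
    have h2 : (2 ^ j : ℝ) ^ i * ‖iteratedFDeriv ℝ i (φ j) ((2:ℝ) ^ j • x)‖ ≤ C i := by
      calc _ ≤ (2 ^ j : ℝ) ^ i * (C i * (((2:ℝ) ^ j)⁻¹) ^ i) := by gcongr
        _ = C i := by rw [inv_pow]; field_simp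
    have h3 : C i ≤ ∑ i ∈ Finset.range (N + 1), C i :=
      Finset.single_le_sum (fun i _ => hC i) (Finset.mem_range.2 (by omega))
    have hn := norm_nonneg x
    gcongr
    · linarith
    · exact h2.trans h3
  · have h1 : iteratedFDeriv ℝ i (φ j) ((2:ℝ) ^ j • x) = 0 := by
      by_contra h
      have h2 := support_iteratedFDeriv_subset (𝕜 := ℝ) (f := φ j) i h
      have h3 : tsupport (φ j) ⊆ closedBall (0 : Rn n) (2 ^ j * 2) := by
        refine closure_minimal (fun ξ hξ => ?_) isClosed_closedBall
        rw [mem_closedBall_zero_iff]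
        by_contra h4
        exact hξ (phi_hi hφ j (not_le.1 h4))
      have h4 := h3 h2
      rw [mem_closedBall_zero_iff, norm_smul, norm_pow, Real.norm_ofNat] at h4
      have := le_of_mul_le_mul_left h4 (by positivity)
      linarith
    rw [h1]; simp; positivity

lemma mu_van (hφ : SmoothResolution n φ) (j : ℕ) (hj : 0 < j) (i : ℕ) :
    iteratedFDeriv ℝ i (dilate (φ j) ((2:ℝ) ^ j)) 0 = 0 := by
  refine iter_zero_of_ball _ (c := 1 / 2) (fun ξ h => ?_) i (by simp)
  rw [dilate_apply _ (by positivity)]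
  refine phi_lo hφ hj ?_
  rw [norm_smul, norm_pow, Real.norm_ofNat]
  have : (0:ℝ) < 2 ^ j := by positivity
  nlinarith

end phi

lemma fam_bd (a b : Sch n) (N : ℕ) : ∃ C : ℝ, ∀ j, SN N (fam a b j) ≤ C :=
  ⟨_, fun j => SN_fam N a b j⟩

lemma meas_mOp (A : Sch n) (f : TDist n E) : Measurable fun z => ‖mOp A f z‖ₑ :=
  (continuous_enorm.comp (mOp_cont A f)).measurable

end TL
end

section
namespace TL

variable {n : ℕ} {E : Type*} [NormedAddCommGroup E] [NormedSpace ℂ E] [CompleteSpace E]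

/-- the `p`-th power of the mixed norm for a family of multipliers -/
def XI (s p : ℝ) (q : ℝ≥0∞) (A : ℕ → Sch n) (f : TDist n E) : ℝ≥0∞ :=
  ∫⁻ x, lqSum q (fun j => 2 ^ ((j:ℝ) * s) * ‖mOp (A j) f x‖ₑ) ^ p

lemma dir1 {s p : ℝ} (hp : 0 < p) {q : ℝ≥0∞} (hq : 0 < q) (Ψ ψ : Sch n) (R : ℕ) (hR : s < R)
    (hv : ∀ i < R, iteratedFDeriv ℝ i ψ 0 = 0) {φ : ℕ → Sch n} (hφ : SmoothResolution n φ) :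
    ∃ C : ℝ≥0∞, C < ∞ ∧ ∀ f : TDist n E,
      XI s p q (fun k => dk k (fam Ψ ψ k)) f ≤ C * XI s p q φ f := by
  obtain ⟨τ0, τ1, hS, hA⟩ := phi_sys hφ
  obtain ⟨Cb, hCb, hb⟩ := bj_est (E := E) hS s R (fam Ψ ψ) (fam_bd Ψ ψ) (fun j hj i hi => by
    rw [fam, if_neg hj.ne']; exact hv i hi)
  obtain ⟨CN, hCN, hN⟩ := hypN_phi (E := E) hA
  obtain ⟨C, hC, h⟩ := main_abs n s hp hq (δ := (R:ℝ) - s) (by linarith) Cb CN hCb hCN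
  refine ⟨C, hC, fun f => ?_⟩
  refine h (fun k z => ‖mOp (φ k) f z‖ₑ) (fun k z => ‖mOp (dk k (fam Ψ ψ k)) f z‖ₑ)
    (fun k => meas_mOp _ f) (hN f) ?_ (hb f)
  have := hypT_of _ (mu_bd hφ) f
  simpa only [dk_dil] using this

lemma dir2 {s p : ℝ} (hp : 0 < p) {q : ℝ≥0∞} (hq : 0 < q) {ε : ℝ} (hε : 0 < ε) (Ψ ψ : Sch n)
    (hΨ : ∀ x : Rn n, ‖x‖ < 2 * ε → 0 < ‖Ψ x‖)
    (hψ : ∀ x : Rn n, ε / 2 < ‖x‖ → ‖x‖ < 2 * ε → 0 < ‖ψ x‖)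
    {φ : ℕ → Sch n} (hφ : SmoothResolution n φ) :
    ∃ C : ℝ≥0∞, C < ∞ ∧ ∀ f : TDist n E,
      XI s p q φ f ≤ C * XI s p q (fun k => dk k (fam Ψ ψ k)) f := by
  obtain ⟨χ, τ0, τ1, hS⟩ := psi_sys hε Ψ ψ hΨ hψ
  obtain ⟨R, hR⟩ := exists_nat_gt s
  obtain ⟨Cb, hCb, hb⟩ := bj_est (E := E) hS s R (fun j => dilate (φ j) ((2:ℝ) ^ j)) (mu_bd hφ)
    (fun j hj i _ => mu_van hφ j hj i)
  obtain ⟨CN, hCN, hN⟩ := hypN_Psi (E := E) hS χ (fun _ => rfl) (fam Ψ ψ) (fun _ => rfl)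
    (fam_bd Ψ ψ)
  obtain ⟨C, hC, h⟩ := main_abs n s hp hq (δ := (R:ℝ) - s) (by linarith) Cb CN hCb hCN
  refine ⟨C, hC, fun f => ?_⟩
  refine h (fun k z => ‖mOp (dk k (fam Ψ ψ k)) f z‖ₑ) (fun k z => ‖mOp (φ k) f z‖ₑ)
    (fun k => meas_mOp _ f) (hN f) (hypT_of _ (fam_bd Ψ ψ) f) ?_
  simpa only [dk_dil] using hb f

lemma add_rpow_le2 (a b : ℝ≥0∞) {r : ℝ} (hr : 0 ≤ r) : (a + b) ^ r ≤ 2 ^ r * (a ^ r + b ^ r) := by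
  rcases le_total a b with h | h
  · calc (a + b) ^ r ≤ (2 * b) ^ r := by
          refine ENNReal.rpow_le_rpow ?_ hr
          rw [two_mul]; gcongr
      _ = 2 ^ r * b ^ r := ENNReal.mul_rpow_of_nonneg _ _ hr
      _ ≤ _ := mul_le_mul' le_rfl le_add_self
  · calc (a + b) ^ r ≤ (2 * a) ^ r := by
          refine ENNReal.rpow_le_rpow ?_ hr
          rw [two_mul]; gcongr
      _ = 2 ^ r * a ^ r := ENNReal.mul_rpow_of_nonneg _ _ hr
      _ ≤ _ := mul_le_mul' le_rfl le_self_add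

lemma lq_zero_le {q : ℝ≥0∞} (hq : 0 < q) (a : ℕ → ℝ≥0∞) (j : ℕ) : a j ≤ lqSum q a := by
  unfold lqSum
  split_ifs with h
  · exact le_iSup a j
  · have hq' : 0 < q.toReal := ENNReal.toReal_pos hq.ne' h
    calc a j = (a j ^ q.toReal) ^ (1 / q.toReal) := by
          rw [← ENNReal.rpow_mul, mul_one_div_cancel hq'.ne', ENNReal.rpow_one]
      _ ≤ _ := ENNReal.rpow_le_rpow (ENNReal.le_tsum (f := fun j => a j ^ q.toReal) j) (by positivity)

lemma lq_shift_le (q : ℝ≥0∞) (a : ℕ → ℝ≥0∞) : lqSum q (fun j => a (j + 1)) ≤ lqSum q a := by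
  unfold lqSum
  split_ifs with h
  · exact iSup_le fun j => le_iSup a (j + 1)
  · refine ENNReal.rpow_le_rpow ?_ (by positivity)
    rw [tsum_eq_zero_add' (f := fun j => a j ^ q.toReal) ENNReal.summable]
    exact le_add_self

lemma lq_split {q : ℝ≥0∞} (hq : 0 < q) : ∃ C : ℝ≥0∞, C < ∞ ∧ ∀ a : ℕ → ℝ≥0∞,
    lqSum q a ≤ C * (a 0 + lqSum q (fun j => a (j + 1))) := by
  by_cases h : q = ∞
  · refine ⟨1, by simp, fun a => ?_⟩
    rw [one_mul, lqSum, lqSum, if_pos h, if_pos h]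
    refine iSup_le fun j => ?_
    cases j with
    | zero => exact le_self_add
    | succ j => exact (le_iSup (fun j => a (j + 1)) j).trans le_add_self
  · have hq' : 0 < q.toReal := ENNReal.toReal_pos hq.ne' h
    refine ⟨2 ^ (1 / q.toReal), (two_rpow_ne_top _).lt_top, fun a => ?_⟩
    rw [lqSum, lqSum, if_neg h, if_neg h,
      tsum_eq_zero_add' (f := fun j => a j ^ q.toReal) ENNReal.summable]
    refine (add_rpow_le2 _ _ (by positivity)).trans (mul_le_mul' le_rfl ?_)
    rw [← ENNReal.rpow_mul, mul_one_div_cancel hq'.ne', ENNReal.rpow_one]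

lemma dk_succ (ψ : Sch n) (Ψ : Sch n) (j : ℕ) :
    dk (j + 1) (fam Ψ ψ (j + 1)) = dilate ψ ((2:ℝ) ^ (-((j:ℝ) + 1))) := by
  simp [dk, fam]

lemma dk_zero (ψ : Sch n) (Ψ : Sch n) : dk 0 (fam Ψ ψ 0) = Ψ := by
  ext x; simp [dk_apply, fam]

lemma psi_eq (s : ℝ) {p : ℝ≥0∞} (hp : 0 < p) (hp' : p ≠ ∞) (q : ℝ≥0∞) (Ψ ψ : Sch n) (f : TDist n E) :
    triebelPsiNorm s p q Ψ ψ f = (∫⁻ x, ‖mOp Ψ f x‖ₑ ^ p.toReal) ^ (1 / p.toReal) +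
      (∫⁻ x, lqSum q (fun j => (fun j : ℕ => 2 ^ ((j:ℝ) * s) * ‖mOp (dk j (fam Ψ ψ j)) f x‖ₑ) (j + 1))
        ^ p.toReal) ^ (1 / p.toReal) := by
  rw [triebelPsiNorm, eLpNorm_eq_lintegral_rpow_enorm_toReal hp.ne' hp', lpNormENN, if_neg hp']
  simp only [dk_succ, enorm_eq_nnnorm, Nat.cast_add, Nat.cast_one]

lemma psi_le (s : ℝ) {p : ℝ≥0∞} (hp : 0 < p) (hp' : p ≠ ∞) {q : ℝ≥0∞} (hq : 0 < q) (Ψ ψ : Sch n)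
    (f : TDist n E) :
    triebelPsiNorm s p q Ψ ψ f ≤
      2 * XI s p.toReal q (fun k => dk k (fam Ψ ψ k)) f ^ (1 / p.toReal) := by
  rw [psi_eq s hp hp', two_mul]
  refine add_le_add ?_ ?_
  · refine ENNReal.rpow_le_rpow (lintegral_mono fun x => ?_) (by positivity)
    refine ENNReal.rpow_le_rpow ?_ (by positivity)
    refine le_trans (le_of_eq ?_) (lq_zero_le hq _ 0)
    simp [dk_zero]
  · refine ENNReal.rpow_le_rpow (lintegral_mono fun x => ?_) (by positivity)
    exact ENNReal.rpow_le_rpow (lq_shift_le q _) (by positivity)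

lemma le_psi (n : ℕ) (s : ℝ) {p : ℝ≥0∞} (hp : 0 < p) (hp' : p ≠ ∞) {q : ℝ≥0∞} (hq : 0 < q) :
    ∃ C : ℝ≥0∞, C < ∞ ∧ ∀ (Ψ ψ : Sch n) (f : TDist n E),
    XI s p.toReal q (fun k => dk k (fam Ψ ψ k)) f ^ (1 / p.toReal) ≤
      C * triebelPsiNorm s p q Ψ ψ f := by
  obtain ⟨C, hC, h⟩ := lq_split hq
  have hpr : 0 < p.toReal := ENNReal.toReal_pos hp.ne' hp'
  refine ⟨C * 2 * 2 ^ (1 / p.toReal), ENNReal.mul_lt_top (ENNReal.mul_lt_top hC (by simp))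
    (two_rpow_ne_top _).lt_top, fun Ψ ψ f => ?_⟩
  rw [psi_eq s hp hp']
  set r := p.toReal
  set a : Rn n → ℕ → ℝ≥0∞ := fun x j => 2 ^ ((j:ℝ) * s) * ‖mOp (dk j (fam Ψ ψ j)) f x‖ₑ with ha
  have ha0 : ∀ x, a x 0 = ‖mOp Ψ f x‖ₑ := fun x => by simp [ha, dk_zero]
  have hcr : ∀ c : ℝ≥0∞, (c ^ r) ^ (1 / r) = c := fun c => by
    rw [← ENNReal.rpow_mul, mul_one_div_cancel hpr.ne', ENNReal.rpow_one]
  have h1 : XI s r q (fun k => dk k (fam Ψ ψ k)) f ≤ (C * 2) ^ r *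
      ((∫⁻ x, ‖mOp Ψ f x‖ₑ ^ r) + ∫⁻ x, lqSum q (fun j => a x (j + 1)) ^ r) := by
    have hm : Measurable fun x => ‖mOp Ψ f x‖ₑ ^ r := (meas_mOp Ψ f).pow_const r
    have hCt : (C * 2) ^ r ≠ ∞ := ENNReal.rpow_ne_top_of_nonneg hpr.le
      (ENNReal.mul_ne_top hC.ne (by simp))
    rw [← lintegral_add_left hm, ← lintegral_const_mul' _ _ hCt]
    refine lintegral_mono fun x => ?_
    calc lqSum q (a x) ^ r ≤ (C * (a x 0 + lqSum q (fun j => a x (j + 1)))) ^ r :=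
          ENNReal.rpow_le_rpow (h (a x)) hpr.le
      _ = C ^ r * (a x 0 + lqSum q (fun j => a x (j + 1))) ^ r :=
          ENNReal.mul_rpow_of_nonneg _ _ hpr.le
      _ ≤ C ^ r * (2 ^ r * (a x 0 ^ r + lqSum q (fun j => a x (j + 1)) ^ r)) :=
          mul_le_mul' le_rfl (add_rpow_le2 _ _ hpr.le)
      _ = _ := by rw [← mul_assoc, ← ENNReal.mul_rpow_of_nonneg _ _ hpr.le, ha0]
  refine (ENNReal.rpow_le_rpow h1 (by positivity)).trans ?_
  rw [ENNReal.mul_rpow_of_nonneg _ _ (by positivity), hcr, mul_assoc (C * 2)]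
  exact mul_le_mul' le_rfl (add_rpow_le2 _ _ (r := 1 / r) (by positivity))

lemma triebel_eq (s : ℝ) {p : ℝ≥0∞} (hp' : p ≠ ∞) (q : ℝ≥0∞) (φ : ℕ → Sch n) (f : TDist n E) :
    triebelNorm s p q φ f = XI s p.toReal q φ f ^ (1 / p.toReal) := by
  rw [triebelNorm, lpNormENN, if_neg hp']; rfl

lemma final {s : ℝ} {p : ℝ≥0∞} (hp : 0 < p) (hp' : p ≠ ∞) {q : ℝ≥0∞} (hq : 0 < q)
    {S : ℤ} (hS : -1 ≤ S) (hSs : ⌊s⌋ ≤ S) {ε : ℝ} (hε : 0 < ε) (Ψ ψ : Sch n)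
    (hΨ : ∀ x : Rn n, ‖x‖ < 2 * ε → 0 < ‖Ψ x‖)
    (hψ : ∀ x : Rn n, ε / 2 < ‖x‖ → ‖x‖ < 2 * ε → 0 < ‖ψ x‖)
    (hmom : ∀ α : Fin n → ℕ, (mdeg α : ℤ) ≤ S → mderiv α (fun y => ψ y) 0 = 0)
    {φ : ℕ → Sch n} (hφ : SmoothResolution n φ) :
    ∃ C : ℝ≥0∞, C < ∞ ∧ ∀ f : TDist n E,
      triebelNorm s p q φ f ≤ C * triebelPsiNorm s p q Ψ ψ f ∧
      triebelPsiNorm s p q Ψ ψ f ≤ C * triebelNorm s p q φ f := by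
  have hpr : 0 < p.toReal := ENNReal.toReal_pos hp.ne' hp'
  have hRS : (((S + 1).toNat : ℕ) : ℤ) = S + 1 := Int.toNat_of_nonneg (by omega)
  have hR : s < ((S + 1).toNat : ℕ) := by
    have h1 := Int.lt_floor_add_one s
    have h2 : ((⌊s⌋ : ℤ) : ℝ) ≤ S := by exact_mod_cast hSs
    have h3 : (((S + 1).toNat : ℕ) : ℝ) = S + 1 := by exact_mod_cast hRS
    rw [h3]; linarith
  have hv : ∀ i < (S + 1).toNat, iteratedFDeriv ℝ i ψ 0 = 0 := fun i hi => by
    have h1 := iter_le ψ 0 i 0 le_rfl (fun α hα => by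
      rw [hmom α (by rw [hα]; omega), norm_zero])
    rw [mul_zero] at h1
    exact norm_le_zero_iff.1 h1
  obtain ⟨C1, hC1, h1⟩ := dir1 (E := E) hpr hq Ψ ψ _ hR hv hφ
  obtain ⟨C2, hC2, h2⟩ := dir2 (E := E) (s := s) hpr hq hε Ψ ψ hΨ hψ hφ
  obtain ⟨C3, hC3, h3⟩ := le_psi (E := E) n s hp hp' hq
  have hi : 0 ≤ 1 / p.toReal := by positivity
  refine ⟨C2 ^ (1 / p.toReal) * C3 + 2 * C1 ^ (1 / p.toReal), ?_, fun f => ⟨?_, ?_⟩⟩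
  · refine ENNReal.add_lt_top.2 ⟨ENNReal.mul_lt_top ?_ hC3, ENNReal.mul_lt_top (by simp) ?_⟩
    · exact ENNReal.rpow_lt_top_of_nonneg hi hC2.ne
    · exact ENNReal.rpow_lt_top_of_nonneg hi hC1.ne
  · rw [triebel_eq s hp']
    calc _ ≤ (C2 * XI s p.toReal q (fun k => dk k (fam Ψ ψ k)) f) ^ (1 / p.toReal) :=
          ENNReal.rpow_le_rpow (h2 f) hi
      _ = C2 ^ (1 / p.toReal) * XI s p.toReal q (fun k => dk k (fam Ψ ψ k)) f ^ (1 / p.toReal) :=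
          ENNReal.mul_rpow_of_nonneg _ _ hi
      _ ≤ C2 ^ (1 / p.toReal) * (C3 * triebelPsiNorm s p q Ψ ψ f) := mul_le_mul' le_rfl (h3 Ψ ψ f)
      _ = C2 ^ (1 / p.toReal) * C3 * triebelPsiNorm s p q Ψ ψ f := (mul_assoc _ _ _).symm
      _ ≤ _ := mul_le_mul' le_self_add le_rfl
  · rw [triebel_eq s hp']
    refine (psi_le s hp hp' hq Ψ ψ f).trans ?_
    calc _ ≤ 2 * (C1 * XI s p.toReal q φ f) ^ (1 / p.toReal) :=
          mul_le_mul' le_rfl (ENNReal.rpow_le_rpow (h1 f) hi)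
      _ = 2 * C1 ^ (1 / p.toReal) * XI s p.toReal q φ f ^ (1 / p.toReal) := by
          rw [ENNReal.mul_rpow_of_nonneg _ _ hi, mul_assoc]
      _ ≤ _ := mul_le_mul' le_add_self le_rfl

lemma final2 {α : Type*} {X Y : α → ℝ≥0∞} {C : ℝ≥0∞} (hC : C < ∞)
    (h : ∀ f, X f ≤ C * Y f ∧ Y f ≤ C * X f) :
    (∃ c₁ : ℝ, 0 < c₁ ∧ ∃ c₂ : ℝ, 0 < c₂ ∧ ∀ f, X f < ∞ →
      ENNReal.ofReal c₁ * X f ≤ Y f ∧ Y f ≤ ENNReal.ofReal c₂ * X f) ∧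
    ∀ f, X f < ∞ ↔ Y f < ∞ := by
  set D : ℝ := C.toReal + 1 with hD
  have hD0 : 0 < D := by have := ENNReal.toReal_nonneg (a := C); linarith
  have hCD : C ≤ ENNReal.ofReal D := by
    rw [← ENNReal.ofReal_toReal hC.ne]
    exact ENNReal.ofReal_le_ofReal (by rw [hD]; linarith)
  refine ⟨⟨D⁻¹, inv_pos.2 hD0, D, hD0, fun f _ => ⟨?_, ?_⟩⟩, fun f => ⟨fun hx => ?_, fun hx => ?_⟩⟩
  · have h1 : X f ≤ ENNReal.ofReal D * Y f := (h f).1.trans (mul_le_mul' hCD le_rfl)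
    calc ENNReal.ofReal D⁻¹ * X f ≤ ENNReal.ofReal D⁻¹ * (ENNReal.ofReal D * Y f) :=
          mul_le_mul' le_rfl h1
      _ = Y f := by
          rw [← mul_assoc, ← ENNReal.ofReal_mul (by positivity), inv_mul_cancel₀ hD0.ne']; simp
  · exact (h f).2.trans (mul_le_mul' hCD le_rfl)
  · exact (h f).2.trans_lt (ENNReal.mul_lt_top hC hx)
  · exact (h f).1.trans_lt (ENNReal.mul_lt_top hC hx)

end TL
end

/-- characterization of `F^s_{p,q}(E)` via `Ψ, ψ` (non-maximal version). -/
theorem statement2 (n : ℕ) (E : Type*) [NormedAddCommGroup E] [NormedSpace ℂ E]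
    [CompleteSpace E] (s : ℝ) (p q : ℝ≥0∞) (hp : 0 < p) (hp' : p ≠ ∞) (hq : 0 < q)
    (S : ℤ) (hS : -1 ≤ S) (hSs : ⌊s⌋ ≤ S)
    (ε : ℝ) (hε : 0 < ε) (Ψ ψ : Sch n)
    (hΨ : ∀ x : Rn n, ‖x‖ < 2 * ε → 0 < ‖Ψ x‖)
    (hψ : ∀ x : Rn n, ε / 2 < ‖x‖ → ‖x‖ < 2 * ε → 0 < ‖ψ x‖)
    (hmom : ∀ α : Fin n → ℕ, (mdeg α : ℤ) ≤ S → mderiv α (fun y => ψ y) 0 = 0)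
    (φ : ℕ → Sch n) (hφ : SmoothResolution n φ) :
    (∃ c₁ > (0 : ℝ), ∃ c₂ > (0 : ℝ), ∀ f : TDist n E, triebelNorm s p q φ f < ∞ →
      ENNReal.ofReal c₁ * triebelNorm s p q φ f ≤ triebelPsiNorm s p q Ψ ψ f ∧
        triebelPsiNorm s p q Ψ ψ f ≤ ENNReal.ofReal c₂ * triebelNorm s p q φ f) ∧
    ∀ f : TDist n E, triebelNorm s p q φ f < ∞ ↔ triebelPsiNorm s p q Ψ ψ f < ∞ := by
  obtain ⟨C, hC, h⟩ := TL.final (E := E) hp hp' hq hS hSs hε Ψ ψ hΨ hψ hmom hφ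
  exact TL.final2 hC h

end
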